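/- Let 1<p<∞, ω a Muckenhoupt A_p weight on ℝⁿ, and T a θ-type Calderón–Zygmund operator with kernel K, θ satisfying the Dini condition. With T_j f(x) = ∫_{|x−y|>2^j} K(x,y) f(y) dy for j ∈ ℤ, there is a constant C such that ‖ sup_{j∈ℤ} |T_j f| ‖_{L^p(ω)} ≤ C ‖f‖_{L^p(ω)} for all f ∈ L^p(ω). -/

import Mathlib

open MeasureTheory Metric Filter Set
open scoped ENNReal Topology

noncomputable section

abbrev Rn (n : ℕ) := EuclideanSpace ℝ (Fin n)

/-- θ is a modulus of continuity as in the paper: continuous, increasing,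
subadditive on `[0,1]`, nonnegative, with `θ 0 = 0`. -/
def IsModulus (θ : ℝ → ℝ) : Prop :=
  ContinuousOn θ (Icc 0 1) ∧ MonotoneOn θ (Icc 0 1) ∧
    (∀ s t : ℝ, 0 ≤ s → 0 ≤ t → s + t ≤ 1 → θ (s + t) ≤ θ s + θ t) ∧
    θ 0 = 0 ∧ ∀ t ∈ Icc (0:ℝ) 1, 0 ≤ θ t

/-- The Dini condition `∫₀¹ θ(t)/t dt < ∞`. -/
def DiniCondition (θ : ℝ → ℝ) : Prop :=
  IntegrableOn (fun t => θ t / t) (Ioc (0:ℝ) 1)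

/-- `K` is a θ-type kernel with size constant `C₀`. -/
def IsThetaKernel (n : ℕ) (θ : ℝ → ℝ) (C₀ : ℝ) (K : Rn n → Rn n → ℝ) : Prop :=
  (∀ x y : Rn n, x ≠ y → |K x y| ≤ C₀ / ‖x - y‖ ^ n) ∧
    ∀ x x' y : Rn n, x ≠ y → 2 * ‖x - x'‖ ≤ ‖x - y‖ →
      |K x y - K x' y| + |K y x - K y x'| ≤ θ (‖x - x'‖ / ‖x - y‖) / ‖x - y‖ ^ n

/-- The open cube centered at `c` with sidelength `r`. -/
def cube {n : ℕ} (c : Rn n) (r : ℝ) : Set (Rn n) := {x | ∀ i, |x i - c i| < r / 2}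

/-- `ω` is a Muckenhoupt `A_p` weight (over cubes). -/
def IsAp (n : ℕ) (p : ℝ) (ω : Rn n → ℝ) : Prop :=
  (∀ᵐ x : Rn n, 0 < ω x) ∧ LocallyIntegrable ω volume ∧
    ∃ A : ℝ≥0∞, A ≠ ⊤ ∧ ∀ (c : Rn n) (r : ℝ), 0 < r →
      ((∫⁻ x in cube c r, ENNReal.ofReal (ω x)) / ENNReal.ofReal (r ^ n)) *
        (((∫⁻ x in cube c r, ENNReal.ofReal (ω x ^ (1 - p / (p - 1)))) /
          ENNReal.ofReal (r ^ n)) ^ (p - 1)) ≤ A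

/-- The measure `ω(x) dx`. -/
def wMeasure (n : ℕ) (ω : Rn n → ℝ) : Measure (Rn n) :=
  (volume : Measure (Rn n)).withDensity fun x => ENNReal.ofReal (ω x)

/-- Hardy–Littlewood maximal function, `ℝ≥0∞`-valued. -/
def maximal {n : ℕ} (f : Rn n → ℝ) (x : Rn n) : ℝ≥0∞ :=
  ⨆ (r : ℝ) (_ : 0 < r),
    (volume (ball x r))⁻¹ * ∫⁻ y in ball x r, ENNReal.ofReal |f y|

/-- Mean oscillation of `b` over the ball `B(c,r)`. -/
def oscBall {n : ℕ} (b : Rn n → ℝ) (c : Rn n) (r : ℝ) : ℝ :=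
  ⨍ x in ball c r, |b x - ⨍ y in ball c r, b y|

/-- `b ∈ BMO(ℝⁿ)`. -/
def IsBMO {n : ℕ} (b : Rn n → ℝ) : Prop :=
  LocallyIntegrable b volume ∧ ∃ C : ℝ, ∀ c r, 0 < r → oscBall b c r ≤ C

/-- The BMO norm of `b`. -/
def bmoNorm {n : ℕ} (b : Rn n → ℝ) : ℝ :=
  ⨆ c : Rn n, ⨆ r : {r : ℝ // 0 < r}, oscBall b c r.1

/-- `b ∈ VMO(ℝⁿ)`: `b ∈ BMO` and its oscillation over balls of a fixed size tends to `0`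
both as the size tends to `0` and as it tends to `∞`. -/
def IsVMO {n : ℕ} (b : Rn n → ℝ) : Prop :=
  IsBMO b ∧
    Tendsto (fun r : ℝ => ⨆ c : Rn n, oscBall b c r) (𝓝[>] 0) (𝓝 0) ∧
    Tendsto (fun r : ℝ => ⨆ c : Rn n, oscBall b c r) atTop (𝓝 0)

/-- `T` is an operator, bounded on `L²`, associated with the kernel `K`:
for smooth compactly supported `f` and a.e. `x` outside the support of `f`,
`T f x = ∫ K x y * f y dy`. -/
def IsCZO (n : ℕ) (K : Rn n → Rn n → ℝ)
    (T : Lp ℝ 2 (volume : Measure (Rn n)) →L[ℝ] Lp ℝ 2 (volume : Measure (Rn n))) : Prop :=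
  ∀ (f : Rn n → ℝ) (hf : MemLp f 2 (volume : Measure (Rn n))),
    ContDiff ℝ (⊤ : ℕ∞) f → HasCompactSupport f →
      ∀ᵐ x : Rn n, x ∉ tsupport f → (T (hf.toLp f) : Rn n → ℝ) x = ∫ y, K x y * f y

/-- Properties of the smooth truncation function `ψ`. -/
def PsiCond (ψ : ℝ → ℝ) (C₁ : ℝ) : Prop :=
  (∀ t, 0 ≤ ψ t ∧ ψ t ≤ 1) ∧ (∀ t ≤ (1:ℝ)/2, ψ t = 0) ∧ (∀ t, 1 ≤ t → ψ t = 1) ∧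
    ∀ t ∈ Ioo ((1:ℝ)/2) 1, |deriv ψ t| ≤ C₁

/-- The maximal commutator `[b,T*] f (x)`. -/
def maxComm {n : ℕ} (K : Rn n → Rn n → ℝ) (b f : Rn n → ℝ) (x : Rn n) : ℝ≥0∞ :=
  ⨆ (ε : ℝ) (_ : 0 < ε),
    ENNReal.ofReal |∫ y in {y : Rn n | ε ≤ dist x y}, (b x - b y) * K x y * f y|

/-- The maximal truncated singular integral `T* f (x)`. -/
def truncT {n : ℕ} (K : Rn n → Rn n → ℝ) (f : Rn n → ℝ) (x : Rn n) : ℝ≥0∞ :=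
  ⨆ (ε : ℝ) (_ : 0 < ε),
    ENNReal.ofReal |∫ y in {y : Rn n | ε ≤ dist x y}, K x y * f y|

/-- Weighted `L^p` "norm" of an `ℝ≥0∞`-valued function. -/
def wLpNorm {n : ℕ} (p : ℝ) (μ : Measure (Rn n)) (g : Rn n → ℝ≥0∞) : ℝ≥0∞ :=
  (∫⁻ x, g x ^ p ∂μ) ^ (1 / p)

/-- `‖∇b‖_∞`. -/
def gradSup {n : ℕ} (b : Rn n → ℝ) : ℝ := ⨆ x : Rn n, ‖fderiv ℝ b x‖

/-- The maximal operator `M_b`. -/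
def Mb {n : ℕ} (b f : Rn n → ℝ) (x : Rn n) : ℝ≥0∞ :=
  ⨆ (r : ℝ) (_ : 0 < r),
    (ENNReal.ofReal (r ^ n))⁻¹ * ∫⁻ y in ball x r, ENNReal.ofReal (|b x - b y| * |f y|)

/-! ### Part 1 -/
namespace CZ

lemma lc_aux (h : ℝ≥0∞) {s : ℝ} (hs : 0 < s) :
    ∫⁻ t in Ioi (0:ℝ), (if ENNReal.ofReal t < h then ENNReal.ofReal (s * t ^ (s - 1)) else 0)
      = h ^ s := by
  have key : ∀ a : ℝ, 0 ≤ a → ∫⁻ t in Ioo (0:ℝ) a, ENNReal.ofReal (s * t ^ (s - 1))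
      = ENNReal.ofReal a ^ s := by
    intro a ha
    have h1 : IntegrableOn (fun t : ℝ => s * t ^ (s-1)) (Ioc 0 a) := by
      have := (intervalIntegral.intervalIntegrable_rpow' (a := 0) (b := a) (r := s - 1) (by linarith))
      exact ((intervalIntegrable_iff_integrableOn_Ioc_of_le ha).1 this).const_mul s
    rw [restrict_Ioo_eq_restrict_Ioc, ← ofReal_integral_eq_lintegral_ofReal h1]
    · rw [← intervalIntegral.integral_of_le ha, intervalIntegral.integral_const_mul,
        integral_rpow (Or.inl (by linarith))]
      rw [ENNReal.ofReal_rpow_of_nonneg ha hs.le]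
      congr 1
      simp only [sub_add_cancel]
      rw [Real.zero_rpow hs.ne']
      field_simp
      simp
    · filter_upwards [ae_restrict_mem measurableSet_Ioc] with t ht
      exact mul_nonneg hs.le (Real.rpow_nonneg ht.1.le _)
  rcases eq_or_ne h ⊤ with rfl | hh
  · simp only [ENNReal.ofReal_lt_top, if_true]
    rw [ENNReal.top_rpow_of_pos hs, eq_top_iff]
    refine le_of_tendsto' (x := atTop) (f := fun k : ℕ => (ENNReal.ofReal k) ^ s) ?_ ?_
    · have : Tendsto (fun k : ℕ => ENNReal.ofReal (k:ℝ)) atTop (𝓝 ⊤) := by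
        simpa using ENNReal.tendsto_nat_nhds_top
      have h2 := (ENNReal.continuous_rpow_const (y := s)).tendsto ⊤
      rw [ENNReal.top_rpow_of_pos hs] at h2
      exact h2.comp this
    · intro k
      rw [← key k (by positivity)]
      exact lintegral_mono_set Ioo_subset_Ioi_self
  · have e : h = ENNReal.ofReal h.toReal := (ENNReal.ofReal_toReal hh).symm
    conv_rhs => rw [e, ← key _ ENNReal.toReal_nonneg]
    rw [← lintegral_indicator measurableSet_Ioi, ← lintegral_indicator measurableSet_Ioo]
    congr 1
    ext t
    by_cases ht : 0 < t
    · have : ENNReal.ofReal t < h ↔ t < h.toReal := ENNReal.ofReal_lt_iff_lt_toReal ht.le hh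
      simp [indicator, ht, this]
    · simp [indicator, ht]

variable {n : ℕ}

lemma layercake (μ : Measure (Rn n)) [SFinite μ] {h : Rn n → ℝ≥0∞} (hm : Measurable h) {s : ℝ}
    (hs : 0 < s) : ∫⁻ x, h x ^ s ∂μ =
      ∫⁻ t in Ioi (0:ℝ), ENNReal.ofReal (s * t ^ (s - 1)) * μ {x | ENNReal.ofReal t < h x} := by
  have : ∀ x, h x ^ s = _ := fun x => (lc_aux (h x) hs).symm
  simp_rw [this]
  rw [lintegral_lintegral_swap]
  · congr 1
    ext t
    have hms : MeasurableSet {x | ENNReal.ofReal t < h x} := measurableSet_lt measurable_const hm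
    rw [← lintegral_indicator_const hms]
    congr 1
    ext x
    simp [indicator]
  · apply Measurable.aemeasurable
    apply Measurable.ite
    · exact measurableSet_lt (by fun_prop) (by fun_prop)
    · fun_prop
    · fun_prop

/-- Uncentered maximal function. -/
def MM (μ : Measure (Rn n)) (g : Rn n → ℝ≥0∞) (x : Rn n) : ℝ≥0∞ :=
  ⨆ (c : Rn n) (r : ℝ) (_ : x ∈ ball c r), (μ (ball c r))⁻¹ * ∫⁻ y in ball c r, g y ∂μ

structure DM (μ : Measure (Rn n)) (D : ℝ≥0∞) : Prop where
  fin : D ≠ ⊤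
  pos : ∀ c r, 0 < r → μ (ball c r) ≠ 0
  ltop : ∀ c r, μ (ball c r) ≠ ⊤
  dbl : ∀ c r, 0 < r → μ (ball c (5 * r)) ≤ D * μ (ball c r)

lemma lt_MM_iff {μ : Measure (Rn n)} {g : Rn n → ℝ≥0∞} {x : Rn n} {l : ℝ≥0∞} :
    l < MM μ g x ↔ ∃ c r, x ∈ ball c r ∧ l < (μ (ball c r))⁻¹ * ∫⁻ y in ball c r, g y ∂μ := by
  simp [MM, lt_iSup_iff]

lemma isOpen_MM (μ : Measure (Rn n)) (g : Rn n → ℝ≥0∞) (l : ℝ≥0∞) : IsOpen {x | l < MM μ g x} := by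
  have : {x | l < MM μ g x} = ⋃ (c) (r) (_ : l < (μ (ball c r))⁻¹ * ∫⁻ y in ball c r, g y ∂μ),
      ball c r := by
    ext x
    simp only [mem_ofPred_eq, lt_MM_iff, mem_iUnion, exists_prop]
    grind
  rw [this]
  exact isOpen_iUnion fun c => isOpen_iUnion fun r => isOpen_iUnion fun _ => isOpen_ball

lemma measurable_MM (μ : Measure (Rn n)) (g : Rn n → ℝ≥0∞) : Measurable (MM μ g) :=
  measurable_of_Ioi fun l => (isOpen_MM μ g l).measurableSet

lemma MM_mono (μ : Measure (Rn n)) {g h : Rn n → ℝ≥0∞} (hgh : ∀ x, g x ≤ h x) (x : Rn n) :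
    MM μ g x ≤ MM μ h x := by
  unfold MM
  gcongr
  exact hgh _

lemma DM.le_MM {μ : Measure (Rn n)} {D : ℝ≥0∞} (hμ : DM μ D) (g : Rn n → ℝ≥0∞) {x c : Rn n} {r : ℝ}
    (hx : x ∈ ball c r) : ∫⁻ y in ball c r, g y ∂μ ≤ μ (ball c r) * MM μ g x := by
  have hr : 0 < r := pos_of_mem_ball hx
  have : (μ (ball c r))⁻¹ * ∫⁻ y in ball c r, g y ∂μ ≤ MM μ g x :=
    le_iSup_of_le c (le_iSup_of_le r (le_iSup_of_le hx le_rfl))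
  calc _ = μ (ball c r) * ((μ (ball c r))⁻¹ * ∫⁻ y in ball c r, g y ∂μ) := by
        rw [← mul_assoc, ENNReal.mul_inv_cancel (hμ.pos c r hr) (hμ.ltop c r), one_mul]
    _ ≤ _ := by gcongr

lemma DM.weak {μ : Measure (Rn n)} {D : ℝ≥0∞} (hμ : DM μ D) (g : Rn n → ℝ≥0∞) (l : ℝ≥0∞) :
    l * μ {x | l < MM μ g x} ≤ D * ∫⁻ y, g y ∂μ := by
  set U : ℕ → Set (Rn n) := fun R => ⋃ (c : Rn n) (r : ℝ)
    (_ : r ≤ R ∧ l < (μ (ball c r))⁻¹ * ∫⁻ y in ball c r, g y ∂μ), ball c r with hU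
  have h1 : {x | l < MM μ g x} = ⋃ R, U R := by
    ext x
    simp only [hU, mem_ofPred_eq, lt_MM_iff, mem_iUnion, exists_prop]
    constructor
    · rintro ⟨c, r, hx, hl⟩
      obtain ⟨R, hR⟩ := exists_nat_ge r
      exact ⟨R, c, r, ⟨hR, hl⟩, hx⟩
    · rintro ⟨R, c, r, ⟨hR, hl⟩, hx⟩
      exact ⟨c, r, hx, hl⟩
  have hmono : Monotone U := by
    intro R R' hRR x hx
    simp only [hU, mem_iUnion, exists_prop] at hx ⊢
    obtain ⟨c, r, ⟨hR, hl⟩, hx⟩ := hx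
    exact ⟨c, r, ⟨hR.trans (by exact_mod_cast hRR), hl⟩, hx⟩
  rw [h1, hmono.measure_iUnion, ENNReal.mul_iSup]
  refine iSup_le fun R => ?_
  set t : Set (Rn n × ℝ) := {q | 0 < q.2 ∧ q.2 ≤ R ∧
    l < (μ (ball q.1 q.2))⁻¹ * ∫⁻ y in ball q.1 q.2, g y ∂μ} with ht
  obtain ⟨u, hut, hdisj, hcov⟩ := Vitali.exists_disjoint_subfamily_covering_enlargement_ball t
    (fun q => q.1) (fun q => q.2) R (fun q hq => hq.2.1) 5 (by norm_num)
  have hcount : u.Countable := hdisj.countable_of_isOpen (fun q _ => isOpen_ball)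
    (fun q hq => nonempty_ball.2 (hut hq).1)
  have hsub : U R ⊆ ⋃ q ∈ u, ball q.1 (5 * q.2) := by
    intro x hx
    simp only [hU, mem_iUnion, exists_prop] at hx
    obtain ⟨c, r, ⟨hR, hl⟩, hx⟩ := hx
    obtain ⟨b, hb, hsub⟩ := hcov (c, r) ⟨pos_of_mem_ball hx, hR, hl⟩
    exact mem_biUnion hb (hsub hx)
  have := hcount.to_subtype
  calc l * μ (U R) ≤ l * ∑' q : u, μ (ball q.1.1 (5 * q.1.2)) := by
        gcongr
        exact (measure_mono hsub).trans (measure_biUnion_le μ hcount _)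
    _ ≤ l * ∑' q : u, D * μ (ball q.1.1 q.1.2) := by
        gcongr with q
        exact hμ.dbl _ _ (hut q.2).1
    _ = D * ∑' q : u, l * μ (ball q.1.1 q.1.2) := by
        rw [ENNReal.tsum_mul_left, ENNReal.tsum_mul_left]; ring
    _ ≤ D * ∑' q : u, ∫⁻ y in ball q.1.1 q.1.2, g y ∂μ := by
        gcongr with q
        have := (hut q.2).2.2.le
        calc _ ≤ (μ (ball q.1.1 q.1.2))⁻¹ * (∫⁻ y in ball q.1.1 q.1.2, g y ∂μ) * μ (ball q.1.1 q.1.2) := by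
              gcongr
          _ = ((μ (ball q.1.1 q.1.2))⁻¹ * μ (ball q.1.1 q.1.2)) * ∫⁻ y in ball q.1.1 q.1.2, g y ∂μ := by ring
          _ = _ := by
            rw [ENNReal.inv_mul_cancel (hμ.pos _ _ (hut q.2).1) (hμ.ltop _ _), one_mul]
    _ = D * ∫⁻ y in ⋃ q ∈ u, ball q.1 q.2, g y ∂μ := by
        rw [lintegral_biUnion hcount (fun q _ => measurableSet_ball) hdisj]
    _ ≤ _ := mul_le_mul_right (setLIntegral_le_lintegral _ _) _

lemma DM.MM_le_const {μ : Measure (Rn n)} {D : ℝ≥0∞} (hμ : DM μ D) {g : Rn n → ℝ≥0∞} {a : ℝ≥0∞}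
    (hg : ∀ x, g x ≤ a) (x : Rn n) : MM μ g x ≤ a := by
  unfold MM
  refine iSup_le fun c => iSup_le fun r => iSup_le fun hx => ?_
  calc _ ≤ (μ (ball c r))⁻¹ * ∫⁻ y in ball c r, a ∂μ := by gcongr; exact hg _
    _ = a := by
      rw [setLIntegral_const, mul_comm a, ← mul_assoc,
        ENNReal.inv_mul_cancel (hμ.pos _ _ (pos_of_mem_ball hx)) (hμ.ltop _ _), one_mul]

lemma MM_add_le (μ : Measure (Rn n)) {g h : Rn n → ℝ≥0∞} (hg : Measurable g) (x : Rn n) :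
    MM μ (fun y => g y + h y) x ≤ MM μ g x + MM μ h x := by
  unfold MM
  refine iSup_le fun c => iSup_le fun r => iSup_le fun hx => ?_
  rw [lintegral_add_left hg, mul_add]
  gcongr
  · exact le_iSup_of_le c (le_iSup_of_le r (le_iSup_of_le hx le_rfl))
  · exact le_iSup_of_le c (le_iSup_of_le r (le_iSup_of_le hx le_rfl))

lemma DM.strong {μ : Measure (Rn n)} [SFinite μ] {D : ℝ≥0∞} (hμ : DM μ D) {q : ℝ} (hq : 1 < q) :
    ∃ C : ℝ≥0∞, C ≠ ⊤ ∧ ∀ g : Rn n → ℝ≥0∞, Measurable g →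
      ∫⁻ x, MM μ g x ^ q ∂μ ≤ C * ∫⁻ x, g x ^ q ∂μ := by
  refine ⟨D * ENNReal.ofReal (2 * q / (q - 1)) * 2 ^ (q - 1), ?_, ?_⟩
  · exact ENNReal.mul_ne_top (ENNReal.mul_ne_top hμ.fin ENNReal.ofReal_ne_top)
      (ENNReal.rpow_ne_top_of_nonneg (by linarith) (by norm_num))
  intro g hg
  have hq1 : 0 < q - 1 := by linarith
  rw [layercake μ (measurable_MM μ g) (by linarith : 0 < q)]
  have hw : ∀ t : ℝ, 0 < t → ENNReal.ofReal t * μ {x | ENNReal.ofReal t < MM μ g x} ≤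
      2 * D * ∫⁻ y, (if ENNReal.ofReal t < 2 * g y then g y else 0) ∂μ := by
    intro t ht
    set g1 : Rn n → ℝ≥0∞ := fun y => if ENNReal.ofReal t < 2 * g y then g y else 0
    set g2 : Rn n → ℝ≥0∞ := fun y => if ENNReal.ofReal t < 2 * g y then 0 else g y
    have hm1 : Measurable g1 :=
      Measurable.ite (measurableSet_lt measurable_const (by fun_prop)) hg measurable_const
    have hsum : (fun y => g1 y + g2 y) = g := by
      ext y; simp only [g1, g2]; split_ifs <;> simp
    have h2 : ∀ y, g2 y ≤ ENNReal.ofReal (t / 2) := by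
      intro y; simp only [g2]; split_ifs with h
      · simp
      · push Not at h
        rw [ENNReal.ofReal_div_of_pos (by norm_num), ENNReal.le_div_iff_mul_le (by simp) (by simp)]
        simpa [mul_comm] using h
    have hsub : {x | ENNReal.ofReal t < MM μ g x} ⊆ {x | ENNReal.ofReal (t/2) < MM μ g1 x} := by
      intro x hx
      simp only [mem_ofPred_eq] at hx ⊢
      by_contra hcon
      push Not at hcon
      have := MM_add_le μ (h := g2) hm1 x
      rw [hsum] at this
      have h3 := hμ.MM_le_const h2 x
      have : MM μ g x ≤ ENNReal.ofReal t := by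
        calc _ ≤ _ := this
          _ ≤ ENNReal.ofReal (t/2) + ENNReal.ofReal (t/2) := by gcongr
          _ = _ := by rw [← ENNReal.ofReal_add (by positivity) (by positivity)]; simp
      exact absurd hx (not_lt.2 this)
    have h4 := hμ.weak g1 (ENNReal.ofReal (t/2))
    calc _ ≤ ENNReal.ofReal (2 * (t/2)) * μ {x | ENNReal.ofReal (t/2) < MM μ g1 x} := by
          gcongr
          linarith
      _ = 2 * (ENNReal.ofReal (t/2) * μ {x | ENNReal.ofReal (t/2) < MM μ g1 x}) := by
          rw [ENNReal.ofReal_mul (by norm_num)]; simp [mul_assoc]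
      _ ≤ 2 * (D * ∫⁻ y, g1 y ∂μ) := by gcongr
      _ = _ := by ring
  calc ∫⁻ t in Ioi (0:ℝ), ENNReal.ofReal (q * t ^ (q - 1)) * μ {x | ENNReal.ofReal t < MM μ g x}
      ≤ ∫⁻ t in Ioi (0:ℝ), D * ENNReal.ofReal (2 * q / (q - 1)) * ∫⁻ y,
        (if ENNReal.ofReal t < 2 * g y then ENNReal.ofReal ((q - 1) * t ^ (q - 1 - 1)) else 0) * g y ∂μ := by
        refine setLIntegral_mono' measurableSet_Ioi fun t ht => ?_
        have ht0 : 0 < t := ht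
        have e1 : q * t ^ (q - 1) = (2 * q / (q - 1)) * (1/2) * ((q - 1) * t ^ (q - 1 - 1)) * t := by
          rw [Real.rpow_sub_one ht0.ne' (q-1)]
          field_simp
        rw [e1, ENNReal.ofReal_mul (by positivity), mul_assoc]
        have e2 : ∀ y, (if ENNReal.ofReal t < 2 * g y then ENNReal.ofReal ((q - 1) * t ^ (q - 1 - 1)) else 0) * g y
            = ENNReal.ofReal ((q - 1) * t ^ (q - 1 - 1)) * (if ENNReal.ofReal t < 2 * g y then g y else 0) := by
          intro y; split_ifs <;> simp
        simp_rw [e2]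
        rw [lintegral_const_mul' _ _ ENNReal.ofReal_ne_top]
        calc _ ≤ ENNReal.ofReal (2 * q / (q - 1) * (1 / 2) * ((q - 1) * t ^ (q - 1 - 1))) *
              (2 * D * ∫⁻ y, (if ENNReal.ofReal t < 2 * g y then g y else 0) ∂μ) := by
              exact mul_le_mul_right (hw t ht0) _
          _ = _ := by
            rw [ENNReal.ofReal_mul (by positivity), ENNReal.ofReal_mul (by positivity)]
            have : ENNReal.ofReal (1/2) * 2 = 1 := by
              rw [ENNReal.ofReal_div_of_pos (by norm_num)]
              simp [ENNReal.inv_mul_cancel]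
            calc _ = D * ENNReal.ofReal (2 * q / (q - 1)) * (ENNReal.ofReal ((q - 1) * t ^ (q - 1 - 1)) *
               ∫⁻ y, (if ENNReal.ofReal t < 2 * g y then g y else 0) ∂μ) * (ENNReal.ofReal (1/2) * 2) := by ring
              _ = _ := by rw [this, mul_one]
    _ = D * ENNReal.ofReal (2 * q / (q - 1)) * ∫⁻ t in Ioi (0:ℝ), ∫⁻ y,
        (if ENNReal.ofReal t < 2 * g y then ENNReal.ofReal ((q - 1) * t ^ (q - 1 - 1)) else 0) * g y ∂μ := by
        rw [lintegral_const_mul' _ _ (ENNReal.mul_ne_top hμ.fin ENNReal.ofReal_ne_top)]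
    _ = D * ENNReal.ofReal (2 * q / (q - 1)) * ∫⁻ y, (∫⁻ t in Ioi (0:ℝ),
        (if ENNReal.ofReal t < 2 * g y then ENNReal.ofReal ((q - 1) * t ^ (q - 1 - 1)) else 0) * g y) ∂μ := by
        rw [lintegral_lintegral_swap]
        apply Measurable.aemeasurable
        apply Measurable.mul
        · apply Measurable.ite
          · exact measurableSet_lt (by fun_prop) (by fun_prop)
          · fun_prop
          · fun_prop
        · fun_prop
    _ = D * ENNReal.ofReal (2 * q / (q - 1)) * ∫⁻ y, 2 ^ (q - 1) * g y ^ q ∂μ := by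
        congr 2
        ext y
        rw [lintegral_mul_const _ (by
          apply Measurable.ite
          · exact measurableSet_lt (by fun_prop) (by fun_prop)
          · fun_prop
          · fun_prop), lc_aux _ hq1, ENNReal.mul_rpow_of_nonneg _ _ hq1.le, mul_assoc]
        congr 1
        conv_lhs => rw [← ENNReal.rpow_one (g y)]
        rw [← ENNReal.rpow_mul, one_mul, ← ENNReal.rpow_add_of_nonneg _ _ hq1.le zero_le_one]
        congr 1; ring
    _ = _ := by
        rw [lintegral_const_mul' _ _ (ENNReal.rpow_ne_top_of_nonneg (by linarith) (by norm_num)), mul_assoc, mul_assoc, mul_assoc]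

end CZ

/-! ### Part 2 -/
namespace CZ
variable {n : ℕ}

/-- volume of the unit ball -/
def vv (n : ℕ) : ℝ≥0∞ := volume (ball (0 : Rn n) 1)

lemma vv_ne_zero : vv n ≠ 0 := (measure_ball_pos _ _ one_pos).ne'
lemma vv_ne_top : vv n ≠ ⊤ := measure_ball_lt_top.ne

lemma volb (c : Rn n) {r : ℝ} (hr : 0 < r) : volume (ball c r) = ENNReal.ofReal r ^ n * vv n := by
  rw [Measure.addHaar_ball_of_pos _ _ hr, finrank_euclideanSpace_fin, ENNReal.ofReal_pow hr.le, vv]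

lemma volcb (c : Rn n) {r : ℝ} (hr : 0 ≤ r) : volume (closedBall c r) = ENNReal.ofReal r ^ n * vv n := by
  rw [Measure.addHaar_closedBall _ _ hr, finrank_euclideanSpace_fin, ENNReal.ofReal_pow hr, vv]

lemma DMvol : DM (volume : Measure (Rn n)) (5 ^ n) where
  fin := by finiteness
  pos c r hr := (measure_ball_pos _ _ hr).ne'
  ltop c r := measure_ball_lt_top.ne
  dbl c r hr := by
    rw [volb c hr, volb c (by positivity), ENNReal.ofReal_mul (by norm_num), mul_pow]
    simp [mul_assoc]

structure APW (p : ℝ) (w s : Rn n → ℝ≥0∞) (A : ℝ≥0∞) : Prop where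
  hp : 1 < p
  wm : Measurable w
  sm : Measurable s
  w0 : ∀ x, w x ≠ 0
  wt : ∀ x, w x ≠ ⊤
  s0 : ∀ x, s x ≠ 0
  st : ∀ x, s x ≠ ⊤
  id : ∀ x, w x = s x ^ (1 - p)
  Wf : ∀ c r, (volume.withDensity w) (ball c r) ≠ ⊤
  Sf : ∀ c r, (volume.withDensity s) (ball c r) ≠ ⊤
  A0 : A ≠ ⊤
  ap : ∀ c r, 0 < r → (volume.withDensity w) (ball c r) * (volume.withDensity s) (ball c r) ^ (p - 1)
    ≤ A * volume (ball c r) ^ p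

lemma APW.swap {p : ℝ} {w s : Rn n → ℝ≥0∞} {A : ℝ≥0∞} (h : APW p w s A) :
    APW (p / (p - 1)) s w (A ^ (1 / (p - 1))) := by
  have hp := h.hp
  have hp1 : 0 < p - 1 := by linarith
  have e1 : p / (p - 1) - 1 = 1 / (p - 1) := by field_simp; ring
  refine ⟨?_, h.sm, h.wm, h.s0, h.st, h.w0, h.wt, ?_, h.Sf, h.Wf, ?_, ?_⟩
  · rw [one_lt_div hp1]; linarith
  · intro x
    rw [h.id x, ← ENNReal.rpow_mul]
    have : (1 - p) * (1 - p / (p - 1)) = 1 := by field_simp; ring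
    rw [this, ENNReal.rpow_one]
  · exact ENNReal.rpow_ne_top_of_nonneg (by positivity) h.A0
  · intro c r hr
    have := ENNReal.rpow_le_rpow (h.ap c r hr) (by positivity : 0 ≤ 1 / (p - 1))
    rw [ENNReal.mul_rpow_of_nonneg _ _ (by positivity), ENNReal.mul_rpow_of_nonneg _ _ (by positivity),
      ← ENNReal.rpow_mul, ← ENNReal.rpow_mul, mul_one_div_cancel hp1.ne', ENNReal.rpow_one] at this
    rw [e1, mul_comm]
    convert this using 3
    ring

lemma APW.holder {p : ℝ} {w s : Rn n → ℝ≥0∞} {A : ℝ≥0∞} (h : APW p w s A) {F : Set (Rn n)}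
    (hF : MeasurableSet F) :
    volume F ^ p ≤ (volume.withDensity w) F * (volume.withDensity s) F ^ (p - 1) := by
  have hp := h.hp
  have hp1 : 0 < p - 1 := by linarith
  have hc : p.HolderConjugate (p / (p - 1)) := Real.HolderConjugate.conjExponent hp
  have := ENNReal.lintegral_mul_le_Lp_mul_Lq (volume.restrict F) hc
    (f := fun x => w x ^ (1 / p)) (g := fun x => s x ^ (1 - 1 / p))
    (h.wm.pow_const _).aemeasurable (h.sm.pow_const _).aemeasurable
  have e : ∀ x, w x ^ (1 / p) * s x ^ (1 - 1 / p) = 1 := by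
    intro x
    rw [h.id x, ← ENNReal.rpow_mul, ← ENNReal.rpow_add _ _ (h.s0 x) (h.st x)]
    have : (1 - p) * (1 / p) + (1 - 1 / p) = 0 := by field_simp; ring
    rw [this, ENNReal.rpow_zero]
  simp only [Pi.mul_apply, e, lintegral_const, one_mul, Measure.restrict_apply_univ] at this
  have e1 : ∀ x, (w x ^ (1/p))^p = w x := fun x => by
    rw [← ENNReal.rpow_mul, one_div_mul_cancel (by linarith), ENNReal.rpow_one]
  have e2 : ∀ x, (s x ^ (1 - 1/p))^(p / (p-1)) = s x := fun x => by
    rw [← ENNReal.rpow_mul]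
    have : (1 - 1 / p) * (p / (p - 1)) = 1 := by field_simp
    rw [this, ENNReal.rpow_one]
  simp only [e1, e2] at this
  rw [withDensity_apply _ hF, withDensity_apply _ hF]
  have h3 := ENNReal.rpow_le_rpow this (by linarith : 0 ≤ p)
  rw [ENNReal.mul_rpow_of_nonneg _ _ (by linarith), ← ENNReal.rpow_mul, ← ENNReal.rpow_mul,
    one_div_mul_cancel (by linarith), ENNReal.rpow_one] at h3
  convert h3 using 3
  field_simp

lemma APW.sub {p : ℝ} {w s : Rn n → ℝ≥0∞} {A : ℝ≥0∞} (h : APW p w s A) {F : Set (Rn n)}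
    (hF : MeasurableSet F) {c : Rn n} {r : ℝ} (hr : 0 < r) (hs : F ⊆ ball c r) :
    volume F ^ p * (volume.withDensity w) (ball c r) ≤
      A * volume (ball c r) ^ p * (volume.withDensity w) F := by
  have hp := h.hp
  calc _ ≤ ((volume.withDensity w) F * (volume.withDensity s) (ball c r) ^ (p - 1)) *
        (volume.withDensity w) (ball c r) := by
        gcongr
        refine (h.holder hF).trans ?_
        gcongr
    _ = ((volume.withDensity w) (ball c r) * (volume.withDensity s) (ball c r) ^ (p - 1)) *
       (volume.withDensity w) F := by ring
    _ ≤ _ := mul_le_mul' (h.ap c r hr) le_rfl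

lemma APW.pos {p : ℝ} {w s : Rn n → ℝ≥0∞} {A : ℝ≥0∞} (h : APW p w s A) (c : Rn n) {r : ℝ} (hr : 0 < r) :
    (volume.withDensity w) (ball c r) ≠ 0 := by
  rw [Ne, withDensity_apply_eq_zero h.wm]
  have : {x | w x ≠ 0} = univ := by ext x; simp [h.w0 x]
  rw [this, univ_inter]
  exact (measure_ball_pos _ _ hr).ne'

lemma APW.dm {p : ℝ} {w s : Rn n → ℝ≥0∞} {A : ℝ≥0∞} (h : APW p w s A) :
    DM (volume.withDensity w) (A * (5 ^ n) ^ p) where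
  fin := ENNReal.mul_ne_top h.A0 (ENNReal.rpow_ne_top_of_nonneg (by linarith [h.hp]) (by finiteness))
  pos c r hr := h.pos c hr
  ltop := h.Wf
  dbl c r hr := by
    have h1 := h.sub (measurableSet_ball) (by positivity : 0 < 5 * r)
      (ball_subset_ball (x := c) (by linarith : r ≤ 5 * r))
    have h2 := DMvol.dbl c r hr
    have hp := h.hp
    have h0 : volume (ball c r) ^ p ≠ 0 := by
      simp [ENNReal.rpow_eq_zero_iff, (measure_ball_pos volume c hr).ne']
      intro; linarith
    have ht : volume (ball c r) ^ p ≠ ⊤ := ENNReal.rpow_ne_top_of_nonneg (by linarith) measure_ball_lt_top.ne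
    rw [← ENNReal.mul_le_mul_iff_right h0 ht]
    calc _ ≤ _ := h1
      _ ≤ A * (5 ^ n * volume (ball c r)) ^ p * (volume.withDensity w) (ball c r) := by gcongr
      _ = _ := by rw [ENNReal.mul_rpow_of_nonneg _ _ (by linarith)]; ring

lemma lint_wd {w : Rn n → ℝ≥0∞} (hw : Measurable w) (hwt : ∀ x, w x ≠ ⊤) (g : Rn n → ℝ≥0∞)
    : ∫⁻ x, g x ∂(volume.withDensity w) = ∫⁻ x, w x * g x := by
  rw [lintegral_withDensity_eq_lintegral_mul_non_measurable _ hw]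
  · rfl
  · exact ae_of_all _ fun x => (hwt x).lt_top

lemma slint_wd {w : Rn n → ℝ≥0∞} (hw : Measurable w) (hwt : ∀ x, w x ≠ ⊤) (g : Rn n → ℝ≥0∞)
    {s : Set (Rn n)} (hs : MeasurableSet s)
    : ∫⁻ x in s, g x ∂(volume.withDensity w) = ∫⁻ x in s, w x * g x := by
  rw [setLIntegral_withDensity_eq_setLIntegral_mul_non_measurable _ hw _ hs]
  · rfl
  · exact ae_of_all _ fun x => (hwt x).lt_top

theorem APW.MW {p : ℝ} {w s : Rn n → ℝ≥0∞} {A : ℝ≥0∞} (h : APW p w s A) :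
    ∃ C : ℝ≥0∞, C ≠ ⊤ ∧ ∀ g : Rn n → ℝ≥0∞, Measurable g →
      ∫⁻ x, MM volume g x ^ p ∂(volume.withDensity w) ≤ C * ∫⁻ x, g x ^ p ∂(volume.withDensity w) := by
  have hp := h.hp
  have hp1 : 0 < p - 1 := by linarith
  set p' := p / (p - 1) with hp'
  have hpp : 1 < p' := h.swap.hp
  obtain ⟨C1, hC1, H1⟩ := h.dm.strong hpp
  obtain ⟨C2, hC2, H2⟩ := h.swap.dm.strong hp
  refine ⟨A ^ p' * (C1 * C2), ENNReal.mul_ne_top (ENNReal.rpow_ne_top_of_nonneg (by linarith) h.A0)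
    (ENNReal.mul_ne_top hC1 hC2), fun g hg => ?_⟩
  set W := volume.withDensity w with hW
  set S := volume.withDensity s with hS
  set gt : Rn n → ℝ≥0∞ := fun x => g x * (s x)⁻¹ with hgt
  have hgtm : Measurable gt := hg.mul h.sm.inv
  set hh : Rn n → ℝ≥0∞ := fun x => MM S gt x ^ (p - 1) * (w x)⁻¹ with hhh
  have hhm : Measurable hh := ((measurable_MM S gt).pow_const _).mul h.wm.inv
  have key : ∀ x, MM volume g x ^ (p - 1) ≤ A * MM W hh x := by
    intro x
    rw [← ENNReal.le_rpow_inv_iff hp1]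
    unfold MM
    refine iSup_le fun c => iSup_le fun r => iSup_le fun hx => ?_
    rw [ENNReal.le_rpow_inv_iff hp1]
    have hr : 0 < r := pos_of_mem_ball hx
    change _ ≤ A * MM W hh x
    set B := ball c r with hB
    have V0 : volume B ≠ 0 := DMvol.pos c r hr
    have Vt : volume B ≠ ⊤ := DMvol.ltop c r
    have W0 : W B ≠ 0 := h.dm.pos c r hr
    have Wt : W B ≠ ⊤ := h.dm.ltop c r
    have hap := h.ap c r hr
    have e1 : ∫⁻ y in B, g y = ∫⁻ y in B, gt y ∂S := by
      rw [hS, slint_wd h.sm h.st _ measurableSet_ball]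
      congr 1; ext y
      rw [hgt, mul_comm, mul_assoc, ENNReal.inv_mul_cancel (h.s0 y) (h.st y), mul_one]
    have e2 : ∫⁻ y in B, hh y ∂W = ∫⁻ y in B, MM S gt y ^ (p - 1) := by
      rw [hW, slint_wd h.wm h.wt _ measurableSet_ball]
      congr 1; ext y
      rw [hhh, mul_comm, mul_assoc, ENNReal.inv_mul_cancel (h.w0 y) (h.wt y), mul_one]
    have e3 : ∀ y ∈ B, (∫⁻ y in B, g y) ^ (p - 1) ≤ S B ^ (p - 1) * MM S gt y ^ (p - 1) := by
      intro y hy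
      rw [← ENNReal.mul_rpow_of_nonneg _ _ hp1.le, e1]
      exact ENNReal.rpow_le_rpow (h.swap.dm.le_MM gt hy) hp1.le
    have e4 : volume B * (∫⁻ y in B, g y) ^ (p - 1) ≤ S B ^ (p - 1) * (W B * MM W hh x) := by
      calc _ = ∫⁻ y in B, (∫⁻ y in B, g y) ^ (p - 1) := by rw [setLIntegral_const, mul_comm]
        _ ≤ ∫⁻ y in B, S B ^ (p - 1) * MM S gt y ^ (p - 1) := setLIntegral_mono' measurableSet_ball e3
        _ = S B ^ (p - 1) * ∫⁻ y in B, MM S gt y ^ (p - 1) := by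
          rw [lintegral_const_mul _ ((measurable_MM S gt).pow_const _)]
        _ ≤ _ := by
          rw [← e2]; gcongr; exact h.dm.le_MM hh hx
    rw [ENNReal.mul_rpow_of_nonneg _ _ hp1.le]
    have Vp0 : volume B ^ p ≠ 0 := by simp [ENNReal.rpow_eq_zero_iff, V0]; intro; linarith
    have Vpt : volume B ^ p ≠ ⊤ := ENNReal.rpow_ne_top_of_nonneg (by linarith) Vt
    rw [← ENNReal.mul_le_mul_iff_right Vp0 Vpt]
    calc _ = volume B * (∫⁻ y in B, g y) ^ (p - 1) := by
          rw [← mul_assoc, ENNReal.inv_rpow, ← ENNReal.rpow_neg, ← ENNReal.rpow_add _ _ V0 Vt]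
          congr 1
          have : p + -(p-1) = 1 := by ring
          rw [this, ENNReal.rpow_one]
      _ ≤ _ := e4
      _ = (W B * S B ^ (p - 1)) * MM W hh x := by ring
      _ ≤ (A * volume B ^ p) * MM W hh x := by gcongr
      _ = _ := by ring
  have ep : (p - 1) * p' = p := by rw [hp']; field_simp
  calc ∫⁻ x, MM volume g x ^ p ∂W = ∫⁻ x, (MM volume g x ^ (p - 1)) ^ p' ∂W := by
        simp_rw [← ENNReal.rpow_mul, ep]
    _ ≤ ∫⁻ x, A ^ p' * (MM W hh x) ^ p' ∂W := by
        refine lintegral_mono fun x => ?_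
        rw [← ENNReal.mul_rpow_of_nonneg _ _ (by linarith)]
        exact ENNReal.rpow_le_rpow (key x) (by linarith)
    _ = A ^ p' * ∫⁻ x, (MM W hh x) ^ p' ∂W := by
        rw [lintegral_const_mul _ ((measurable_MM W hh).pow_const _)]
    _ ≤ A ^ p' * (C1 * ∫⁻ x, hh x ^ p' ∂W) := by gcongr; exact H1 hh hhm
    _ = A ^ p' * (C1 * ∫⁻ x, MM S gt x ^ p ∂S) := by
        rw [hW, hS, lint_wd h.wm h.wt, lint_wd h.sm h.st]
        congr 2
        refine lintegral_congr fun x => ?_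
        rw [hhh]
        simp only
        rw [ENNReal.mul_rpow_of_nonneg _ _ (by linarith), ← ENNReal.rpow_mul, ep, h.id x,
          ← ENNReal.rpow_neg, ← ENNReal.rpow_mul, mul_comm (_ ^ p), ← mul_assoc,
          ← ENNReal.rpow_add _ _ (h.s0 x) (h.st x)]
        have : 1 - p + -(1 - p) * p' = 1 := by linear_combination ep
        rw [this, ENNReal.rpow_one]
    _ ≤ A ^ p' * (C1 * (C2 * ∫⁻ x, gt x ^ p ∂S)) := by gcongr; exact H2 gt hgtm
    _ = A ^ p' * (C1 * (C2 * ∫⁻ x, g x ^ p ∂W)) := by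
        rw [hW, hS, lint_wd h.wm h.wt, lint_wd h.sm h.st]
        congr 3
        refine lintegral_congr fun x => ?_
        rw [hgt]
        simp only
        rw [ENNReal.mul_rpow_of_nonneg _ _ (by linarith), h.id x, ENNReal.inv_rpow, ← ENNReal.rpow_neg,
          mul_comm (_ ^ p), ← mul_assoc]
        congr 1
        conv_lhs => rw [← ENNReal.rpow_one (s x)]
        rw [← ENNReal.rpow_mul, ← ENNReal.rpow_add _ _ (h.s0 x) (h.st x)]
        congr 1; ring
    _ = _ := by ring

end CZ

/-! ### Part 3 -/
namespace CZ
variable {n : ℕ}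

lemma ball_sub_cube (c : Rn n) (r : ℝ) : ball c r ⊆ cube c (2 * r) := by
  intro x hx i
  rw [mem_ball, dist_eq_norm] at hx
  have := PiLp.norm_apply_le (x - c) i
  simp only [PiLp.sub_apply, Real.norm_eq_abs] at this
  linarith

lemma exists_APW {p : ℝ} (hp : 1 < p) {ω : Rn n → ℝ} (hω : IsAp n p ω) :
    ∃ w s A, APW p w s A ∧ wMeasure n ω = (volume : Measure (Rn n)).withDensity w := by
  obtain ⟨hpos, hloc, A, hA, hap⟩ := hω
  have hp1 : 0 < p - 1 := by linarith
  have hae : AEMeasurable ω volume := hloc.aestronglyMeasurable.aemeasurable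
  set ω' := hae.mk ω with hω'
  have hm : Measurable ω' := hae.measurable_mk
  set w : Rn n → ℝ≥0∞ := fun x => if 0 < ω' x then ENNReal.ofReal (ω' x) else 1 with hw
  have wm : Measurable w := Measurable.ite (measurableSet_lt measurable_const hm)
    hm.ennreal_ofReal measurable_const
  have w0 : ∀ x, w x ≠ 0 := by
    intro x; simp only [hw]; split_ifs with h
    · simpa using h
    · simp
  have wt : ∀ x, w x ≠ ⊤ := by
    intro x; simp only [hw]; split_ifs with h <;> simp
  set s : Rn n → ℝ≥0∞ := fun x => w x ^ (1 - p / (p - 1)) with hs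
  have wae : w =ᵐ[volume] fun x => ENNReal.ofReal (ω x) := by
    filter_upwards [hpos, hae.ae_eq_mk] with x h1 h2
    simp only [hw]
    rw [hω', ← h2, if_pos h1]
  have sae : s =ᵐ[volume] fun x => ENNReal.ofReal (ω x ^ (1 - p / (p - 1))) := by
    filter_upwards [hpos, wae] with x h1 h2
    simp only [hs, h2]
    rw [ENNReal.ofReal_rpow_of_pos h1]
  have s0 : ∀ x, s x ≠ 0 := fun x => by
    simp [hs, ENNReal.rpow_eq_zero_iff, w0 x, wt x]
  have st : ∀ x, s x ≠ ⊤ := fun x => by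
    simp [hs, ENNReal.rpow_eq_top_iff, w0 x, wt x]
  have Wb : ∀ c r, (volume.withDensity w) (ball c r) = ∫⁻ x in ball c r, ENNReal.ofReal (ω x) := by
    intro c r
    rw [withDensity_apply _ measurableSet_ball]
    exact lintegral_congr_ae (ae_restrict_of_ae wae)
  have Sb : ∀ c r, (volume.withDensity s) (ball c r) =
      ∫⁻ x in ball c r, ENNReal.ofReal (ω x ^ (1 - p / (p - 1))) := by
    intro c r
    rw [withDensity_apply _ measurableSet_ball]
    exact lintegral_congr_ae (ae_restrict_of_ae sae)
  have Wf : ∀ c r, (volume.withDensity w) (ball c r) ≠ ⊤ := by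
    intro c r
    rw [Wb]
    have h1 : IntegrableOn ω (ball c r) volume :=
      (hloc.integrableOn_isCompact (isCompact_closedBall c r)).mono_set ball_subset_closedBall
    refine (lt_of_le_of_lt (lintegral_mono fun x => ?_) h1.2).ne
    exact Real.ofReal_le_enorm _
  have Wp : ∀ c r, 0 < r → (volume.withDensity w) (ball c r) ≠ 0 := by
    intro c r hr
    rw [Ne, withDensity_apply_eq_zero wm]
    have : {x | w x ≠ 0} = univ := by ext x; simp [w0 x]
    rw [this, univ_inter]
    exact (measure_ball_pos _ _ hr).ne'
  have main : ∀ c r, 0 < r → ((volume.withDensity w) (ball c r) / ENNReal.ofReal ((2 * r) ^ n)) *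
      ((volume.withDensity s) (ball c r) / ENNReal.ofReal ((2 * r) ^ n)) ^ (p - 1) ≤ A := by
    intro c r hr
    refine le_trans ?_ (hap c (2 * r) (by positivity))
    rw [Wb, Sb]
    gcongr <;> exact ball_sub_cube c r
  have Sf : ∀ c r, (volume.withDensity s) (ball c r) ≠ ⊤ := by
    intro c r
    rcases le_or_gt r 0 with hr | hr
    · rw [ball_eq_empty.2 hr]; simp
    intro hcon
    have := main c r hr
    rw [hcon, ENNReal.top_div_of_ne_top ENNReal.ofReal_ne_top, ENNReal.top_rpow_of_pos hp1,
      ENNReal.mul_top] at this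
    · exact hA (top_le_iff.1 this)
    · exact ENNReal.div_ne_zero.2 ⟨Wp c r hr, ENNReal.ofReal_ne_top⟩
  refine ⟨w, s, A * (2 ^ n / vv n) ^ p, ⟨hp, wm, wm.pow_const _, w0, wt, s0, st, ?_, Wf, Sf, ?_, ?_⟩, ?_⟩
  · intro x
    rw [hs]
    simp only
    rw [← ENNReal.rpow_mul]
    have : (1 - p / (p - 1)) * (1 - p) = 1 := by field_simp; ring
    rw [this, ENNReal.rpow_one]
  · exact ENNReal.mul_ne_top hA (ENNReal.rpow_ne_top_of_nonneg (by linarith)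
      (ENNReal.div_ne_top (by finiteness) vv_ne_zero))
  · intro c r hr
    have h1 := main c r hr
    set R := ENNReal.ofReal ((2 * r) ^ n) with hR
    have R0 : R ≠ 0 := by rw [hR, Ne, ENNReal.ofReal_eq_zero]; push Not; positivity
    have Rt : R ≠ ⊤ := ENNReal.ofReal_ne_top
    have hRe : R = 2 ^ n / vv n * volume (ball c r) := by
      rw [hR, volb c hr, ENNReal.ofReal_pow (by positivity), ENNReal.ofReal_mul (by norm_num), mul_pow,
        ENNReal.ofReal_ofNat, mul_comm (_ ^ n) (vv n), ← mul_assoc, ENNReal.div_mul_cancel vv_ne_zero vv_ne_top]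
    set a := (volume.withDensity w) (ball c r)
    set b := (volume.withDensity s) (ball c r)
    calc a * b ^ (p - 1) = (a / R * R) * (b / R * R) ^ (p - 1) := by
          rw [ENNReal.div_mul_cancel R0 Rt, ENNReal.div_mul_cancel R0 Rt]
      _ = (a / R * (b / R) ^ (p - 1)) * (R ^ (1:ℝ) * R ^ (p - 1)) := by
          rw [ENNReal.mul_rpow_of_nonneg _ _ hp1.le, ENNReal.rpow_one]; ring
      _ ≤ A * (R ^ (1:ℝ) * R ^ (p - 1)) := mul_le_mul' h1 le_rfl
      _ = A * R ^ p := by rw [← ENNReal.rpow_add _ _ R0 Rt]; congr 2; ring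
      _ = _ := by rw [hRe, ENNReal.mul_rpow_of_nonneg _ _ (by linarith)]; ring
  · exact withDensity_congr_ae wae.symm

end CZ

/-! ### Part 4 -/
namespace CZ
variable {n : ℕ}

lemma dini_sum {θ : ℝ → ℝ} (hθ : IsModulus θ) (hD : DiniCondition θ) :
    ∑' k : ℕ, ENNReal.ofReal (θ ((2⁻¹:ℝ) ^ (k+1))) ≠ ⊤ := by
  obtain ⟨-, hmono, -, -, hnn⟩ := hθ
  set a : ℕ → ℝ := fun k => (2⁻¹:ℝ) ^ k with ha
  have hanti : Antitone a := fun i j hij => pow_le_pow_of_le_one (by norm_num) (by norm_num) hij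
  have ha0 : ∀ k, 0 < a k := fun k => by positivity
  have ha1 : ∀ k, a k ≤ 1 := fun k => pow_le_one₀ (by norm_num) (by norm_num)
  have hhalf : ∀ k, a k = 2 * a (k+1) := fun k => by simp only [ha]; rw [pow_succ]; ring
  have hdisj := hanti.pairwise_disjoint_on_Ioc_succ
  have hterm : ∀ k, ENNReal.ofReal (θ (a (k+1))) ≤ 2 * ∫⁻ t in Ioc (a (k+1)) (a k), ENNReal.ofReal (θ t / t) := by
    intro k
    calc ENNReal.ofReal (θ (a (k+1))) = 2 * (ENNReal.ofReal (θ (a (k+1)) / a k) * ENNReal.ofReal (a k - a (k+1))) := by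
          rw [← ENNReal.ofReal_mul (div_nonneg (hnn _ ⟨(ha0 _).le, ha1 _⟩) (ha0 _).le)]
          rw [← ENNReal.ofReal_ofNat, ← ENNReal.ofReal_mul (by norm_num)]
          congr 1
          have := ha0 (k+1)
          rw [hhalf k]; field_simp; ring
      _ = 2 * ∫⁻ t in Ioc (a (k+1)) (a k), ENNReal.ofReal (θ (a (k+1)) / a k) := by
          rw [setLIntegral_const, Real.volume_Ioc]
      _ ≤ _ := by
          gcongr 2 * ?_
          refine setLIntegral_mono' measurableSet_Ioc fun t ht => ?_
          apply ENNReal.ofReal_le_ofReal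
          have h1 := ha0 (k+1)
          have h2 : 0 < t := h1.trans ht.1
          have h3 : θ (a (k+1)) ≤ θ t :=
            hmono ⟨h1.le, ha1 _⟩ ⟨h2.le, ht.2.trans (ha1 _)⟩ ht.1.le
          have h4 := hnn _ ⟨h1.le, ha1 (k+1)⟩
          gcongr
          · linarith
          · exact ht.2
  have h1 : ∑' k : ℕ, ENNReal.ofReal (θ (a (k+1))) ≤ 2 * ∫⁻ t in Ioc (0:ℝ) 1, ENNReal.ofReal (θ t / t) := by
    calc _ ≤ ∑' k, 2 * ∫⁻ t in Ioc (a (k+1)) (a k), ENNReal.ofReal (θ t / t) := ENNReal.tsum_le_tsum hterm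
      _ = 2 * ∫⁻ t in ⋃ k, Ioc (a (k+1)) (a k), ENNReal.ofReal (θ t / t) := by
          rw [ENNReal.tsum_mul_left, lintegral_iUnion (fun _ => measurableSet_Ioc)]
          exact hdisj
      _ ≤ _ := by
          gcongr 2 * ?_
          refine lintegral_mono_set (iUnion_subset fun k => ?_)
          exact Ioc_subset_Ioc (ha0 _).le (ha1 _)
  refine (lt_of_le_of_lt h1 ?_).ne
  refine ENNReal.mul_lt_top (by norm_num) ?_
  refine lt_of_le_of_lt (lintegral_mono fun t => ?_) hD.2
  exact Real.ofReal_le_enorm _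

def Ann (x0 : Rn n) (ρ : ℝ) (k : ℕ) : Set (Rn n) :=
  {y | 2 ^ (k+1) * ρ ≤ dist y x0 ∧ dist y x0 < 2 * (2 ^ (k+1) * ρ)}

lemma measurableSet_Ann (x0 : Rn n) (ρ : ℝ) (k : ℕ) : MeasurableSet (Ann x0 ρ k) := by
  have h1 : Measurable fun y : Rn n => dist y x0 := by fun_prop
  have h2 : Ann x0 ρ k = {y | 2 ^ (k+1) * ρ ≤ dist y x0} ∩ {y | dist y x0 < 2 * (2 ^ (k+1) * ρ)} := by
    ext y; simp [Ann]
  rw [h2]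
  exact (measurableSet_le measurable_const h1).inter (measurableSet_lt h1 measurable_const)

def phi (θ : ℝ → ℝ) (x0 : Rn n) (ρ : ℝ) (y : Rn n) : ℝ≥0∞ :=
  ∑' k : ℕ, (Ann x0 ρ k).indicator
    (fun _ => ENNReal.ofReal (θ ((2⁻¹:ℝ) ^ (k+1))) * (ENNReal.ofReal (2 ^ (k+1) * ρ) ^ n)⁻¹) y

lemma measurable_phi (θ : ℝ → ℝ) (x0 : Rn n) (ρ : ℝ) : Measurable (phi θ x0 ρ) :=
  Measurable.tsum fun k => measurable_const.indicator (measurableSet_Ann x0 ρ k)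

lemma phi_int (θ : ℝ → ℝ) (g : Rn n → ℝ≥0∞) (hg : Measurable g) (x0 : Rn n) {ρ : ℝ} (hρ : 0 < ρ)
    {L : ℝ≥0∞} (hL : ∀ R, ρ ≤ R → ∫⁻ y in ball x0 (2 * R), g y ≤ L * ENNReal.ofReal R ^ n) :
    ∫⁻ y, phi θ x0 ρ y * g y ≤ (∑' k : ℕ, ENNReal.ofReal (θ ((2⁻¹:ℝ) ^ (k+1)))) * L := by
  unfold phi
  simp_rw [← ENNReal.tsum_mul_right]
  rw [lintegral_tsum]
  swap
  · exact fun k => ((measurable_const.indicator (measurableSet_Ann x0 ρ k)).mul hg).aemeasurable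
  refine ENNReal.tsum_le_tsum fun k => ?_
  set R := 2 ^ (k+1) * ρ with hR
  have hR0 : 0 < R := by positivity
  have hle : ρ ≤ R := by
    have : (1:ℝ) ≤ 2 ^ (k+1) := one_le_pow₀ (by norm_num)
    nlinarith
  set q := ENNReal.ofReal (θ ((2⁻¹:ℝ) ^ (k+1)))
  have R0 : ENNReal.ofReal R ^ n ≠ 0 := pow_ne_zero _ (by simpa using hR0)
  have Rt : ENNReal.ofReal R ^ n ≠ ⊤ := by finiteness
  calc ∫⁻ y, (Ann x0 ρ k).indicator (fun _ => q * (ENNReal.ofReal R ^ n)⁻¹) y * g y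
      = ∫⁻ y in Ann x0 ρ k, q * (ENNReal.ofReal R ^ n)⁻¹ * g y := by
        rw [← lintegral_indicator (measurableSet_Ann x0 ρ k)]
        congr 1; ext y
        by_cases hy : y ∈ Ann x0 ρ k <;> simp [hy]
    _ = q * (ENNReal.ofReal R ^ n)⁻¹ * ∫⁻ y in Ann x0 ρ k, g y := by
        rw [lintegral_const_mul _ hg]
    _ ≤ q * (ENNReal.ofReal R ^ n)⁻¹ * (L * ENNReal.ofReal R ^ n) := by
        gcongr
        refine le_trans (lintegral_mono_set ?_) (hL R hle)
        intro y hy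
        exact hy.2
    _ = q * L * ((ENNReal.ofReal R ^ n)⁻¹ * ENNReal.ofReal R ^ n) := by ring
    _ = _ := by rw [ENNReal.inv_mul_cancel R0 Rt, mul_one]

section kernel
variable {θ : ℝ → ℝ} {C₀ : ℝ} {K : Rn n → Rn n → ℝ}

lemma phi_ge (hθ : IsModulus θ) (hK : IsThetaKernel n θ C₀ K) {x0 x y : Rn n} {ρ : ℝ} (hρ : 0 < ρ)
    (hy : 2 * ρ ≤ dist y x0) (hx : dist x x0 ≤ ρ) :
    ‖K x0 y - K x y‖ₑ ≤ phi θ x0 ρ y ∧ ‖K y x0 - K y x‖ₑ ≤ phi θ x0 ρ y := by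
  obtain ⟨-, hmono, -, -, hnn⟩ := hθ
  set d := dist y x0 with hd
  have hd0 : 0 < d := by linarith
  obtain ⟨k, hk1, hk2⟩ := exists_nat_pow_near (x := d / (2 * ρ)) (y := 2)
    (by rw [le_div_iff₀ (by positivity)]; linarith) (by norm_num)
  rw [le_div_iff₀ (by positivity)] at hk1
  rw [div_lt_iff₀ (by positivity)] at hk2
  have hmem : y ∈ Ann x0 ρ k := ⟨by rw [← hd]; calc _ = 2^k * (2 * ρ) := by ring
                                      _ ≤ _ := hk1, by rw [← hd]; calc _ < _ := hk2
                                                    _ = _ := by ring⟩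
  have h1 : (Ann x0 ρ k).indicator (fun _ => ENNReal.ofReal (θ ((2⁻¹:ℝ) ^ (k+1))) *
     (ENNReal.ofReal (2 ^ (k+1) * ρ) ^ n)⁻¹) y ≤ phi θ x0 ρ y := ENNReal.le_tsum k
  rw [indicator_of_mem hmem] at h1
  have hne : x0 ≠ y := by rintro rfl; simp at hd; linarith
  have hn1 : ‖x0 - y‖ = d := by rw [hd, dist_comm, dist_eq_norm]
  have hn2 : ‖x0 - x‖ ≤ ρ := by rw [← dist_eq_norm, dist_comm]; exact hx
  have h2 := hK.2 x0 x y hne (by rw [hn1]; linarith)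
  have hR : 0 < 2 ^ (k+1) * ρ := by positivity
  have hRd : 2 ^ (k+1) * ρ ≤ d := hmem.1
  have hpow : (2⁻¹:ℝ) ^ (k+1) ≤ 1 := pow_le_one₀ (by norm_num) (by norm_num)
  have hq : ‖x0 - x‖ / d ≤ (2⁻¹:ℝ) ^ (k+1) := by
    rw [div_le_iff₀ hd0, inv_pow, inv_mul_eq_div, le_div_iff₀ (by positivity)]
    calc _ ≤ ρ * 2 ^ (k+1) := by gcongr
      _ ≤ d := by linarith
  have h3 : θ (‖x0 - x‖ / ‖x0 - y‖) / ‖x0 - y‖ ^ n ≤ θ ((2⁻¹:ℝ) ^ (k+1)) / (2 ^ (k+1) * ρ) ^ n := by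
    rw [hn1]
    have := hmono ⟨by positivity, hq.trans hpow⟩ ⟨by positivity, hpow⟩ hq
    have h0 := hnn _ ⟨by positivity, hpow⟩
    gcongr
  have h4 : ENNReal.ofReal (θ ((2⁻¹:ℝ) ^ (k+1)) / (2 ^ (k+1) * ρ) ^ n) =
    ENNReal.ofReal (θ ((2⁻¹:ℝ) ^ (k+1))) * (ENNReal.ofReal (2 ^ (k+1) * ρ) ^ n)⁻¹ := by
    rw [ENNReal.ofReal_div_of_pos (by positivity), ENNReal.ofReal_pow hR.le]; rfl
  rw [← h4] at h1
  constructor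
  · refine le_trans ?_ h1
    rw [Real.enorm_eq_ofReal_abs]
    exact ENNReal.ofReal_le_ofReal (by linarith [abs_nonneg (K y x0 - K y x)])
  · refine le_trans ?_ h1
    rw [Real.enorm_eq_ofReal_abs]
    exact ENNReal.ofReal_le_ofReal (by linarith [abs_nonneg (K x0 y - K x y)])

lemma K_cont (hθ : IsModulus θ) (hK : IsThetaKernel n θ C₀ K) {x y : Rn n} (hxy : x ≠ y) :
    ContinuousAt (fun x' => K x' y) x ∧ ContinuousAt (fun x' => K y x') x := by
  obtain ⟨hc, -, -, h0, hnn⟩ := hθ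
  have hd : 0 < ‖x - y‖ := norm_pos_iff.2 (sub_ne_zero.2 hxy)
  have hev : ∀ᶠ x' in 𝓝 x, 2 * ‖x - x'‖ ≤ ‖x - y‖ := by
    have : Tendsto (fun x' => 2 * ‖x - x'‖) (𝓝 x) (𝓝 (2 * ‖x - x‖)) := by
      apply Continuous.tendsto; fun_prop
    simp only [sub_self, norm_zero, mul_zero] at this
    exact (this.eventually (Iio_mem_nhds hd)).mono fun _ h => le_of_lt h
  have ht : Tendsto (fun x' => θ (‖x - x'‖ / ‖x - y‖) / ‖x - y‖ ^ n) (𝓝 x) (𝓝 0) := by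
    have h1 : Tendsto (fun x' => ‖x - x'‖ / ‖x - y‖) (𝓝 x) (𝓝[Icc 0 1] 0) := by
      apply tendsto_nhdsWithin_iff.2 ⟨?_, ?_⟩
      · have : Tendsto (fun x' => ‖x - x'‖ / ‖x - y‖) (𝓝 x) (𝓝 (‖x - x‖ / ‖x - y‖)) := by
          apply Continuous.tendsto; fun_prop
        simpa using this
      · filter_upwards [hev] with x' hx'
        exact ⟨by positivity, by rw [div_le_one hd]; linarith [norm_nonneg (x - x')]⟩
    have h2 := (hc 0 (by simp)).tendsto.comp h1
    rw [h0] at h2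
    simpa using h2.div_const (‖x - y‖ ^ n)
  constructor
  · rw [ContinuousAt, tendsto_iff_norm_sub_tendsto_zero]
    refine squeeze_zero' (Eventually.of_forall fun _ => norm_nonneg _) ?_ ht
    filter_upwards [hev] with x' hx'
    have := hK.2 x x' y hxy hx'
    rw [norm_sub_rev, Real.norm_eq_abs]
    linarith [abs_nonneg (K y x - K y x')]
  · rw [ContinuousAt, tendsto_iff_norm_sub_tendsto_zero]
    refine squeeze_zero' (Eventually.of_forall fun _ => norm_nonneg _) ?_ ht
    filter_upwards [hev] with x' hx'
    have := hK.2 x x' y hxy hx'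
    rw [norm_sub_rev, Real.norm_eq_abs]
    linarith [abs_nonneg (K x y - K x' y)]

lemma Kbd (hK : IsThetaKernel n θ C₀ K) {x y : Rn n} {a : ℝ} (ha : 0 < a) (h : a ≤ dist x y) :
    ‖K x y‖ₑ ≤ ENNReal.ofReal C₀ * (ENNReal.ofReal a ^ n)⁻¹ := by
  have hne : x ≠ y := by rintro rfl; simp at h; linarith
  have h1 := hK.1 x y hne
  rw [dist_eq_norm] at h
  have hd : 0 < ‖x - y‖ := by linarith
  have hC : 0 ≤ C₀ := by
    have : 0 ≤ C₀ / ‖x - y‖ ^ n := (abs_nonneg _).trans h1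
    by_contra hcon
    push Not at hcon
    have : C₀ / ‖x - y‖ ^ n < 0 := div_neg_of_neg_of_pos hcon (by positivity)
    linarith
  rw [Real.enorm_eq_ofReal_abs, ← ENNReal.ofReal_pow ha.le, ← div_eq_mul_inv, ← ENNReal.ofReal_div_of_pos (by positivity)]
  apply ENNReal.ofReal_le_ofReal
  refine h1.trans ?_
  gcongr

/-- bounded, boundedly supported, measurable -/
structure BB (f : Rn n → ℝ) : Prop where
  meas : Measurable f
  bdd : ∃ M, ∀ x, |f x| ≤ M
  supp : ∃ R, ∀ x, f x ≠ 0 → ‖x‖ ≤ R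

lemma BB.memLp {f : Rn n → ℝ} (hf : BB f) (q : ℝ≥0∞) : MemLp f q volume := by
  obtain ⟨M, hM⟩ := hf.bdd
  obtain ⟨R, hR⟩ := hf.supp
  have h1 : MemLp f ⊤ (volume : Measure (Rn n)) :=
    memLp_top_of_bound hf.meas.aestronglyMeasurable M (ae_of_all _ hM)
  refine h1.mono_exponent_of_measure_support_ne_top (s := closedBall 0 R) ?_ measure_closedBall_lt_top.ne le_top
  intro x hx
  by_contra hcon
  exact hx (by simpa using hR x hcon)

lemma BB.integrable {f : Rn n → ℝ} (hf : BB f) : Integrable f := memLp_one_iff_integrable.1 (hf.memLp 1)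

lemma BB.ind {f : Rn n → ℝ} (hf : BB f) {s : Set (Rn n)} (hs : MeasurableSet s) : BB (s.indicator f) := by
  obtain ⟨M, hM⟩ := hf.bdd
  obtain ⟨R, hR⟩ := hf.supp
  refine ⟨hf.meas.indicator hs, ⟨M, fun x => ?_⟩, R, fun x hx => ?_⟩
  · have := hM x
    by_cases h : x ∈ s
    · simpa [h] using this
    · simpa [h] using (abs_nonneg _).trans this
  · exact hR x (by by_contra h; apply hx; by_cases h' : x ∈ s <;> simp [h, h'])

lemma BB.sub {f g : Rn n → ℝ} (hf : BB f) (hg : BB g) : BB (fun x => f x - g x) := by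
  obtain ⟨M, hM⟩ := hf.bdd
  obtain ⟨R, hR⟩ := hf.supp
  obtain ⟨M', hM'⟩ := hg.bdd
  obtain ⟨R', hR'⟩ := hg.supp
  refine ⟨hf.meas.sub hg.meas, ⟨M + M', fun x => ?_⟩, max R R', fun x hx => ?_⟩
  · exact (abs_sub _ _).trans (add_le_add (hM x) (hM' x))
  · by_cases h : f x = 0
    · exact le_max_of_le_right (hR' x fun h' => hx (by simp [h, h']))
    · exact le_max_of_le_left (hR x h)

/-- truncation -/
def Tr (K : Rn n → Rn n → ℝ) (ε : ℝ) (f : Rn n → ℝ) (x : Rn n) : ℝ :=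
  ∫ y in {y : Rn n | ε < dist x y}, K x y * f y

def Ts (K : Rn n → Rn n → ℝ) (f : Rn n → ℝ) (x : Rn n) : ℝ≥0∞ :=
  ⨆ (ε : ℝ) (_ : 0 < ε), ‖Tr K ε f x‖ₑ

lemma ms_far (ε : ℝ) (x : Rn n) : MeasurableSet {y : Rn n | ε < dist x y} :=
  measurableSet_lt measurable_const (by fun_prop)

lemma K_meas (hθ : IsModulus θ) (hK : IsThetaKernel n θ C₀ K) (x : Rn n) {s : Set (Rn n)}
    (hs : MeasurableSet s) (hx : x ∉ s) : AEStronglyMeasurable (K x) (volume.restrict s) := by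
  refine ContinuousOn.aestronglyMeasurable (fun y hy => ?_) hs
  exact ((K_cont hθ hK (x := y) (y := x) (by rintro rfl; exact hx hy)).2).continuousWithinAt

lemma K_int (hθ : IsModulus θ) (hK : IsThetaKernel n θ C₀ K) {x : Rn n} {a : ℝ} (ha : 0 < a)
    {s : Set (Rn n)} (hs : MeasurableSet s) (h : ∀ y ∈ s, a ≤ dist x y) {f : Rn n → ℝ} (hf : Integrable f) :
    IntegrableOn (fun y => K x y * f y) s := by
  have hx : x ∉ s := fun hx => by have := h x hx; simp at this; linarith
  refine Integrable.bdd_mul (c := C₀ / a ^ n) hf.integrableOn (K_meas hθ hK x hs hx) ?_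
  filter_upwards [ae_restrict_mem hs] with y hy
  have h1 := Kbd hK ha (h y hy)
  rw [← ENNReal.ofReal_pow ha.le, ← div_eq_mul_inv, ← ENNReal.ofReal_div_of_pos (by positivity),
    Real.enorm_eq_ofReal_abs] at h1
  have hC : 0 ≤ C₀ / a ^ n := by
    have h2 := hK.1 x y (by rintro rfl; exact hx hy)
    have : 0 ≤ C₀ := by
      have h3 := (abs_nonneg _).trans h2
      have hd : 0 < ‖x - y‖ := by rw [← dist_eq_norm]; exact ha.trans_le (h y hy)
      by_contra hcon
      push Not at hcon
      have : C₀ / ‖x - y‖ ^ n < 0 := div_neg_of_neg_of_pos hcon (by positivity)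
      linarith
    positivity
  exact (ENNReal.ofReal_le_ofReal_iff hC).1 h1

lemma Tr_le (hK : IsThetaKernel n θ C₀ K) {x : Rn n} {a ε : ℝ} (ha : 0 < a)
    {f : Rn n → ℝ} (h : ∀ y, f y ≠ 0 → a ≤ dist x y) :
    ‖Tr K ε f x‖ₑ ≤ ENNReal.ofReal C₀ * (ENNReal.ofReal a ^ n)⁻¹ * ∫⁻ y, ‖f y‖ₑ := by
  have hfin : ENNReal.ofReal C₀ * (ENNReal.ofReal a ^ n)⁻¹ ≠ ⊤ :=
    ENNReal.mul_ne_top ENNReal.ofReal_ne_top (ENNReal.inv_ne_top.2 (pow_ne_zero _ (by simpa using ha)))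
  calc _ ≤ ∫⁻ y in {y : Rn n | ε < dist x y}, ‖K x y * f y‖ₑ := enorm_integral_le_lintegral_enorm _
    _ ≤ ∫⁻ y, ‖K x y * f y‖ₑ := setLIntegral_le_lintegral _ _
    _ ≤ ∫⁻ y, ENNReal.ofReal C₀ * (ENNReal.ofReal a ^ n)⁻¹ * ‖f y‖ₑ := by
        refine lintegral_mono fun y => ?_
        by_cases hy : f y = 0
        · simp [hy]
        · rw [enorm_mul]; gcongr; exact Kbd hK ha (h y hy)
    _ = _ := lintegral_const_mul' _ _ hfin

lemma continuous_Tr (hn : 0 < n) (hθ : IsModulus θ) (hK : IsThetaKernel n θ C₀ K) {ε : ℝ} (hε : 0 < ε) {f : Rn n → ℝ}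
    (hf : Integrable f) : Continuous (Tr K ε f) := by
  rw [continuous_iff_continuousAt]
  intro x0
  have e : Tr K ε f = fun x => ∫ y, ({y : Rn n | ε < dist x y}).indicator (fun y => K x y * f y) y := by
    ext x; rw [Tr, integral_indicator (ms_far ε x)]
  rw [e]
  have hfin : ENNReal.ofReal C₀ * (ENNReal.ofReal ε ^ n)⁻¹ ≠ ⊤ :=
    ENNReal.mul_ne_top ENNReal.ofReal_ne_top (ENNReal.inv_ne_top.2 (pow_ne_zero _ (by simpa using hε)))
  set c := (ENNReal.ofReal C₀ * (ENNReal.ofReal ε ^ n)⁻¹).toReal with hc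
  have hKr : ∀ x y, ε ≤ dist x y → ‖K x y‖ ≤ c := by
    intro x y hxy
    have := Kbd hK hε hxy
    rw [hc, ← toReal_enorm]
    exact ENNReal.toReal_mono hfin this
  refine continuousAt_of_dominated (bound := fun y => c * ‖f y‖) ?_ ?_ (hf.norm.const_mul _) ?_
  · refine Eventually.of_forall fun x => ?_
    have := (K_int hθ hK hε (ms_far ε x) (fun y hy => le_of_lt hy) hf).1
    exact (aestronglyMeasurable_indicator_iff (ms_far ε x)).2 this
  · refine Eventually.of_forall fun x => ae_of_all _ fun y => ?_
    by_cases hy : y ∈ {y : Rn n | ε < dist x y}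
    · rw [indicator_of_mem hy, norm_mul]
      gcongr
      exact hKr x y (le_of_lt hy)
    · rw [indicator_of_notMem hy, norm_zero]
      exact mul_nonneg ENNReal.toReal_nonneg (norm_nonneg _)
  · have hsph : volume (sphere x0 ε) = 0 := by
      have : Nontrivial (Rn n) := by
        have : Nonempty (Fin n) := ⟨⟨0, hn⟩⟩
        infer_instance
      exact Measure.addHaar_sphere _ _ _
    filter_upwards [measure_eq_zero_iff_ae_notMem.1 hsph] with y hy
    rcases lt_trichotomy (dist x0 y) ε with h | h | h
    · have : ∀ᶠ x in 𝓝 x0, dist x y < ε :=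
        (Continuous.tendsto (by fun_prop : Continuous fun x => dist x y) x0).eventually (Iio_mem_nhds h)
      refine (continuousAt_const (y := (0:ℝ))).congr ?_
      filter_upwards [this] with x hx
      rw [indicator_of_notMem]
      intro h'; exact absurd h' (not_lt.2 hx.le)
    · exact absurd (by rw [mem_sphere, dist_comm]; exact h) hy
    · have : ∀ᶠ x in 𝓝 x0, ε < dist x y :=
        (Continuous.tendsto (by fun_prop : Continuous fun x => dist x y) x0).eventually (Ioi_mem_nhds h)
      have hne : x0 ≠ y := by rintro rfl; simp at h; linarith
      refine (((K_cont hθ hK hne).1).mul (continuousAt_const (y := f y))).congr ?_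
      filter_upwards [this] with x hx
      exact (indicator_of_mem (s := {y : Rn n | ε < dist x y}) hx (fun y => K x y * f y)).symm

lemma isOpen_Ts (hn : 0 < n) (hθ : IsModulus θ) (hK : IsThetaKernel n θ C₀ K) {f : Rn n → ℝ}
    (hf : Integrable f) (l : ℝ≥0∞) : IsOpen {x | l < Ts K f x} := by
  have : {x | l < Ts K f x} = ⋃ (ε) (_ : 0 < ε), {x | l < ‖Tr K ε f x‖ₑ} := by
    ext x
    simp only [mem_ofPred_eq, Ts, lt_iSup_iff, mem_iUnion, exists_prop]
  rw [this]
  refine isOpen_iUnion fun ε => isOpen_iUnion fun hε => ?_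
  exact isOpen_lt continuous_const (continuous_Tr hn hθ hK hε hf).enorm

lemma measurable_Ts (hn : 0 < n) (hθ : IsModulus θ) (hK : IsThetaKernel n θ C₀ K) {f : Rn n → ℝ}
    (hf : Integrable f) : Measurable (Ts K f) :=
  measurable_of_Ioi fun l => (isOpen_Ts hn hθ hK hf l).measurableSet

lemma Tr_add (hθ : IsModulus θ) (hK : IsThetaKernel n θ C₀ K) {ε : ℝ} (hε : 0 < ε) {f g h : Rn n → ℝ}
    (hf : Integrable f) (hg : Integrable g) (hh : ∀ x, h x = f x + g x) (x : Rn n) :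
    Tr K ε h x = Tr K ε f x + Tr K ε g x := by
  unfold Tr
  rw [← integral_add (K_int hθ hK hε (ms_far ε x) (fun y hy => le_of_lt hy) hf)
    (K_int hθ hK hε (ms_far ε x) (fun y hy => le_of_lt hy) hg)]
  congr 1; ext y; rw [hh]; ring

lemma Ts_add (hθ : IsModulus θ) (hK : IsThetaKernel n θ C₀ K) {f g h : Rn n → ℝ}
    (hf : Integrable f) (hg : Integrable g) (hh : ∀ x, h x = f x + g x) (x : Rn n) :
    Ts K h x ≤ Ts K f x + Ts K g x := by
  refine iSup_le fun ε => iSup_le fun hε => ?_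
  rw [Tr_add hθ hK hε hf hg hh]
  refine (enorm_add_le _ _).trans ?_
  gcongr
  · exact le_iSup₂_of_le ε hε le_rfl
  · exact le_iSup₂_of_le ε hε le_rfl

end kernel
end CZ

/-! ### Part 5 -/
namespace CZ
variable {n : ℕ}

lemma exists_approx {f : Rn n → ℝ} (hf : BB f) (x0 : Rn n) {ε : ℝ} (hε : 0 < ε)
    (hz : ∀ y ∈ ball x0 ε, f y = 0) :
    ∃ (u : ℕ → Rn n → ℝ) (R : ℝ), (∀ k, ContDiff ℝ (⊤ : ℕ∞) (u k)) ∧ (∀ k, HasCompactSupport (u k)) ∧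
      (∀ k y, dist y x0 < 3 * ε / 4 → u k y = 0) ∧ (∀ k y, u k y ≠ 0 → ‖y‖ ≤ R) ∧
      (∀ y, f y ≠ 0 → ‖y‖ ≤ R) ∧ (∀ k, MemLp (u k) 2 volume) ∧
      Tendsto (fun k => eLpNorm (u k - f) 2 volume) atTop (𝓝 0) := by
  obtain ⟨R0, hR0⟩ := hf.supp
  set R := max R0 1
  have hR1 : 0 < R := lt_max_of_lt_right one_pos
  have hR : ∀ y, f y ≠ 0 → ‖y‖ ≤ R := fun y hy => (hR0 y hy).trans (le_max_left _ _)
  have happ : ∀ k : ℕ, ∃ g, HasCompactSupport g ∧ ContDiff ℝ (⊤ : ℕ∞) g ∧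
      eLpNorm (f - g) 2 volume ≤ ENNReal.ofReal (1 / ((k:ℝ) + 1)) := fun k =>
    (hf.memLp 2).exist_eLpNorm_sub_le (by norm_num) (by norm_num) (by positivity)
  choose g hg1 hg2 hg3 using happ
  let b1 : ContDiffBump x0 := ⟨3 * ε / 4, ε, by positivity, by linarith⟩
  let b2 : ContDiffBump (0 : Rn n) := ⟨R, R + 1, hR1, by linarith⟩
  set χ : Rn n → ℝ := fun y => (1 - b1 y) * b2 y with hχ
  have hχ1 : ∀ y, |χ y| ≤ 1 := fun y => by
    rw [hχ, abs_of_nonneg (mul_nonneg (sub_nonneg.2 b1.le_one) b2.nonneg)]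
    exact mul_le_one₀ (by linarith [b1.nonneg' y]) b2.nonneg b2.le_one
  have hfχ : ∀ y, f y = χ y * f y := fun y => by
    by_cases hy : f y = 0
    · simp [hy]
    · have h1 : b1 y = 0 := b1.zero_of_le_dist (by
        by_contra hcon
        exact hy (hz y (not_le.1 hcon)))
      have h2 : b2 y = 1 := b2.one_of_mem_closedBall (by simpa using hR y hy)
      simp [hχ, h1, h2]
  have hsm : ∀ k, ContDiff ℝ (⊤ : ℕ∞) (fun y => χ y * g k y) := fun k =>
    ((contDiff_const.sub b1.contDiff).mul b2.contDiff).mul (hg2 k)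
  have hcs : ∀ k, HasCompactSupport (fun y => χ y * g k y) := fun k => (hg1 k).mul_left
  refine ⟨fun k y => χ y * g k y, R + 1, hsm, hcs, ?_, ?_, ?_, ?_, ?_⟩
  · intro k y hy
    have h1 : b1 y = 1 := b1.one_of_mem_closedBall hy.le
    simp [hχ, h1]
  · intro k y hy
    by_contra hcon
    apply hy
    have h2 : b2 y = 0 := b2.zero_of_le_dist (by simpa using (not_le.1 hcon).le)
    simp [hχ, h2]
  · intro y hy; linarith [hR y hy]
  · intro k
    exact (hsm k).continuous.memLp_of_hasCompactSupport (hcs k)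
  · have hb : ∀ k, eLpNorm ((fun y => χ y * g k y) - f) 2 volume ≤ ENNReal.ofReal (1 / ((k:ℝ) + 1)) := by
      intro k
      refine le_trans (eLpNorm_mono fun y => ?_) (hg3 k)
      simp only [Pi.sub_apply]
      conv_lhs => rw [hfχ y, ← mul_sub, norm_mul, norm_sub_rev]
      exact mul_le_of_le_one_left (norm_nonneg _) (hχ1 y)
    refine tendsto_of_tendsto_of_tendsto_of_le_of_le tendsto_const_nhds ?_ (fun _ => zero_le) hb
    have := ENNReal.tendsto_ofReal (tendsto_one_div_add_atTop_nhds_zero_nat (𝕜 := ℝ))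
    simpa using this

section kernel
variable {θ : ℝ → ℝ} {C₀ : ℝ} {K : Rn n → Rn n → ℝ}

lemma rep (hθ : IsModulus θ) (hK : IsThetaKernel n θ C₀ K)
    {T : Lp ℝ 2 (volume : Measure (Rn n)) →L[ℝ] Lp ℝ 2 (volume : Measure (Rn n))} (hT : IsCZO n K T)
    {f : Rn n → ℝ} (hf : BB f) (x0 : Rn n) {ε : ℝ} (hε : 0 < ε) (hz : ∀ y ∈ ball x0 ε, f y = 0) :
    ∀ᵐ x, x ∈ ball x0 (ε / 2) → (T ((hf.memLp 2).toLp f) : Rn n → ℝ) x = ∫ y, K x y * f y := by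
  obtain ⟨u, R, hu1, hu2, hu3, hu4, hfR, hm, hlim⟩ := exists_approx hf x0 hε hz
  have hl1 : Tendsto (fun k => (hm k).toLp (u k)) atTop (𝓝 ((hf.memLp 2).toLp f)) :=
    (Lp.tendsto_Lp_iff_tendsto_eLpNorm'' _ hm _ (hf.memLp 2)).2 hlim
  have hl2 := (T.continuous.tendsto _).comp hl1
  obtain ⟨ns, hns, hae⟩ := (tendstoInMeasure_of_tendsto_Lp hl2).exists_seq_tendsto_ae
  have hrep : ∀ᵐ x : Rn n, ∀ k, x ∉ tsupport (u k) → (T ((hm k).toLp (u k)) : Rn n → ℝ) x = ∫ y, K x y * u k y :=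
    ae_all_iff.2 fun k => hT (u k) (hm k) (hu1 k) (hu2 k)
  filter_upwards [hae, hrep] with x hx1 hx2 hx3
  have hxs : ∀ k, x ∉ tsupport (u k) := by
    intro k hk
    have : tsupport (u k) ⊆ (ball x0 (3 * ε / 4))ᶜ :=
      closure_minimal (fun y hy hy' => hy (hu3 k y hy')) isOpen_ball.isClosed_compl
    refine this hk (ball_subset_ball (by linarith) hx3)
  refine tendsto_nhds_unique hx1 ?_
  have he : ∀ i, ((fun k => (T ((hm k).toLp (u k)) : Rn n → ℝ)) (ns i)) x = ∫ y, K x y * u (ns i) y :=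
    fun i => hx2 _ (hxs _)
  refine Tendsto.congr (fun i => (he i).symm) ?_
  suffices h : Tendsto (fun k => ∫ y, K x y * u k y) atTop (𝓝 (∫ y, K x y * f y)) from
    h.comp hns.tendsto_atTop
  -- uniform bound
  set S : Set (Rn n) := closedBall 0 R \ ball x0 (3 * ε / 4) with hS
  have hSm : MeasurableSet S := measurableSet_closedBall.diff measurableSet_ball
  have hSd : ∀ y ∈ S, ε / 4 ≤ dist x y := by
    intro y hy
    have h1 : 3 * ε / 4 ≤ dist y x0 := not_lt.1 hy.2
    have h2 : dist x x0 < ε / 2 := hx3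
    have := dist_triangle y x x0
    rw [dist_comm y x] at this
    linarith
  have hSf : volume S ≠ ⊤ := ((measure_mono sdiff_subset).trans_lt measure_closedBall_lt_top).ne
  have hS1 : ∀ k y, y ∉ S → u k y = 0 := by
    intro k y hy
    by_contra hcon
    refine hy ⟨by simpa using hu4 k y hcon, fun h => hcon (hu3 k y h)⟩
  have hS2 : ∀ y, y ∉ S → f y = 0 := by
    intro y hy
    by_contra hcon
    refine hy ⟨by simpa using hfR y hcon, fun h => hcon (hz y (ball_subset_ball (by linarith) h))⟩
  have hui : ∀ k, Integrable (u k) := fun k => (hu1 k).continuous.integrable_of_hasCompactSupport (hu2 k)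
  have e1 : ∀ k, ∫ y, K x y * u k y = ∫ y in S, K x y * u k y := fun k =>
    (setIntegral_eq_integral_of_forall_compl_eq_zero fun y hy => by rw [hS1 k y hy, mul_zero]).symm
  have e2 : ∫ y, K x y * f y = ∫ y in S, K x y * f y :=
    (setIntegral_eq_integral_of_forall_compl_eq_zero fun y hy => by rw [hS2 y hy, mul_zero]).symm
  simp_rw [e1, e2]
  have hε4 : 0 < ε / 4 := by positivity
  refine tendsto_integral_of_L1 _ (K_int hθ hK hε4 hSm hSd hf.integrable).1
    (Eventually.of_forall fun k => K_int hθ hK hε4 hSm hSd (hui k)) ?_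
  set c := ENNReal.ofReal C₀ * (ENNReal.ofReal (ε/4) ^ n)⁻¹
  have hc : c ≠ ⊤ :=
    ENNReal.mul_ne_top ENNReal.ofReal_ne_top (ENNReal.inv_ne_top.2 (pow_ne_zero _ (by simpa using hε4)))
  have hb : ∀ k, ∫⁻ y in S, ‖K x y * u k y - K x y * f y‖ₑ ≤
      c * (volume S ^ (1/2 : ℝ) * eLpNorm (u k - f) 2 volume) := by
    intro k
    calc _ ≤ ∫⁻ y in S, c * ‖(u k - f) y‖ₑ := by
          refine setLIntegral_mono' hSm fun y hy => ?_
          rw [← mul_sub, enorm_mul]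
          exact mul_le_mul' (Kbd hK hε4 (hSd y hy)) le_rfl
      _ = c * ∫⁻ y in S, ‖(u k - f) y‖ₑ := lintegral_const_mul' _ _ hc
      _ = c * eLpNorm (u k - f) 1 (volume.restrict S) := by rw [eLpNorm_one_eq_lintegral_enorm]
      _ ≤ _ := by
          gcongr
          have hms := ((hm k).1.sub hf.meas.aestronglyMeasurable).restrict (s := S)
          refine (eLpNorm_le_eLpNorm_mul_rpow_measure_univ (p := 1) (q := 2) (by norm_num) hms).trans ?_
          rw [mul_comm]
          refine mul_le_mul' (le_of_eq ?_) (eLpNorm_mono_measure _ Measure.restrict_le_self)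
          rw [Measure.restrict_apply_univ]
          congr 1; norm_num
  refine tendsto_of_tendsto_of_tendsto_of_le_of_le tendsto_const_nhds ?_ (fun _ => zero_le) hb
  have h1 : volume S ^ (1/2 : ℝ) ≠ ⊤ := ENNReal.rpow_ne_top_of_nonneg (by norm_num) hSf
  have h2 := ENNReal.Tendsto.const_mul (ENNReal.Tendsto.const_mul hlim (Or.inr h1)) (Or.inr hc)
  simpa using h2

end kernel
end CZ

/-! ### Part 6 -/
namespace CZ
variable {n : ℕ}

def SS (θ : ℝ → ℝ) : ℝ≥0∞ := ∑' k : ℕ, ENNReal.ofReal (θ ((2⁻¹:ℝ) ^ (k+1)))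

lemma phi_MM (θ : ℝ → ℝ) {g : Rn n → ℝ≥0∞} (hg : Measurable g) {x0 z : Rn n} {ρ : ℝ} (hρ : 0 < ρ)
    (hz : z ∈ ball x0 (2 * ρ)) :
    ∫⁻ y, phi θ x0 ρ y * g y ≤ SS θ * (2 ^ n * vv n) * MM volume g z := by
  rw [mul_assoc]
  refine phi_int θ g hg x0 hρ fun R hR => ?_
  refine (DMvol.le_MM g (x := z) (ball_subset_ball (by linarith) hz)).trans (le_of_eq ?_)
  rw [volb _ (by linarith), ENNReal.ofReal_mul (by norm_num), mul_pow]
  simp only [ENNReal.ofReal_ofNat]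
  ring

lemma wk {μ : Measure (Rn n)} {A : Rn n → ℝ≥0∞} {X : ℝ≥0∞} (h : ∀ m, m * μ {x | m < A x} ≤ X) {c : ℝ≥0∞}
    (hc : c ≠ ⊤) (l : ℝ≥0∞) : l * μ {x | l < c * A x} ≤ c * X := by
  rcases eq_or_ne c 0 with rfl | h0
  · simp
  · have h1 : {x | l < c * A x} ⊆ {x | l / c < A x} := fun x hx => ENNReal.div_lt_of_lt_mul' hx
    calc l * μ {x | l < c * A x} ≤ (c * (l / c)) * μ {x | l / c < A x} := by
          rw [ENNReal.mul_div_cancel h0 hc]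
          gcongr
      _ = c * ((l / c) * μ {x | l / c < A x}) := by ring
      _ ≤ _ := by gcongr; exact h _

section kernel
variable {θ : ℝ → ℝ} {C₀ : ℝ} {K : Rn n → Rn n → ℝ}

lemma kdiff (hθ : IsModulus θ) (hK : IsThetaKernel n θ C₀ K) {x0 x : Rn n} {ρ : ℝ} (hρ : 0 < ρ)
    (hx : dist x x0 ≤ ρ) {s : Set (Rn n)} (hs : MeasurableSet s) (hd : ∀ y ∈ s, 2 * ρ ≤ dist y x0)
    {f : Rn n → ℝ} (hf : Integrable f) :
    ‖(∫ y in s, K x0 y * f y) - ∫ y in s, K x y * f y‖ₑ ≤ ∫⁻ y, phi θ x0 ρ y * ‖f y‖ₑ := by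
  rw [← integral_sub (K_int hθ hK hρ hs (fun y hy => ?_) hf) (K_int hθ hK hρ hs (fun y hy => ?_) hf)]
  · refine (enorm_integral_le_lintegral_enorm _).trans ?_
    refine le_trans (setLIntegral_mono' hs (fun y hy => ?_)) (setLIntegral_le_lintegral s _)
    rw [← sub_mul, enorm_mul]
    exact mul_le_mul' (phi_ge hθ hK hρ (hd y hy) hx).1 le_rfl
  · have := hd y hy
    rw [dist_comm]; linarith
  · have := hd y hy
    have h2 := dist_triangle y x x0
    rw [dist_comm x y]; linarith

lemma T_l2 (T : Lp ℝ 2 (volume : Measure (Rn n)) →L[ℝ] Lp ℝ 2 (volume : Measure (Rn n)))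
    {f : Rn n → ℝ} (hf : MemLp f 2 volume) :
    ∫⁻ x, ‖(T (hf.toLp f) : Rn n → ℝ) x‖ₑ ^ (2:ℝ) ≤ ‖T‖ₑ ^ (2:ℝ) * ∫⁻ x, ‖f x‖ₑ ^ (2:ℝ) := by
  have key : ∀ g : Rn n → ℝ, ∫⁻ x, ‖g x‖ₑ ^ (2:ℝ) = eLpNorm g 2 volume ^ (2:ℝ) := by
    intro g
    have := eLpNorm_nnreal_pow_eq_lintegral (f := g) (μ := (volume : Measure (Rn n))) (p := 2) (by norm_num)
    simpa using this.symm
  rw [key, key, ← ENNReal.mul_rpow_of_nonneg _ _ (by norm_num)]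
  gcongr
  have h := T.le_opENorm (hf.toLp f)
  rw [Lp.enorm_def, Lp.enorm_def] at h
  rwa [eLpNorm_congr_ae hf.coeFn_toLp] at h

set_option maxHeartbeats 1000000 in
lemma cotlar (hθ : IsModulus θ) (hK : IsThetaKernel n θ C₀ K)
    {T : Lp ℝ 2 (volume : Measure (Rn n)) →L[ℝ] Lp ℝ 2 (volume : Measure (Rn n))} (hT : IsCZO n K T)
    {f : Rn n → ℝ} (hf : BB f) (x0 : Rn n) :
    Ts K f x0 ^ (2:ℝ) ≤ 4 * MM volume (fun x => ‖(T ((hf.memLp 2).toLp f) : Rn n → ℝ) x‖ₑ ^ (2:ℝ)) x0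
      + 4 * (‖T‖ₑ ^ (2:ℝ) * 4 ^ n) * MM volume (fun x => ‖f x‖ₑ ^ (2:ℝ)) x0
      + 4 * (SS θ * (2 ^ n * vv n)) ^ (2:ℝ) * MM volume (fun x => ‖f x‖ₑ) x0 ^ (2:ℝ) := by
  set R := 4 * MM volume (fun x => ‖(T ((hf.memLp 2).toLp f) : Rn n → ℝ) x‖ₑ ^ (2:ℝ)) x0
      + 4 * (‖T‖ₑ ^ (2:ℝ) * 4 ^ n) * MM volume (fun x => ‖f x‖ₑ ^ (2:ℝ)) x0
      + 4 * (SS θ * (2 ^ n * vv n)) ^ (2:ℝ) * MM volume (fun x => ‖f x‖ₑ) x0 ^ (2:ℝ) with hR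
  suffices h : ∀ ε, 0 < ε → ‖Tr K ε f x0‖ₑ ^ (2:ℝ) ≤ R by
    rw [← ENNReal.le_rpow_inv_iff (by norm_num : (0:ℝ) < 2)]
    refine iSup₂_le fun ε hε => ?_
    rw [ENNReal.le_rpow_inv_iff (by norm_num : (0:ℝ) < 2)]
    exact h ε hε
  intro ε hε
  set N : Set (Rn n) := {y | ε < dist x0 y} with hN
  have hNm : MeasurableSet N := ms_far ε x0
  have hf1 : BB (Nᶜ.indicator f) := hf.ind hNm.compl
  have hf2 : BB (N.indicator f) := hf.ind hNm
  have hrep := rep hθ hK hT hf2 x0 hε (fun y hy => by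
    rw [indicator_of_notMem]
    intro h'
    rw [mem_ball, dist_comm] at hy
    exact lt_asymm hy h')
  have hsum : (hf.memLp 2).toLp f = (hf1.memLp 2).toLp _ + (hf2.memLp 2).toLp _ := by
    rw [← MemLp.toLp_add]
    congr 1
    exact (indicator_compl_add_self N f).symm
  set B := ball x0 (ε / 2) with hB
  set F : Rn n → ℝ≥0∞ := fun x => ‖(T ((hf.memLp 2).toLp f) : Rn n → ℝ) x‖ₑ with hF
  set F1 : Rn n → ℝ≥0∞ := fun x => ‖(T ((hf1.memLp 2).toLp _) : Rn n → ℝ) x‖ₑ with hF1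
  set d := SS θ * (2 ^ n * vv n) * MM volume (fun x => ‖f x‖ₑ) x0 with hd
  have hgm : Measurable fun x => ‖f x‖ₑ := hf.meas.enorm
  have hpt : ∀ᵐ x, x ∈ B → ‖Tr K ε f x0‖ₑ ^ (2:ℝ) ≤ 4 * F x ^ (2:ℝ) + 4 * F1 x ^ (2:ℝ) + 4 * d ^ (2:ℝ) := by
    have hadd : (T ((hf.memLp 2).toLp f) : Rn n → ℝ) =ᵐ[volume]
        (T ((hf1.memLp 2).toLp _) : Rn n → ℝ) + (T ((hf2.memLp 2).toLp _) : Rn n → ℝ) := by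
      rw [hsum, map_add]; exact Lp.coeFn_add _ _
    filter_upwards [hrep, hadd] with x h1 h2 hx
    have h3 : ‖Tr K ε f x0‖ₑ ≤ F x + (F1 x + d) := by
      have e1 : ∫ y, K x y * N.indicator f y = ∫ y in N, K x y * f y := by
        rw [← integral_indicator hNm]
        congr 1; ext y
        by_cases hy : y ∈ N <;> simp [hy]
      have h4 := h1 hx
      rw [e1] at h4
      have h5 := kdiff hθ hK (x0 := x0) (x := x) (ρ := ε / 2) (by positivity) (le_of_lt hx) hNm
        (fun y hy => by rw [dist_comm]; have : ε < dist x0 y := hy; linarith) hf.integrable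
      have h6 := h5.trans (phi_MM θ hgm (z := x0) (by positivity) (mem_ball_self (by positivity)))
      have e2 : Tr K ε f x0 = (T ((hf.memLp 2).toLp f) : Rn n → ℝ) x +
          (- (T ((hf1.memLp 2).toLp _) : Rn n → ℝ) x + (Tr K ε f x0 - ∫ y in N, K x y * f y)) := by
        rw [h2, Pi.add_apply, h4]; ring
      rw [e2]
      refine (enorm_add_le _ _).trans ?_
      gcongr
      refine (enorm_add_le _ _).trans ?_
      rw [enorm_neg]
      gcongr
      exact h6
    have p2 : (2:ℝ≥0∞) ^ ((2:ℝ) - 1) = 2 := by norm_num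
    have := ENNReal.rpow_add_le_mul_rpow_add_rpow (F x) (F1 x + d) (p := 2) (by norm_num)
    have h7 := ENNReal.rpow_add_le_mul_rpow_add_rpow (F1 x) d (p := 2) (by norm_num)
    rw [p2] at this h7
    calc _ ≤ (F x + (F1 x + d)) ^ (2:ℝ) := by gcongr
      _ ≤ 2 * (F x ^ (2:ℝ) + (F1 x + d) ^ (2:ℝ)) := this
      _ ≤ 2 * (2 * F x ^ (2:ℝ) + 2 * (F1 x ^ (2:ℝ) + d ^ (2:ℝ))) := by
          gcongr
          exact le_mul_of_one_le_left zero_le (by norm_num)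
      _ = _ := by ring
  have hBpos : volume B ≠ 0 := DMvol.pos _ _ (by positivity)
  have hBfin : volume B ≠ ⊤ := DMvol.ltop _ _
  have hFm : AEMeasurable F volume := (Lp.aestronglyMeasurable _).enorm
  have hF1m : AEMeasurable F1 volume := (Lp.aestronglyMeasurable _).enorm
  have h1 : ∫⁻ x in B, F x ^ (2:ℝ) ≤ volume B * MM volume (fun x => F x ^ (2:ℝ)) x0 :=
    DMvol.le_MM _ (mem_ball_self (by positivity))
  have h2 : ∫⁻ x in B, F1 x ^ (2:ℝ) ≤ volume B * (‖T‖ₑ ^ (2:ℝ) * 4 ^ n * MM volume (fun x => ‖f x‖ₑ ^ (2:ℝ)) x0) := by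
    calc _ ≤ ∫⁻ x, F1 x ^ (2:ℝ) := setLIntegral_le_lintegral _ _
      _ ≤ ‖T‖ₑ ^ (2:ℝ) * ∫⁻ x, ‖Nᶜ.indicator f x‖ₑ ^ (2:ℝ) := T_l2 T (hf1.memLp 2)
      _ ≤ ‖T‖ₑ ^ (2:ℝ) * ∫⁻ x in ball x0 (2 * ε), ‖f x‖ₑ ^ (2:ℝ) := by
          gcongr ‖T‖ₑ ^ (2:ℝ) * ?_
          rw [← lintegral_indicator measurableSet_ball]
          refine lintegral_mono fun y => ?_
          by_cases hy : y ∈ N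
          · simp [hy]
          · have : y ∈ ball x0 (2 * ε) := by
              rw [mem_ball, dist_comm]
              have : dist x0 y ≤ ε := not_lt.1 hy
              linarith
            simp [hy, this]
      _ ≤ ‖T‖ₑ ^ (2:ℝ) * (volume (ball x0 (2 * ε)) * MM volume (fun x => ‖f x‖ₑ ^ (2:ℝ)) x0) := by
          gcongr ‖T‖ₑ ^ (2:ℝ) * ?_
          exact DMvol.le_MM _ (mem_ball_self (by positivity))
      _ = _ := by
          have : volume (ball x0 (2 * ε)) = 4 ^ n * volume B := by
            rw [hB, volb _ (by positivity), volb _ (by positivity), ← mul_assoc, ← mul_pow,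
              ← ENNReal.ofReal_ofNat, ← ENNReal.ofReal_mul (by norm_num)]
            congr 3; ring
          rw [this]; ring
  have h3 : volume B * ‖Tr K ε f x0‖ₑ ^ (2:ℝ) ≤ volume B * R := by
    calc _ = ∫⁻ x in B, ‖Tr K ε f x0‖ₑ ^ (2:ℝ) := by rw [setLIntegral_const, mul_comm]
      _ ≤ ∫⁻ x in B, (4 * F x ^ (2:ℝ) + 4 * F1 x ^ (2:ℝ) + 4 * d ^ (2:ℝ)) :=
          setLIntegral_mono_ae' measurableSet_ball hpt
      _ = 4 * (∫⁻ x in B, F x ^ (2:ℝ)) + 4 * (∫⁻ x in B, F1 x ^ (2:ℝ)) + 4 * d ^ (2:ℝ) * volume B := by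
          rw [lintegral_add_right _ measurable_const, lintegral_add_right', setLIntegral_const,
            lintegral_const_mul' _ _ (by norm_num), lintegral_const_mul' _ _ (by norm_num)]
          exact ((hF1m.pow_const _).const_mul _).restrict
      _ ≤ 4 * (volume B * MM volume (fun x => F x ^ (2:ℝ)) x0) +
          4 * (volume B * (‖T‖ₑ ^ (2:ℝ) * 4 ^ n * MM volume (fun x => ‖f x‖ₑ ^ (2:ℝ)) x0)) + 4 * d ^ (2:ℝ) * volume B :=
          add_le_add (add_le_add (mul_le_mul' le_rfl h1) (mul_le_mul' le_rfl h2)) le_rfl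
      _ = _ := by
          rw [hR, hd, ENNReal.mul_rpow_of_nonneg (SS θ * (2 ^ n * vv n)) _ (by norm_num)]
          ring
  exact (ENNReal.mul_le_mul_iff_right hBpos hBfin).1 h3

lemma weak22 (hθ : IsModulus θ) (hD : DiniCondition θ) (hK : IsThetaKernel n θ C₀ K)
    {T : Lp ℝ 2 (volume : Measure (Rn n)) →L[ℝ] Lp ℝ 2 (volume : Measure (Rn n))} (hT : IsCZO n K T) :
    ∃ C : ℝ≥0∞, C ≠ ⊤ ∧ ∀ f : Rn n → ℝ, BB f → ∀ l : ℝ≥0∞,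
      l ^ (2:ℝ) * volume {x | l < Ts K f x} ≤ C * ∫⁻ x, ‖f x‖ₑ ^ (2:ℝ) := by
  obtain ⟨Cm, hCm, hstr⟩ := (DMvol (n := n)).strong (q := 2) (by norm_num)
  set a := ‖T‖ₑ ^ (2:ℝ) with ha
  set b := (SS θ * (2 ^ n * vv n)) ^ (2:ℝ) with hb
  have hat : a ≠ ⊤ := ENNReal.rpow_ne_top_of_nonneg (by norm_num) enorm_ne_top
  have hbt : b ≠ ⊤ := by
    refine ENNReal.rpow_ne_top_of_nonneg (by norm_num) ?_
    refine ENNReal.mul_ne_top (dini_sum hθ hD) (ENNReal.mul_ne_top (by finiteness) vv_ne_top)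
  refine ⟨12 * (5 ^ n * a) + 12 * (a * 4 ^ n) * 5 ^ n + 12 * b * Cm, by finiteness, ?_⟩
  intro f hf l
  set F : Rn n → ℝ≥0∞ := fun x => ‖(T ((hf.memLp 2).toLp f) : Rn n → ℝ) x‖ₑ with hF
  have hsub : {x | l < Ts K f x} ⊆
      ({x | l ^ (2:ℝ) < 12 * MM volume (fun x => F x ^ (2:ℝ)) x} ∪
      {x | l ^ (2:ℝ) < (12 * (a * 4 ^ n)) * MM volume (fun x => ‖f x‖ₑ ^ (2:ℝ)) x}) ∪
      {x | l ^ (2:ℝ) < (12 * b) * MM volume (fun x => ‖f x‖ₑ) x ^ (2:ℝ)} := by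
    intro x hx
    by_contra hcon
    simp only [mem_union, mem_ofPred_eq, not_or, not_lt] at hcon
    obtain ⟨⟨h1, h2⟩, h3⟩ := hcon
    have h4 : l ^ (2:ℝ) < Ts K f x ^ (2:ℝ) := ENNReal.rpow_lt_rpow hx (by norm_num)
    have h5 := cotlar hθ hK hT hf x
    have h6 : 3 * Ts K f x ^ (2:ℝ) ≤ 3 * l ^ (2:ℝ) := by
      calc _ ≤ 3 * _ := mul_le_mul_right h5 3
        _ = 12 * MM volume (fun x => F x ^ (2:ℝ)) x + (12 * (a * 4 ^ n)) * MM volume (fun x => ‖f x‖ₑ ^ (2:ℝ)) x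
            + (12 * b) * MM volume (fun x => ‖f x‖ₑ) x ^ (2:ℝ) := by
            rw [ha, hb]; ring
        _ ≤ l ^ (2:ℝ) + l ^ (2:ℝ) + l ^ (2:ℝ) := add_le_add (add_le_add h1 h2) h3
        _ = _ := by ring
    rw [ENNReal.mul_le_mul_iff_right (by norm_num) (by norm_num)] at h6
    exact absurd h4 (not_lt.2 h6)
  have w1 := wk (c := 12) (DMvol.weak (fun x => F x ^ (2:ℝ))) (by norm_num) (l ^ (2:ℝ))
  have w2 := wk (c := 12 * (a * 4 ^ n)) (DMvol.weak (fun x => ‖f x‖ₑ ^ (2:ℝ))) (by finiteness) (l ^ (2:ℝ))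
  have w3 : l ^ (2:ℝ) * volume {x | l ^ (2:ℝ) < (12 * b) * MM volume (fun x => ‖f x‖ₑ) x ^ (2:ℝ)}
      ≤ 12 * b * (Cm * ∫⁻ x, ‖f x‖ₑ ^ (2:ℝ)) := by
    refine wk (fun m => ?_) (by finiteness) _
    refine le_trans ?_ (hstr _ hf.meas.enorm)
    refine le_trans ?_ (mul_meas_ge_le_lintegral ((measurable_MM _ _).pow_const _) m)
    gcongr
    exact fun h => le_of_lt h
  have w0 := T_l2 T (hf.memLp 2)
  calc _ ≤ l ^ (2:ℝ) * _ := mul_le_mul_right (measure_mono hsub) _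
    _ ≤ l ^ (2:ℝ) * (volume _ + volume _ + volume _) :=
        mul_le_mul_right ((measure_union_le _ _).trans (add_le_add (measure_union_le _ _) le_rfl)) _
    _ = l ^ (2:ℝ) * volume _ + l ^ (2:ℝ) * volume _ + l ^ (2:ℝ) * volume _ := by rw [mul_add, mul_add]
    _ ≤ 12 * (5 ^ n * (a * ∫⁻ x, ‖f x‖ₑ ^ (2:ℝ))) + (12 * (a * 4 ^ n)) * (5 ^ n * ∫⁻ x, ‖f x‖ₑ ^ (2:ℝ))
        + 12 * b * (Cm * ∫⁻ x, ‖f x‖ₑ ^ (2:ℝ)) := by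
        refine add_le_add (add_le_add (w1.trans ?_) w2) w3
        exact mul_le_mul_right (mul_le_mul_right w0 _) _
    _ = _ := by ring

end kernel
end CZ

/-! ### Part 7 -/
namespace CZ
variable {n : ℕ}

structure Wh (Ω : Set (Rn n)) {ι : Type} (c : ι → Rn n) (r : ι → ℝ) (Q : ι → Set (Rn n)) : Prop where
  pos : ∀ i, 0 < r i
  rb : ∃ r0, ∀ i, r i ≤ r0
  disj : Pairwise fun i j => Disjoint (ball (c i) (r i)) (ball (c j) (r j))
  far : ∀ i, ball (c i) (20 * r i) ⊆ Ω
  near : ∀ i, ∃ x', x' ∉ Ω ∧ dist x' (c i) ≤ 20 * r i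
  ms : ∀ i, MeasurableSet (Q i)
  Qd : Pairwise fun i j => Disjoint (Q i) (Q j)
  Qb : ∀ i, Q i ⊆ ball (c i) (5 * r i)
  cov : ⋃ i, Q i = Ω

lemma Wh.Qsub {Ω : Set (Rn n)} {ι : Type} {c : ι → Rn n} {r : ι → ℝ} {Q : ι → Set (Rn n)} (h : Wh Ω c r Q)
    (i : ι) : Q i ⊆ Ω := by rw [← h.cov]; exact subset_iUnion Q i

lemma Wh.Bsub {Ω : Set (Rn n)} {ι : Type} {c : ι → Rn n} {r : ι → ℝ} {Q : ι → Set (Rn n)} (h : Wh Ω c r Q)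
    (i : ι) : ball (c i) (r i) ⊆ Ω :=
  (ball_subset_ball (by linarith [h.pos i])).trans (h.far i)

lemma whitney (hn : 0 < n) {Ω : Set (Rn n)} (hΩ : IsOpen Ω) (hfin : volume Ω ≠ ⊤) :
    ∃ (ι : Type) (_ : Countable ι) (c : ι → Rn n) (r : ι → ℝ) (Q : ι → Set (Rn n)), Wh Ω c r Q := by
  have hne : (Ωᶜ).Nonempty := by
    rw [nonempty_compl]
    rintro rfl
    have : Nonempty (Fin n) := ⟨⟨0, hn⟩⟩
    exact hfin (measure_univ_of_isAddLeftInvariant _)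
  have hcl : IsClosed Ωᶜ := hΩ.isClosed_compl
  set ρ : Rn n → ℝ := fun x => infDist x Ωᶜ / 20 with hρ
  have hρ0 : ∀ x ∈ Ω, 0 < ρ x := fun x hx => by
    have := (hcl.notMem_iff_infDist_pos hne).1 (by simpa using hx : x ∉ Ωᶜ)
    simp only [hρ]; linarith
  have hfar : ∀ x, ball x (20 * ρ x) ⊆ Ω := by
    intro x y hy
    by_contra hcon
    have : infDist x Ωᶜ ≤ dist x y := infDist_le_dist_of_mem hcon
    rw [mem_ball, dist_comm] at hy
    simp only [hρ] at hy
    linarith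
  set r0 : ℝ := max 1 (volume Ω / vv n).toReal with hr0
  have hrb : ∀ x ∈ Ω, ρ x ≤ r0 := by
    intro x hx
    by_contra hcon
    have h2 := not_le.1 hcon
    have h1 : 1 < ρ x := (le_max_left _ _).trans_lt h2
    have h3 := measure_mono (μ := volume) (hfar x)
    rw [volb _ (by linarith), ← ENNReal.le_div_iff_mul_le (Or.inl vv_ne_zero) (Or.inl vv_ne_top),
      ← ENNReal.ofReal_pow (by linarith), ENNReal.ofReal_le_iff_le_toReal
        (ENNReal.div_ne_top hfin vv_ne_zero)] at h3
    have h4 : 20 * ρ x ≤ (20 * ρ x) ^ n := le_self_pow₀ (by linarith) hn.ne'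
    have h5 : (volume Ω / vv n).toReal ≤ r0 := le_max_right _ _
    linarith
  obtain ⟨u, hut, hdisj, hcov⟩ := Vitali.exists_disjoint_subfamily_covering_enlargement_ball Ω
    (fun x => x) ρ r0 hrb 5 (by norm_num)
  have hcount : u.Countable := hdisj.countable_of_isOpen (fun _ _ => isOpen_ball)
    (fun x hx => nonempty_ball.2 (hρ0 x (hut hx)))
  have : Countable u := hcount.to_subtype
  obtain ⟨e, he⟩ := exists_injective_nat u
  refine ⟨u, inferInstance, fun i => i.1, fun i => ρ i.1,
    fun i => ball i.1 (5 * ρ i.1) \ ⋃ (j : u) (_ : e j < e i), ball j.1 (5 * ρ j.1), ?_⟩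
  constructor
  · exact fun i => hρ0 _ (hut i.2)
  · exact ⟨r0, fun i => hrb _ (hut i.2)⟩
  · intro i j hij
    exact hdisj i.2 j.2 (fun h => hij (Subtype.ext h))
  · exact fun i => hfar _
  · intro i
    obtain ⟨y, hy, hd⟩ := hcl.exists_infDist_eq_dist hne i.1
    refine ⟨y, hy, ?_⟩
    rw [dist_comm, ← hd]; simp only [hρ]; linarith
  · intro i
    exact measurableSet_ball.diff (MeasurableSet.iUnion fun j => MeasurableSet.iUnion fun _ => measurableSet_ball)
  · intro i j hij
    rw [Set.disjoint_left]
    intro x hxi hxj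
    rcases lt_trichotomy (e i) (e j) with h | h | h
    · exact hxj.2 (mem_iUnion₂.2 ⟨i, h, hxi.1⟩)
    · exact hij (he h)
    · exact hxi.2 (mem_iUnion₂.2 ⟨j, h, hxj.1⟩)
  · exact fun i => sdiff_subset
  · apply Subset.antisymm
    · refine iUnion_subset fun i => sdiff_subset.trans ((ball_subset_ball ?_).trans (hfar i.1))
      linarith [hρ0 _ (hut i.2)]
    · intro x hx
      obtain ⟨b, hb, hsub⟩ := hcov x hx
      have hxb : x ∈ ball b (5 * ρ b) := hsub (mem_ball_self (hρ0 x hx))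
      classical
      have hex : ∃ k, ∃ j : u, e j = k ∧ x ∈ ball j.1 (5 * ρ j.1) := ⟨e ⟨b, hb⟩, ⟨b, hb⟩, rfl, hxb⟩
      obtain ⟨i, hi, hxi⟩ := Nat.find_spec hex
      refine mem_iUnion.2 ⟨i, hxi, ?_⟩
      intro h
      obtain ⟨j, hj, hxj⟩ := mem_iUnion₂.1 h
      exact Nat.find_min hex (hi ▸ hj) ⟨j, rfl, hxj⟩

end CZ

/-! ### Part 8 -/
namespace CZ
variable {n : ℕ}

lemma ae_le_MM (hn : 0 < n) {h : Rn n → ℝ≥0∞} (hm : Measurable h) (hi : ∫⁻ x, h x ≠ ⊤) :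
    ∀ᵐ x, h x ≤ MM volume h x := by
  filter_upwards [(Besicovitch.vitaliFamily (volume : Measure (Rn n))).ae_tendsto_lintegral_div hm.aemeasurable hi]
    with x hx
  have h1 := hx.comp (Besicovitch.tendsto_filterAt volume x)
  refine le_of_tendsto h1 ?_
  filter_upwards [self_mem_nhdsWithin] with r hr
  have hr : 0 < r := hr
  have : Nontrivial (Rn n) := by
    have : Nonempty (Fin n) := ⟨⟨0, hn⟩⟩
    infer_instance
  have hsph : volume (sphere x r) = 0 := Measure.addHaar_sphere _ _ _
  have e1 : ∫⁻ y in closedBall x r, h y ≤ ∫⁻ y in ball x r, h y := by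
    rw [← ball_union_sphere]
    refine (lintegral_union_le _ _ _).trans ?_
    rw [setLIntegral_measure_zero _ _ hsph, add_zero]
  have e2 : volume (closedBall x r) = volume (ball x r) := by rw [volcb _ hr.le, volb _ hr]
  simp only [Function.comp]
  rw [e2]
  refine ENNReal.div_le_of_le_mul' (e1.trans ?_)
  exact DMvol.le_MM h (mem_ball_self hr)

lemma phi_one (θ : ℝ → ℝ) (c : Rn n) {ρ : ℝ} (hρ : 0 < ρ) :
    ∫⁻ y, phi θ c ρ y ≤ SS θ * (2 ^ n * vv n) := by
  have := phi_MM θ (g := fun _ => 1) measurable_const (z := c) hρ (mem_ball_self (by positivity))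
  simp only [mul_one] at this
  refine this.trans ?_
  calc _ ≤ SS θ * (2 ^ n * vv n) * 1 := mul_le_mul' le_rfl (DMvol.MM_le_const (fun _ => le_rfl) c)
    _ = _ := mul_one _

section kernel
variable {θ : ℝ → ℝ} {C₀ : ℝ} {K : Rn n → Rn n → ℝ}

lemma Tr_le' (hK : IsThetaKernel n θ C₀ K) (x : Rn n) {ε : ℝ} (hε : 0 < ε) (f : Rn n → ℝ) :
    ‖Tr K ε f x‖ₑ ≤ ENNReal.ofReal C₀ * (ENNReal.ofReal ε ^ n)⁻¹ * ∫⁻ y, ‖f y‖ₑ := by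
  have e : Tr K ε f x = Tr K ε ({y : Rn n | ε < dist x y}.indicator f) x := by
    unfold Tr
    refine setIntegral_congr_fun (ms_far ε x) fun y hy => ?_
    rw [indicator_of_mem hy]
  rw [e]
  refine (Tr_le hK hε fun y hy => ?_).trans ?_
  · by_contra hcon
    apply hy
    rw [indicator_of_notMem]
    exact fun h => hcon (le_of_lt h)
  · refine mul_le_mul' le_rfl (lintegral_mono fun y => ?_)
    rw [enorm_indicator_eq_indicator_enorm]
    exact indicator_le_self _ _ _

lemma bad_atom (hθ : IsModulus θ) (hK : IsThetaKernel n θ C₀ K) {b : Rn n → ℝ} (hb : Integrable b)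
    {c x : Rn n} {r ε : ℝ} (hr : 0 < r) (hs : ∀ y, b y ≠ 0 → dist y c ≤ 5 * r) (h0 : ∫ y, b y = 0)
    (hx : 20 * r ≤ dist x c) (hε : 0 < ε) :
    ‖Tr K ε b x‖ₑ ≤ phi θ c (5 * r) x * (∫⁻ y, ‖b y‖ₑ) +
      ENNReal.ofReal C₀ * (ENNReal.ofReal ε ^ n)⁻¹ * ∫⁻ y in ball x (3 * ε), ‖b y‖ₑ := by
  by_cases hc : ε < dist x c - 5 * r
  · refine le_add_right ?_
    set s := {y : Rn n | ε < dist x y} with hsd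
    have hsm : MeasurableSet s := ms_far ε x
    have hsup : ∀ y, y ∉ s → b y = 0 := by
      intro y hy
      by_contra hcon
      have h1 := hs y hcon
      have h2 := dist_triangle x y c
      exact hy (by simp only [hsd, mem_ofPred_eq]; linarith)
    have h1 : ∫ y in s, K x c * b y = 0 := by
      rw [integral_const_mul, setIntegral_eq_integral_of_forall_compl_eq_zero hsup, h0, mul_zero]
    have h2 : Tr K ε b x = - ∫ y in s, (K x c * b y - K x y * b y) := by
      rw [integral_sub (hb.const_mul _).integrableOn
        (K_int hθ hK hε hsm (fun y hy => le_of_lt hy) hb), h1, zero_sub, neg_neg, Tr]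
    rw [h2, enorm_neg, ← lintegral_const_mul'' _ hb.1.enorm]
    refine (enorm_integral_le_lintegral_enorm _).trans ?_
    refine (setLIntegral_le_lintegral s _).trans (lintegral_mono fun y => ?_)
    by_cases hy : b y = 0
    · simp [hy]
    · rw [← sub_mul, enorm_mul]
      exact mul_le_mul' (phi_ge hθ hK (x0 := c) (x := y) (y := x) (ρ := 5 * r) (by positivity)
        (by linarith) (hs y hy)).2 le_rfl
  · refine le_add_left ?_
    refine (Tr_le' hK x hε b).trans (mul_le_mul' le_rfl ?_)
    rw [← lintegral_indicator measurableSet_ball]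
    refine lintegral_mono fun y => ?_
    by_cases hy : b y = 0
    · simp [hy]
    · rw [indicator_of_mem]
      have h1 := hs y hy
      have h2 := dist_triangle y c x
      rw [dist_comm c x] at h2
      rw [mem_ball]; linarith

lemma bad_sum (hθ : IsModulus θ) (hD : DiniCondition θ) (hK : IsThetaKernel n θ C₀ K) :
    ∃ C : ℝ≥0∞, C ≠ ⊤ ∧ ∀ (ι : Type) (_ : Countable ι) (Ω : Set (Rn n)) (c : ι → Rn n) (r : ι → ℝ)
      (b : ι → Rn n → ℝ), (∀ i, 0 < r i) → (∀ i, ∀ x, x ∉ Ω → 20 * r i ≤ dist x (c i)) →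
      (∀ i, Measurable (b i)) → (∀ i y, b i y ≠ 0 → dist y (c i) ≤ 5 * r i) → (∀ i, ∫ y, b i y = 0) →
      ∀ X : ℝ≥0∞, X ≠ ⊤ → ∑' i, ∫⁻ y, ‖b i y‖ₑ ≤ X → ∀ l : ℝ≥0∞,
      l * volume {x | x ∉ Ω ∧ l < Ts K (fun y => ∑' i, b i y) x} ≤ C * X := by
  set A := SS θ * (2 ^ n * vv n) with hA
  have hAt : A ≠ ⊤ := ENNReal.mul_ne_top (dini_sum hθ hD) (ENNReal.mul_ne_top (by finiteness) vv_ne_top)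
  set D := ENNReal.ofReal C₀ * (3 ^ n * vv n) with hDd
  have hDt : D ≠ ⊤ := ENNReal.mul_ne_top (by finiteness) (ENNReal.mul_ne_top (by finiteness) vv_ne_top)
  refine ⟨2 * A + 2 * D * 5 ^ n, by finiteness, ?_⟩
  intro ι _ Ω c r b hr hx hbm hbs hb0 X hX hbX l
  have hfin : ∀ i, ∫⁻ y, ‖b i y‖ₑ ≠ ⊤ := fun i => ne_top_of_le_ne_top hX ((ENNReal.le_tsum i).trans hbX)
  have hbi : ∀ i, Integrable (b i) := fun i => ⟨(hbm i).aestronglyMeasurable, (hfin i).lt_top⟩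
  set β : Rn n → ℝ≥0∞ := fun y => ∑' i, ‖b i y‖ₑ with hβ
  have hβm : Measurable β := Measurable.tsum fun i => (hbm i).enorm
  have hβi : ∫⁻ y, β y ≤ X := by
    rw [hβ, lintegral_tsum fun i => (hbm i).enorm.aemeasurable]; exact hbX
  set Φ : Rn n → ℝ≥0∞ := fun x => ∑' i, phi θ (c i) (5 * r i) x * ∫⁻ y, ‖b i y‖ₑ with hΦ
  have hΦm : Measurable Φ := Measurable.tsum fun i => (measurable_phi _ _ _).mul_const _
  have hΦi : ∫⁻ x, Φ x ≤ A * X := by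
    rw [hΦ, lintegral_tsum fun i => ((measurable_phi _ _ _).mul_const _).aemeasurable]
    calc _ ≤ ∑' i, A * ∫⁻ y, ‖b i y‖ₑ := by
          refine ENNReal.tsum_le_tsum fun i => ?_
          rw [lintegral_mul_const _ (measurable_phi _ _ _)]
          exact mul_le_mul' (phi_one θ (c i) (by have := hr i; positivity)) le_rfl
      _ = A * ∑' i, ∫⁻ y, ‖b i y‖ₑ := ENNReal.tsum_mul_left
      _ ≤ _ := mul_le_mul' le_rfl hbX
  have hpt : ∀ x, x ∉ Ω → Ts K (fun y => ∑' i, b i y) x ≤ Φ x + D * MM volume β x := by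
    intro x hxΩ
    refine iSup₂_le fun ε hε => ?_
    have hfar : MeasurableSet {y : Rn n | ε < dist x y} := ms_far ε x
    set k := ENNReal.ofReal C₀ * (ENNReal.ofReal ε ^ n)⁻¹ with hk
    have hkt : k ≠ ⊤ :=
      ENNReal.mul_ne_top ENNReal.ofReal_ne_top (ENNReal.inv_ne_top.2 (pow_ne_zero _ (by simpa using hε)))
    have e : Tr K ε (fun y => ∑' i, b i y) x = ∑' i, Tr K ε (b i) x := by
      unfold Tr
      rw [← integral_tsum (fun i => (K_int hθ hK hε hfar (fun y hy => le_of_lt hy) (hbi i)).1)]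
      · congr 1; ext y; rw [tsum_mul_left]
      · refine ne_top_of_le_ne_top (ENNReal.mul_ne_top hkt hX) ?_
        calc _ ≤ ∑' i, k * ∫⁻ y, ‖b i y‖ₑ := by
              refine ENNReal.tsum_le_tsum fun i => ?_
              rw [← lintegral_const_mul' _ _ hkt]
              refine le_trans (setLIntegral_mono' hfar fun y hy => ?_) (setLIntegral_le_lintegral _ _)
              rw [enorm_mul]
              exact mul_le_mul' (Kbd hK hε (le_of_lt hy)) le_rfl
          _ = k * ∑' i, ∫⁻ y, ‖b i y‖ₑ := ENNReal.tsum_mul_left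
          _ ≤ _ := mul_le_mul' le_rfl hbX
    rw [e]
    refine enorm_tsum_le_tsum_enorm.trans ?_
    refine (ENNReal.tsum_le_tsum fun i => bad_atom hθ hK (hbi i) (hr i) (hbs i) (hb0 i) (hx i x hxΩ) hε).trans ?_
    rw [ENNReal.tsum_add, ENNReal.tsum_mul_left]
    refine add_le_add le_rfl ?_
    rw [← lintegral_tsum fun i => (hbm i).enorm.aemeasurable.restrict]
    calc _ ≤ k * (volume (ball x (3 * ε)) * MM volume β x) :=
          mul_le_mul' le_rfl (DMvol.le_MM β (mem_ball_self (by positivity)))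
      _ = D * MM volume β x * ((ENNReal.ofReal ε ^ n)⁻¹ * ENNReal.ofReal ε ^ n) := by
          rw [volb _ (by positivity), ENNReal.ofReal_mul (by norm_num), mul_pow, hk, hDd]
          simp only [ENNReal.ofReal_ofNat]
          ring
      _ = _ := by
          rw [ENNReal.inv_mul_cancel (pow_ne_zero _ (by simpa using hε)) (by finiteness), mul_one]
  have hsub : {x | x ∉ Ω ∧ l < Ts K (fun y => ∑' i, b i y) x} ⊆
      {x | l < 2 * Φ x} ∪ {x | l < (2 * D) * MM volume β x} := by
    rintro x ⟨h1, h2⟩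
    by_contra hcon
    simp only [mem_union, mem_ofPred_eq, not_or, not_lt] at hcon
    have h3 : 2 * Ts K (fun y => ∑' i, b i y) x ≤ 2 * l := by
      calc _ ≤ 2 * (Φ x + D * MM volume β x) := mul_le_mul' le_rfl (hpt x h1)
        _ = 2 * Φ x + (2 * D) * MM volume β x := by ring
        _ ≤ l + l := add_le_add hcon.1 hcon.2
        _ = _ := by ring
    rw [ENNReal.mul_le_mul_iff_right (by norm_num) (by norm_num)] at h3
    exact absurd h2 (not_lt.2 h3)
  have w1 : l * volume {x | l < 2 * Φ x} ≤ 2 * (A * X) := by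
    refine wk (fun m => ?_) (by finiteness) _
    refine le_trans ?_ hΦi
    refine le_trans ?_ (mul_meas_ge_le_lintegral hΦm m)
    gcongr
    exact fun h => le_of_lt h
  have w2 := wk (c := 2 * D) (DMvol.weak β) (by finiteness) l
  calc _ ≤ l * (volume _ + volume _) := mul_le_mul' le_rfl ((measure_mono hsub).trans (measure_union_le _ _))
    _ = l * volume _ + l * volume _ := mul_add _ _ _
    _ ≤ 2 * (A * X) + 2 * D * (5 ^ n * X) := add_le_add w1 (w2.trans (mul_le_mul' le_rfl (mul_le_mul' le_rfl hβi)))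
    _ = _ := by ring

end kernel
end CZ

/-! ### Part 9 -/
namespace CZ
variable {n : ℕ}

section kernel
variable {θ : ℝ → ℝ} {C₀ : ℝ} {K : Rn n → Rn n → ℝ}

lemma tsum_ind {ι : Type} {B : ι → Set (Rn n)} (hd : Pairwise fun i j => Disjoint (B i) (B j))
    (u : ι → Rn n → ℝ) {y : Rn n} {i : ι} (hy : y ∈ B i) : HasSum (fun j => (B j).indicator (u j) y) (u i y) := by
  have h := hasSum_single (f := fun j => (B j).indicator (u j) y) i (fun j hj => by
    rw [indicator_of_notMem]
    exact fun hyj => Set.disjoint_left.1 (hd hj) hyj hy)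
  simpa only [indicator_of_mem hy] using h

lemma tsum_ind0 {ι : Type} {B : ι → Set (Rn n)}
    (u : ι → Rn n → ℝ) {y : Rn n} (hy : ∀ i, y ∉ B i) : HasSum (fun j => (B j).indicator (u j) y) 0 := by
  have : (fun j => (B j).indicator (u j) y) = fun _ => 0 := by
    ext j; rw [indicator_of_notMem (hy j)]
  rw [this]; exact hasSum_zero

set_option maxHeartbeats 1000000 in
lemma weak11 (hn : 0 < n) (hθ : IsModulus θ) (hD : DiniCondition θ) (hK : IsThetaKernel n θ C₀ K)
    {T : Lp ℝ 2 (volume : Measure (Rn n)) →L[ℝ] Lp ℝ 2 (volume : Measure (Rn n))} (hT : IsCZO n K T) :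
    ∃ C : ℝ≥0∞, C ≠ ⊤ ∧ ∀ f : Rn n → ℝ, BB f → ∀ l : ℝ≥0∞,
      l * volume {x | l < Ts K f x} ≤ C * ∫⁻ x, ‖f x‖ₑ := by
  obtain ⟨C2, hC2, h22⟩ := weak22 hθ hD hK hT
  obtain ⟨Cb, hCb, hbad⟩ := bad_sum hθ hD hK
  refine ⟨4 * C2 * 21 ^ n + 5 ^ n + 2 * (Cb * 2), by finiteness, ?_⟩
  intro f hf l
  rcases eq_or_ne l 0 with rfl | hl0
  · simp
  rcases eq_or_ne l ⊤ with rfl | hlt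
  · simp
  set h : Rn n → ℝ≥0∞ := fun x => ‖f x‖ₑ with hh
  have hhm : Measurable h := hf.meas.enorm
  have hI : ∫⁻ x, h x ≠ ⊤ := hf.integrable.2.ne
  set I := ∫⁻ x, h x with hId
  set Ω := {x | l < MM volume h x} with hΩd
  have hΩo : IsOpen Ω := isOpen_MM _ _ _
  have hΩm : MeasurableSet Ω := hΩo.measurableSet
  have hΩ1 : l * volume Ω ≤ 5 ^ n * I := DMvol.weak h l
  have hΩf : volume Ω ≠ ⊤ := by
    intro h
    rw [h, ENNReal.mul_top hl0] at hΩ1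
    exact absurd hΩ1 (not_le.2 (by finiteness))
  obtain ⟨ι, _, c, r, Q, W⟩ := whitney hn hΩo hΩf
  set B : ι → Set (Rn n) := fun i => ball (c i) (r i) with hB
  have hBm : ∀ i, MeasurableSet (B i) := fun i => measurableSet_ball
  have hB0 : ∀ i, volume (B i) ≠ 0 := fun i => DMvol.pos _ _ (W.pos i)
  have hBt : ∀ i, volume (B i) ≠ ⊤ := fun i => DMvol.ltop _ _
  set α : ι → ℝ := fun i => (∫ y in Q i, f y) / (volume (B i)).toReal with hα
  have hα0 : ∀ i, α i * (volume (B i)).toReal = ∫ y in Q i, f y := fun i =>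
    div_mul_cancel₀ _ (ENNReal.toReal_ne_zero.2 ⟨hB0 i, hBt i⟩)
  have hα1 : ∀ i, ‖α i‖ₑ * volume (B i) ≤ ∫⁻ y in Q i, h y := by
    intro i
    calc ‖α i‖ₑ * volume (B i) = ‖α i * (volume (B i)).toReal‖ₑ := by
          rw [enorm_mul, Real.enorm_of_nonneg ENNReal.toReal_nonneg, ENNReal.ofReal_toReal (hBt i)]
      _ ≤ _ := by rw [hα0]; exact enorm_integral_le_lintegral_enorm _
  have hα2 : ∀ i, ‖α i‖ₑ ≤ 21 ^ n * l := by
    intro i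
    obtain ⟨x', hx', hdx⟩ := W.near i
    have hr := W.pos i
    have h1 : ∫⁻ y in Q i, h y ≤ volume (B i) * (21 ^ n * l) := by
      calc _ ≤ ∫⁻ y in ball (c i) (21 * r i), h y :=
            lintegral_mono_set ((W.Qb i).trans (ball_subset_ball (by linarith)))
        _ ≤ volume (ball (c i) (21 * r i)) * MM volume h x' := DMvol.le_MM h (by rw [mem_ball]; linarith)
        _ ≤ volume (ball (c i) (21 * r i)) * l := mul_le_mul' le_rfl (not_lt.1 hx')
        _ = _ := by
          simp only [hB]
          rw [volb _ (by positivity), volb _ hr, ENNReal.ofReal_mul (by norm_num), mul_pow]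
          simp only [ENNReal.ofReal_ofNat]
          ring
    have h2 := (hα1 i).trans h1
    rw [mul_comm] at h2
    exact (ENNReal.mul_le_mul_iff_right (hB0 i) (hBt i)).1 h2
  set G : Rn n → ℝ := fun y => ∑' i, (B i).indicator (fun _ => α i) y with hG
  have hGB : ∀ i y, y ∈ B i → G y = α i := fun i y hy =>
    (tsum_ind W.disj (fun i _ => α i) hy).tsum_eq
  have hGn : ∀ y, (∀ i, y ∉ B i) → G y = 0 := fun y hy => (tsum_ind0 (fun i _ => α i) hy).tsum_eq
  have hGΩ : ∀ y, y ∉ Ω → G y = 0 := fun y hy => hGn y fun i hi => hy (W.Bsub i hi)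
  have hGm : Measurable G := Measurable.tsum fun i => measurable_const.indicator (hBm i)
  set g : Rn n → ℝ := fun y => Ωᶜ.indicator f y + G y with hg
  have hgm : Measurable g := (hf.meas.indicator hΩm.compl).add hGm
  have hgΩ : ∀ y, y ∈ Ω → g y = G y := fun y hy => by simp [hg, hy]
  have hgΩ' : ∀ y, y ∉ Ω → g y = f y := fun y hy => by simp [hg, hy, hGΩ y hy]
  have hGle : ∀ y, ‖G y‖ₑ ≤ 21 ^ n * l := by
    intro y
    by_cases hy : ∃ i, y ∈ B i
    · obtain ⟨i, hi⟩ := hy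
      rw [hGB i y hi]; exact hα2 i
    · push Not at hy
      rw [hGn y hy]; simp
  have hgBB : BB g := by
    obtain ⟨M, hM⟩ := hf.bdd
    obtain ⟨R, hR⟩ := hf.supp
    obtain ⟨r0, hr0⟩ := W.rb
    refine ⟨hgm, ⟨max M (21 ^ n * l).toReal, fun y => ?_⟩, max R (R + 6 * r0), fun y hy => ?_⟩
    · by_cases hyΩ : y ∈ Ω
      · rw [hgΩ y hyΩ]
        refine le_max_of_le_right ?_
        have := ENNReal.toReal_mono (by finiteness) (hGle y)
        simpa using this
      · rw [hgΩ' y hyΩ]; exact le_max_of_le_left (hM y)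
    · by_cases hyΩ : y ∈ Ω
      · rw [hgΩ y hyΩ] at hy
        by_cases hyB : ∃ i, y ∈ B i
        · obtain ⟨i, hi⟩ := hyB
          rw [hGB i y hi] at hy
          have : ∃ z ∈ Q i, f z ≠ 0 := by
            by_contra hcon
            push Not at hcon
            apply hy
            simp only [hα]
            rw [setIntegral_eq_zero_of_forall_eq_zero hcon, zero_div]
          obtain ⟨z, hz, hfz⟩ := this
          refine le_max_of_le_right ?_
          have h1 := hR z hfz
          have h2 : dist z (c i) < 5 * r i := W.Qb i hz
          have h3 : dist y (c i) < r i := hi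
          have h4 := hr0 i
          have h5 := dist_triangle y (c i) z
          rw [dist_comm (c i) z] at h5
          have h6 : ‖y‖ ≤ dist y z + ‖z‖ := by
            rw [dist_eq_norm]; simpa using norm_add_le (y - z) z
          linarith
        · push Not at hyB
          exact absurd (hGn y hyB) hy
      · rw [hgΩ' y hyΩ] at hy; exact le_max_of_le_left (hR y hy)
  have hQsum : ∑' i, ∫⁻ y in Q i, h y = ∫⁻ y in Ω, h y := by
    rw [← W.cov, lintegral_iUnion W.ms W.Qd]
  have hQle : ∑' i, ∫⁻ y in Q i, h y ≤ I := hQsum ▸ setLIntegral_le_lintegral _ _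
  have hg1 : ∫⁻ y, ‖g y‖ₑ ≤ I := by
    rw [← lintegral_add_compl _ hΩm, hId, ← lintegral_add_compl h hΩm]
    refine add_le_add ?_ (le_of_eq (setLIntegral_congr_fun hΩm.compl fun y hy => by simp only [hh]; rw [hgΩ' y hy]))
    rw [← hQsum]
    calc ∫⁻ y in Ω, ‖g y‖ₑ = ∫⁻ y in Ω, ‖G y‖ₑ := setLIntegral_congr_fun hΩm fun y hy => by simp only [hgΩ y hy]
      _ ≤ ∫⁻ y, ‖G y‖ₑ := setLIntegral_le_lintegral _ _
      _ ≤ ∫⁻ y, ∑' i, (B i).indicator (fun _ => ‖α i‖ₑ) y := by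
          refine lintegral_mono fun y => ?_
          refine enorm_tsum_le_tsum_enorm.trans (le_of_eq ?_)
          congr 1; ext i
          rw [enorm_indicator_eq_indicator_enorm]
      _ = ∑' i, ‖α i‖ₑ * volume (B i) := by
          rw [lintegral_tsum fun i => (measurable_const.indicator (hBm i)).aemeasurable]
          congr 1; ext i
          rw [lintegral_indicator_const (hBm i)]
      _ ≤ _ := ENNReal.tsum_le_tsum hα1
  have hg2 : ∫⁻ y, ‖g y‖ₑ ^ (2:ℝ) ≤ 21 ^ n * l * I := by
    calc _ ≤ ∫⁻ y, 21 ^ n * l * ‖g y‖ₑ := by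
          refine lintegral_mono_ae ?_
          filter_upwards [ae_le_MM hn hhm hI] with y hy
          rw [ENNReal.rpow_two, sq]
          refine mul_le_mul' ?_ le_rfl
          by_cases hyΩ : y ∈ Ω
          · rw [hgΩ y hyΩ]; exact hGle y
          · rw [hgΩ' y hyΩ]
            refine (hy.trans (not_lt.1 hyΩ)).trans ?_
            exact le_mul_of_one_le_left zero_le (one_le_pow₀ (by norm_num))
      _ = 21 ^ n * l * ∫⁻ y, ‖g y‖ₑ := lintegral_const_mul' _ _ (by finiteness)
      _ ≤ _ := mul_le_mul' le_rfl hg1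
  -- bad part
  set b : ι → Rn n → ℝ := fun i y => (Q i).indicator f y - (B i).indicator (fun _ => α i) y with hb
  have hbm : ∀ i, Measurable (b i) := fun i => (hf.meas.indicator (W.ms i)).sub (measurable_const.indicator (hBm i))
  have hbs : ∀ i y, b i y ≠ 0 → dist y (c i) ≤ 5 * r i := by
    intro i y hy
    by_contra hcon
    apply hy
    have h1 : y ∉ Q i := fun h => hcon (le_of_lt (W.Qb i h))
    have h2 : y ∉ B i := fun h => hcon (by have : dist y (c i) < r i := h; linarith [W.pos i])
    simp [hb, h1, h2]
  have hb0 : ∀ i, ∫ y, b i y = 0 := by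
    intro i
    simp only [hb]
    rw [integral_sub (hf.integrable.indicator (W.ms i)) ((integrable_indicator_iff (hBm i)).2 (integrableOn_const (hBt i) (by simp))), integral_indicator (W.ms i), integral_indicator_const _ (hBm i),
      ← hα0]
    simp [Measure.real, mul_comm]
  have hbX : ∑' i, ∫⁻ y, ‖b i y‖ₑ ≤ 2 * I := by
    calc _ ≤ ∑' i, 2 * ∫⁻ y in Q i, h y := by
          refine ENNReal.tsum_le_tsum fun i => ?_
          calc ∫⁻ y, ‖b i y‖ₑ ≤ ∫⁻ y, ((Q i).indicator h y + (B i).indicator (fun _ => ‖α i‖ₑ) y) := by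
                refine lintegral_mono fun y => ?_
                refine enorm_sub_le.trans (le_of_eq ?_)
                rw [enorm_indicator_eq_indicator_enorm, enorm_indicator_eq_indicator_enorm]
            _ = (∫⁻ y in Q i, h y) + ‖α i‖ₑ * volume (B i) := by
                rw [lintegral_add_left (hhm.indicator (W.ms i)), lintegral_indicator (W.ms i),
                  lintegral_indicator_const (hBm i)]
            _ ≤ _ := by rw [two_mul]; exact add_le_add le_rfl (hα1 i)
      _ = 2 * ∑' i, ∫⁻ y in Q i, h y := ENNReal.tsum_mul_left
      _ ≤ _ := mul_le_mul' le_rfl hQle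
  have hfar : ∀ i x, x ∉ Ω → 20 * r i ≤ dist x (c i) := by
    intro i x hx
    by_contra hcon
    exact hx (W.far i (not_le.1 hcon))
  have hbd := hbad ι inferInstance Ω c r b W.pos hfar hbm hbs hb0 (2 * I) (by finiteness) hbX (l / 2)
  have hsum : ∀ y, f y = g y + ∑' i, b i y := by
    intro y
    by_cases hy : y ∈ Ω
    · have hy' := hy
      rw [← W.cov] at hy'
      obtain ⟨i, hi⟩ := mem_iUnion.1 hy'
      have s1 : HasSum (fun j => (Q j).indicator f y) (f y) := tsum_ind W.Qd (fun _ => f) hi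
      have s2 : HasSum (fun j => (B j).indicator (fun _ => α j) y) (G y) := by
        by_cases hyB : ∃ i, y ∈ B i
        · obtain ⟨i, hi⟩ := hyB
          rw [hGB i y hi]; exact tsum_ind W.disj (fun i _ => α i) hi
        · push Not at hyB
          rw [hGn y hyB]; exact tsum_ind0 (fun i _ => α i) hyB
      rw [hgΩ y hy, (s1.sub s2).tsum_eq]; ring
    · rw [hgΩ' y hy]
      have : ∀ i, b i y = 0 := fun i => by
        have h1 : y ∉ Q i := fun h => hy (W.Qsub i h)
        have h2 : y ∉ B i := fun h => hy (W.Bsub i h)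
        simp [hb, h1, h2]
      simp [this]
  have hbint : Integrable (fun y => ∑' i, b i y) := by
    have : (fun y => ∑' i, b i y) = fun y => f y - g y := by ext y; rw [hsum y]; ring
    rw [this]; exact hf.integrable.sub hgBB.integrable
  have hsub : {x | l < Ts K f x} ⊆ ({x | l / 2 < Ts K g x} ∪ Ω) ∪ {x | x ∉ Ω ∧ l / 2 < Ts K (fun y => ∑' i, b i y) x} := by
    intro x hx
    by_contra hcon
    simp only [mem_union, mem_ofPred_eq, not_or, not_lt, not_and] at hcon
    obtain ⟨⟨h1, h2⟩, h3⟩ := hcon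
    have h4 := Ts_add hθ hK hgBB.integrable hbint hsum x
    have h5 := h4.trans (add_le_add h1 (h3 h2))
    rw [ENNReal.add_halves] at h5
    exact absurd hx (not_lt.2 h5)
  have w1 : l * volume {x | l / 2 < Ts K g x} ≤ 4 * C2 * 21 ^ n * I := by
    have h1 := (h22 g hgBB (l / 2)).trans (mul_le_mul' le_rfl hg2)
    rw [ENNReal.rpow_two] at h1
    have e : l * l = 4 * (l / 2) ^ 2 := by
      have : l = 2 * (l / 2) := (ENNReal.mul_div_cancel (by norm_num) (by norm_num)).symm
      calc l * l = (2 * (l / 2)) * (2 * (l / 2)) := by rw [← this]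
        _ = _ := by ring
    have h2 : l * (l * volume {x | l / 2 < Ts K g x}) ≤ l * (4 * C2 * 21 ^ n * I) := by
      calc _ = 4 * ((l / 2) ^ 2 * volume {x | l / 2 < Ts K g x}) := by rw [← mul_assoc, e]; ring
        _ ≤ 4 * (C2 * (21 ^ n * l * I)) := mul_le_mul' le_rfl h1
        _ = _ := by ring
    exact (ENNReal.mul_le_mul_iff_right hl0 hlt).1 h2
  have w3 : l * volume {x | x ∉ Ω ∧ l / 2 < Ts K (fun y => ∑' i, b i y) x} ≤ 2 * (Cb * (2 * I)) := by
    calc _ = 2 * ((l / 2) * volume {x | x ∉ Ω ∧ l / 2 < Ts K (fun y => ∑' i, b i y) x}) := by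
          rw [← mul_assoc, ENNReal.mul_div_cancel (by norm_num) (by norm_num)]
      _ ≤ _ := mul_le_mul' le_rfl hbd
  calc _ ≤ l * ((volume _ + volume _) + volume _) := mul_le_mul' le_rfl ((measure_mono hsub).trans
        ((measure_union_le _ _).trans (add_le_add (measure_union_le _ _) le_rfl)))
    _ = l * volume _ + l * volume _ + l * volume _ := by rw [mul_add, mul_add]
    _ ≤ 4 * C2 * 21 ^ n * I + 5 ^ n * I + 2 * (Cb * (2 * I)) := add_le_add (add_le_add w1 hΩ1) w3
    _ = _ := by ring

end kernel
end CZ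

/-! ### Part 10 -/
namespace CZ
variable {n : ℕ}
section kernel
variable {θ : ℝ → ℝ} {C₀ : ℝ} {K : Rn n → Rn n → ℝ}

def C3 (n : ℕ) (θ : ℝ → ℝ) (C₀ : ℝ) : ℝ≥0∞ :=
  ENNReal.ofReal C₀ * (6 ^ n * vv n) + SS θ * (2 ^ n * vv n)

set_option maxHeartbeats 1000000 in
lemma far_est (hθ : IsModulus θ) (hK : IsThetaKernel n θ C₀ K) {f : Rn n → ℝ} (hf : BB f)
    {x x' z : Rn n} {ρ : ℝ} (hρ : 0 < ρ) (hx : dist x x' ≤ ρ) (hz : dist z x' < 2 * ρ) :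
    Ts K ({y | 2 * ρ < dist x' y}.indicator f) x ≤ Ts K f x' + C3 n θ C₀ * MM volume (fun y => ‖f y‖ₑ) z := by
  refine iSup_le fun ε => iSup_le fun hε => ?_
  set ε' := max ε (2 * ρ) with hε'
  have hε'0 : 0 < ε' := lt_max_of_lt_left hε
  have h2ρ : 2 * ρ ≤ ε' := le_max_right _ _
  have hεε : ε ≤ ε' := le_max_left _ _
  set N0 : Set (Rn n) := {y | 2 * ρ < dist x' y} with hN0
  set N : Set (Rn n) := {y | ε' < dist x' y} with hN
  set S : Set (Rn n) := {y | ε < dist x y} with hS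
  have hN0m : MeasurableSet N0 := ms_far _ _
  have hNm : MeasurableSet N := ms_far _ _
  have hSm : MeasurableSet S := ms_far _ _
  have htri : ∀ y, dist x' y ≤ dist x y + ρ ∧ dist x y ≤ dist x' y + ρ := by
    intro y
    constructor
    · have := dist_triangle x' x y; rw [dist_comm x' x] at this; linarith
    · have := dist_triangle x x' y; linarith
  have hgm : Measurable (fun y => ‖f y‖ₑ) := hf.meas.enorm
  have e1 : ‖Tr K ε (N0.indicator f) x - ∫ y in N, K x y * f y‖ₑ ≤
      ENNReal.ofReal C₀ * (6 ^ n * vv n) * MM volume (fun y => ‖f y‖ₑ) z := by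
    have i1 : IntegrableOn (fun y => K x y * N0.indicator f y) S :=
      K_int hθ hK hε hSm (fun y hy => le_of_lt hy) (hf.ind hN0m).integrable
    have i2 : IntegrableOn (fun y => K x y * f y) N :=
      K_int hθ hK hρ hNm (fun y hy => by
        have : ε' < dist x' y := hy
        linarith [(htri y).1]) hf.integrable
    unfold Tr
    rw [← integral_indicator hSm, ← integral_indicator hNm,
      ← integral_sub (i1.integrable_indicator hSm) (i2.integrable_indicator hNm)]
    refine (enorm_integral_le_lintegral_enorm _).trans ?_
    have hb : ∫⁻ y in ball x' (3 * ε'), ‖f y‖ₑ ≤ volume (ball x' (3 * ε')) * MM volume (fun y => ‖f y‖ₑ) z :=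
      DMvol.le_MM _ (by rw [mem_ball]; linarith)
    calc _ ≤ ∫⁻ y, (ball x' (3 * ε')).indicator
          (fun y => ENNReal.ofReal C₀ * (ENNReal.ofReal (ε' / 2) ^ n)⁻¹ * ‖f y‖ₑ) y := by
          refine lintegral_mono fun y => ?_
          have key : ∀ v : ℝ, ‖v‖ₑ = ‖K x y * f y‖ₑ → ε' / 2 ≤ dist x y → dist x' y ≤ 2 * ε' →
              ‖v‖ₑ ≤ (ball x' (3 * ε')).indicator
                (fun y => ENNReal.ofReal C₀ * (ENNReal.ofReal (ε' / 2) ^ n)⁻¹ * ‖f y‖ₑ) y := by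
            intro v hv h1 h2
            rw [indicator_of_mem (by rw [mem_ball, dist_comm]; linarith), hv, enorm_mul]
            exact mul_le_mul' (Kbd hK (by positivity) h1) le_rfl
          by_cases hyS : y ∈ S <;> by_cases hyN : y ∈ N
          · have : y ∈ N0 := lt_of_le_of_lt h2ρ hyN
            simp [hyS, hyN, this]
          · rw [indicator_of_mem hyS, indicator_of_notMem hyN, sub_zero]
            by_cases hy0 : y ∈ N0
            · rw [indicator_of_mem hy0]
              have a1 : dist x' y ≤ ε' := not_lt.1 hyN
              have a2 : 2 * ρ < dist x' y := hy0
              have a3 : ε < dist x y := hyS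
              have a4 : ε' = ε := by
                rcases max_choice ε (2 * ρ) with h | h
                · exact h
                · exfalso; rw [hε', h] at a1; linarith
              exact key _ rfl (by linarith) (by linarith)
            · rw [indicator_of_notMem hy0]; simp
          · rw [indicator_of_notMem hyS, indicator_of_mem hyN, zero_sub]
            have a1 : ε' < dist x' y := hyN
            have a3 : dist x y ≤ ε := not_lt.1 hyS
            have a4 := (htri y).1
            exact key _ (enorm_neg _) (by linarith) (by linarith)
          · simp [hyS, hyN]
      _ = ENNReal.ofReal C₀ * (ENNReal.ofReal (ε' / 2) ^ n)⁻¹ * ∫⁻ y in ball x' (3 * ε'), ‖f y‖ₑ := by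
          rw [lintegral_indicator measurableSet_ball, lintegral_const_mul _ hgm]
      _ ≤ ENNReal.ofReal C₀ * (ENNReal.ofReal (ε' / 2) ^ n)⁻¹ * (volume (ball x' (3 * ε')) * MM volume (fun y => ‖f y‖ₑ) z) :=
          mul_le_mul' le_rfl hb
      _ = _ := by
          have h0 : ENNReal.ofReal (ε' / 2) ^ n ≠ 0 := pow_ne_zero _ (by simpa using hε'0)
          have ht : ENNReal.ofReal (ε' / 2) ^ n ≠ ⊤ := by finiteness
          rw [volb _ (by positivity), show 3 * ε' = 6 * (ε' / 2) by ring, ENNReal.ofReal_mul (by norm_num), mul_pow]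
          simp only [ENNReal.ofReal_ofNat]
          calc _ = ENNReal.ofReal C₀ * (6 ^ n * vv n) * MM volume (fun y => ‖f y‖ₑ) z *
                ((ENNReal.ofReal (ε' / 2) ^ n)⁻¹ * ENNReal.ofReal (ε' / 2) ^ n) := by ring
            _ = _ := by rw [ENNReal.inv_mul_cancel h0 ht, mul_one]
  have e2 : ‖(∫ y in N, K x' y * f y) - ∫ y in N, K x y * f y‖ₑ ≤
      SS θ * (2 ^ n * vv n) * MM volume (fun y => ‖f y‖ₑ) z :=
    (kdiff hθ hK hρ hx hNm (fun y hy => by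
      have : ε' < dist x' y := hy
      rw [dist_comm]; linarith) hf.integrable).trans (phi_MM θ hgm hρ hz)
  have e3 : ‖∫ y in N, K x' y * f y‖ₑ ≤ Ts K f x' :=
    le_iSup_of_le ε' (le_iSup_of_le hε'0 le_rfl)
  have e4 : Tr K ε (N0.indicator f) x = (∫ y in N, K x' y * f y) + ((Tr K ε (N0.indicator f) x - ∫ y in N, K x y * f y)
      + -((∫ y in N, K x' y * f y) - ∫ y in N, K x y * f y)) := by ring
  rw [e4]
  refine (enorm_add_le _ _).trans (add_le_add e3 ((enorm_add_le _ _).trans ?_))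
  rw [enorm_neg, C3, add_mul]
  exact add_le_add e1 e2

set_option maxHeartbeats 1000000 in
lemma local_good (hθ : IsModulus θ) (hK : IsThetaKernel n θ C₀ K)
    {C1 : ℝ≥0∞} (h11 : ∀ f : Rn n → ℝ, BB f → ∀ l, l * volume {x | l < Ts K f x} ≤ C1 * ∫⁻ x, ‖f x‖ₑ)
    {f : Rn n → ℝ} (hf : BB f) {l δ γ : ℝ≥0∞} (hl0 : l ≠ 0) (hlt : l ≠ ⊤) (hδ0 : δ ≠ 0) (hδt : δ ≠ ⊤)
    (hg1 : C3 n θ C₀ * γ ≤ δ) (hg2 : C1 * 43 ^ n * γ ≤ δ) {c x' : Rn n} {r : ℝ} (hr : 0 < r)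
    (hx' : dist x' c ≤ 20 * r) (hx'l : Ts K f x' ≤ l) :
    2 * volume (ball c r ∩ {x | (1 + 3 * δ) * l < Ts K f x ∧ MM volume (fun y => ‖f y‖ₑ) x ≤ γ * l}) ≤ volume (ball c r) := by
  set g : Rn n → ℝ≥0∞ := fun y => ‖f y‖ₑ with hg
  set E := {x | (1 + 3 * δ) * l < Ts K f x ∧ MM volume g x ≤ γ * l} with hE
  rcases (ball c r ∩ E).eq_empty_or_nonempty with h | ⟨z, hzB, hzE⟩
  · rw [h]; simp
  have hzM : MM volume g z ≤ γ * l := hzE.2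
  set N0 : Set (Rn n) := {y | 2 * (21 * r) < dist x' y} with hN0
  have hN0m : MeasurableSet N0 := ms_far _ _
  have hzd : dist z x' ≤ 21 * r := by
    have := dist_triangle z c x'
    rw [dist_comm c x'] at this
    have h2 : dist z c < r := hzB
    linarith
  have hn1 : BB (N0ᶜ.indicator f) := hf.ind hN0m.compl
  have hn2 : BB (N0.indicator f) := hf.ind hN0m
  have hint : ∫⁻ y, ‖N0ᶜ.indicator f y‖ₑ ≤ 43 ^ n * volume (ball c r) * (γ * l) := by
    calc _ = ∫⁻ y in N0ᶜ, g y := by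
          rw [← lintegral_indicator hN0m.compl]
          congr 1; ext y; rw [enorm_indicator_eq_indicator_enorm]
      _ ≤ ∫⁻ y in ball x' (43 * r), g y := by
          refine lintegral_mono_set fun y hy => ?_
          have : dist x' y ≤ 2 * (21 * r) := not_lt.1 hy
          rw [mem_ball, dist_comm]; linarith
      _ ≤ volume (ball x' (43 * r)) * MM volume g z := DMvol.le_MM _ (by rw [mem_ball]; linarith)
      _ ≤ volume (ball x' (43 * r)) * (γ * l) := mul_le_mul' le_rfl hzM
      _ = _ := by
          rw [volb _ (by positivity), volb _ hr, ENNReal.ofReal_mul (by norm_num), mul_pow]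
          simp only [ENNReal.ofReal_ofNat]; ring
  have hsub : ball c r ∩ E ⊆ {x | 2 * δ * l < Ts K (N0ᶜ.indicator f) x} := by
    rintro x ⟨hxB, hxE⟩
    have hxd : dist x x' ≤ 21 * r := by
      have := dist_triangle x c x'
      rw [dist_comm c x'] at this
      have h2 : dist x c < r := hxB
      linarith
    have h1 : Ts K f x ≤ Ts K (N0ᶜ.indicator f) x + Ts K (N0.indicator f) x :=
      Ts_add hθ hK hn1.integrable hn2.integrable (fun y => by
        by_cases hy : y ∈ N0 <;> simp [hy]) x
    have h2 := far_est hθ hK hf (x := x) (x' := x') (z := z) (ρ := 21 * r) (by positivity) hxd (by linarith)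
    have h3 : C3 n θ C₀ * MM volume g z ≤ δ * l :=
      calc _ ≤ C3 n θ C₀ * (γ * l) := mul_le_mul' le_rfl hzM
        _ = C3 n θ C₀ * γ * l := by ring
        _ ≤ _ := mul_le_mul' hg1 le_rfl
    by_contra hcon
    have hcon' : Ts K (N0ᶜ.indicator f) x ≤ 2 * δ * l := not_lt.1 hcon
    refine absurd hxE.1 (not_lt.2 ?_)
    calc _ ≤ _ := h1
      _ ≤ 2 * δ * l + (l + δ * l) := add_le_add hcon' (h2.trans (add_le_add hx'l h3))
      _ = _ := by ring
  have h4 := h11 _ hn1 (2 * δ * l)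
  have h5 : δ * l * (2 * volume (ball c r ∩ E)) ≤ δ * l * volume (ball c r) := by
    calc _ = 2 * δ * l * volume (ball c r ∩ E) := by ring
      _ ≤ 2 * δ * l * volume {x | 2 * δ * l < Ts K (N0ᶜ.indicator f) x} := mul_le_mul' le_rfl (measure_mono hsub)
      _ ≤ C1 * (43 ^ n * volume (ball c r) * (γ * l)) := h4.trans (mul_le_mul' le_rfl hint)
      _ = C1 * 43 ^ n * γ * (l * volume (ball c r)) := by ring
      _ ≤ δ * (l * volume (ball c r)) := mul_le_mul' hg2 le_rfl
      _ = _ := by ring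
  exact (ENNReal.mul_le_mul_iff_right (mul_ne_zero hδ0 hl0) (ENNReal.mul_ne_top hδt hlt)).1 h5

set_option maxHeartbeats 1000000 in
lemma good_lambda (hn : 0 < n) (hθ : IsModulus θ) (hK : IsThetaKernel n θ C₀ K)
    {p : ℝ} {w s : Rn n → ℝ≥0∞} {A : ℝ≥0∞} (hw : APW p w s A)
    {C1 : ℝ≥0∞} (hC1 : C1 ≠ ⊤) (h11 : ∀ f : Rn n → ℝ, BB f → ∀ l, l * volume {x | l < Ts K f x} ≤ C1 * ∫⁻ x, ‖f x‖ₑ)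
    {f : Rn n → ℝ} (hf : BB f) {l δ γ N : ℝ≥0∞} (hl0 : l ≠ 0) (hlt : l ≠ ⊤) (hδ0 : δ ≠ 0) (hδt : δ ≠ ⊤)
    (hg1 : C3 n θ C₀ * γ ≤ δ) (hg2 : C1 * 43 ^ n * γ ≤ δ) (hN : N = A * (5 ^ n) ^ p * (A * 2 ^ p)) :
    (volume.withDensity w) {x | l < Ts K f x} + N * (volume.withDensity w) {x | (1 + 3 * δ) * l < Ts K f x} ≤
      N * (volume.withDensity w) {x | l < Ts K f x} +
        N * (volume.withDensity w) {x | γ * l < MM volume (fun y => ‖f y‖ₑ) x} := by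
  have hp := hw.hp
  set g : Rn n → ℝ≥0∞ := fun y => ‖f y‖ₑ with hg
  set W := volume.withDensity w with hW
  set Ω := {x | l < Ts K f x} with hΩ
  set Ω1 := {x | (1 + 3 * δ) * l < Ts K f x} with hΩ1
  set E := {x | (1 + 3 * δ) * l < Ts K f x ∧ MM volume g x ≤ γ * l} with hE
  have hΩo : IsOpen Ω := isOpen_Ts hn hθ hK hf.integrable l
  have hΩ1m : MeasurableSet Ω1 := (isOpen_Ts hn hθ hK hf.integrable _).measurableSet
  have hEm : MeasurableSet E := by
    refine hΩ1m.inter (measurableSet_le (measurable_MM _ _) measurable_const)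
  have hΩ1s : Ω1 ⊆ Ω := fun x hx => lt_of_le_of_lt (le_mul_of_one_le_left zero_le (le_self_add : 1 ≤ 1 + 3 * δ)) hx
  have hfin : volume Ω ≠ ⊤ := by
    intro h
    have h1 := h11 f hf l
    rw [← hΩ, h, ENNReal.mul_top hl0] at h1
    exact absurd (top_le_iff.1 h1) (ENNReal.mul_ne_top hC1 hf.integrable.2.ne)
  obtain ⟨ι, _, c, r, Q, H⟩ := whitney hn hΩo hfin
  have hi : ∀ i, W (Q i) ≤ N * W (ball (c i) (r i) \ E) := by
    intro i
    have hr := H.pos i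
    obtain ⟨x', hx', hd⟩ := H.near i
    have h1 := local_good hθ hK h11 hf hl0 hlt hδ0 hδt hg1 hg2 hr hd (not_lt.1 hx')
    have hBt : volume (ball (c i) (r i)) ≠ ⊤ := measure_ball_lt_top.ne
    have h2 : volume (ball (c i) (r i)) ≤ 2 * volume (ball (c i) (r i) \ E) := by
      have e := measure_inter_add_diff (μ := (volume : Measure (Rn n))) (ball (c i) (r i)) hEm
      have : volume (ball (c i) (r i)) + volume (ball (c i) (r i)) ≤
          volume (ball (c i) (r i)) + 2 * volume (ball (c i) (r i) \ E) := by
        calc _ = 2 * volume (ball (c i) (r i)) := by ring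
          _ = 2 * volume (ball (c i) (r i) ∩ E) + 2 * volume (ball (c i) (r i) \ E) := by rw [← mul_add, e]
          _ ≤ _ := add_le_add h1 le_rfl
      exact (ENNReal.add_le_add_iff_left hBt).1 this
    have h3 := hw.sub (measurableSet_ball.diff hEm) hr (sdiff_subset (s := ball (c i) (r i)) (t := E))
    have hB0 : volume (ball (c i) (r i)) ≠ 0 := (measure_ball_pos _ _ hr).ne'
    have h4 : W (ball (c i) (r i)) ≤ A * 2 ^ p * W (ball (c i) (r i) \ E) := by
      have hv0 : volume (ball (c i) (r i) \ E) ≠ 0 := by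
        intro h; rw [h, mul_zero] at h2; exact hB0 (le_antisymm h2 zero_le)
      have hvt : volume (ball (c i) (r i) \ E) ≠ ⊤ := ne_top_of_le_ne_top hBt (measure_mono sdiff_subset)
      refine (ENNReal.mul_le_mul_iff_right (a := volume (ball (c i) (r i) \ E) ^ p)
        (by simp [ENNReal.rpow_eq_zero_iff, hv0, hvt]) (ENNReal.rpow_ne_top_of_nonneg (by linarith) hvt)).1 ?_
      calc _ ≤ _ := h3
        _ ≤ A * (2 * volume (ball (c i) (r i) \ E)) ^ p * W (ball (c i) (r i) \ E) := by
            gcongr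
        _ = _ := by rw [ENNReal.mul_rpow_of_nonneg _ _ (by linarith)]; ring
    calc W (Q i) ≤ W (ball (c i) (5 * r i)) := measure_mono (H.Qb i)
      _ ≤ A * (5 ^ n) ^ p * W (ball (c i) (r i)) := hw.dm.dbl _ _ hr
      _ ≤ A * (5 ^ n) ^ p * (A * 2 ^ p * W (ball (c i) (r i) \ E)) := mul_le_mul' le_rfl h4
      _ = _ := by rw [hN]; ring
  have h6 : W Ω ≤ N * W (Ω \ E) := by
    calc W Ω = W (⋃ i, Q i) := by rw [H.cov]
      _ ≤ ∑' i, W (Q i) := measure_iUnion_le _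
      _ ≤ ∑' i, N * W (ball (c i) (r i) \ E) := ENNReal.tsum_le_tsum hi
      _ = N * W (⋃ i, ball (c i) (r i) \ E) := by
          rw [ENNReal.tsum_mul_left, measure_iUnion (fun i j hij => (H.disj hij).mono sdiff_subset sdiff_subset)
            fun i => measurableSet_ball.diff hEm]
      _ ≤ _ := by
          gcongr
          refine iUnion_subset fun i => diff_subset_diff_left ?_
          exact (ball_subset_ball (by linarith [H.pos i])).trans (H.far i)
  have h7 : W (Ω \ E) ≤ W (Ω \ Ω1) + W {x | γ * l < MM volume g x} := by
    refine (measure_mono ?_).trans (measure_union_le _ _)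
    rintro x ⟨hx, hxE⟩
    by_cases h : x ∈ Ω1
    · right
      by_contra hc
      exact hxE ⟨h, not_lt.1 hc⟩
    · exact Or.inl ⟨hx, h⟩
  calc W Ω + N * W Ω1 ≤ N * (W (Ω \ Ω1) + W {x | γ * l < MM volume g x}) + N * W Ω1 :=
        add_le_add (h6.trans (mul_le_mul' le_rfl h7)) le_rfl
    _ = N * (W (Ω ∩ Ω1) + W (Ω \ Ω1)) + N * W {x | γ * l < MM volume g x} := by
        rw [inter_eq_right.2 hΩ1s]; ring
    _ = _ := by rw [measure_inter_add_diff _ hΩ1m]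

end kernel
end CZ

/-! ### Part 11 -/
namespace CZ
variable {n : ℕ}

lemma lt_inv_mul {a l F : ℝ≥0∞} (h0 : a ≠ 0) (ht : a ≠ ⊤) : l < a⁻¹ * F ↔ a * l < F := by
  rw [← not_le, ← not_le, not_iff_not, ← ENNReal.mul_le_mul_iff_right h0 ht (b := a⁻¹ * F), ← mul_assoc,
    ENNReal.mul_inv_cancel h0 ht, one_mul]

lemma lc_meas (μ : Measure (Rn n)) (h : Rn n → ℝ≥0∞) (s : ℝ) :
    Measurable fun t : ℝ => ENNReal.ofReal (s * t ^ (s - 1)) * μ {x | ENNReal.ofReal t < h x} := by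
  refine Measurable.mul (by fun_prop) (Antitone.measurable fun t u htu => measure_mono fun x hx => ?_)
  exact lt_of_le_of_lt (ENNReal.ofReal_le_ofReal htu) hx

lemma glam (μ : Measure (Rn n)) [SFinite μ] {F M : Rn n → ℝ≥0∞} (hF : Measurable F) (hM : Measurable M)
    {p : ℝ} (hp : 0 < p) {N a γ : ℝ≥0∞} (hNt : N ≠ ⊤) (ha0 : a ≠ 0) (hat : a ≠ ⊤) (hγ0 : γ ≠ 0) (hγt : γ ≠ ⊤)
    (H : ∀ l, l ≠ 0 → l ≠ ⊤ → μ {x | l < F x} + N * μ {x | a * l < F x} ≤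
      N * μ {x | l < F x} + N * μ {x | γ * l < M x})
    (hNa : N ≤ N * a⁻¹ ^ p + 2⁻¹) (hX : ∫⁻ x, F x ^ p ∂μ ≠ ⊤) :
    ∫⁻ x, F x ^ p ∂μ ≤ 2 * (N * γ⁻¹ ^ p) * ∫⁻ x, M x ^ p ∂μ := by
  set X := ∫⁻ x, F x ^ p ∂μ with hXd
  have e1 := layercake μ hF hp
  have e2 := layercake μ (hF.const_mul a⁻¹) hp
  have e3 := layercake μ (hM.const_mul γ⁻¹) hp
  have e2' : ∫⁻ x, (a⁻¹ * F x) ^ p ∂μ = a⁻¹ ^ p * X := by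
    rw [hXd, ← lintegral_const_mul _ (hF.pow_const _)]
    simp_rw [ENNReal.mul_rpow_of_nonneg _ _ hp.le]
  have e3' : ∫⁻ x, (γ⁻¹ * M x) ^ p ∂μ = γ⁻¹ ^ p * ∫⁻ x, M x ^ p ∂μ := by
    rw [← lintegral_const_mul _ (hM.pow_const _)]
    simp_rw [ENNReal.mul_rpow_of_nonneg _ _ hp.le]
  have key : X + N * (a⁻¹ ^ p * X) ≤ N * X + N * (γ⁻¹ ^ p * ∫⁻ x, M x ^ p ∂μ) := by
    rw [← e2', ← e3', hXd, e1, e2, e3, ← lintegral_const_mul' _ _ hNt, ← lintegral_const_mul' _ _ hNt,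
      ← lintegral_const_mul' _ _ hNt, ← lintegral_add_left (lc_meas μ F p),
      ← lintegral_add_left ((lc_meas μ F p).const_mul N)]
    refine setLIntegral_mono' measurableSet_Ioi fun t ht => ?_
    have := H (ENNReal.ofReal t) (by simpa using ht) ENNReal.ofReal_ne_top
    simp only [lt_inv_mul ha0 hat, lt_inv_mul hγ0 hγt]
    have h2 := mul_le_mul' (le_refl (ENNReal.ofReal (p * t ^ (p - 1)))) this
    refine le_trans (le_of_eq ?_) (h2.trans (le_of_eq ?_)) <;> ring
  have ht : N * (a⁻¹ ^ p * X) ≠ ⊤ := by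
    refine ENNReal.mul_ne_top hNt (ENNReal.mul_ne_top (ENNReal.rpow_ne_top_of_nonneg hp.le ?_) hX)
    exact ENNReal.inv_ne_top.2 ha0
  set Z := N * (γ⁻¹ ^ p * ∫⁻ x, M x ^ p ∂μ) with hZ
  have k2 : X ≤ 2⁻¹ * X + Z := by
    refine (ENNReal.add_le_add_iff_right ht).1 (key.trans ?_)
    calc N * X + Z ≤ (N * a⁻¹ ^ p + 2⁻¹) * X + Z := by gcongr
      _ = _ := by ring
  have k3 : 2 * X ≤ X + 2 * Z := by
    calc 2 * X ≤ 2 * (2⁻¹ * X + Z) := by gcongr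
      _ = 2 * 2⁻¹ * X + 2 * Z := by ring
      _ = _ := by rw [ENNReal.mul_inv_cancel (by norm_num) (by norm_num), one_mul]
  have k4 : X ≤ 2 * Z := by
    rw [two_mul] at k3
    exact (ENNReal.add_le_add_iff_left hX).1 k3
  refine k4.trans (le_of_eq ?_)
  rw [hZ]; ring

lemma choose_a {N : ℝ≥0∞} (hN : N ≠ ⊤) {p : ℝ} (hp : 0 < p) :
    ∃ δ : ℝ≥0∞, δ ≠ 0 ∧ δ ≠ ⊤ ∧ N ≤ N * (1 + 3 * δ)⁻¹ ^ p + 2⁻¹ := by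
  have hc : Tendsto (fun δ : ℝ => N.toReal * ((1 + 3 * δ)⁻¹) ^ p + 2⁻¹) (𝓝[>] 0) (𝓝 (N.toReal + 2⁻¹)) := by
    have : ContinuousAt (fun δ : ℝ => N.toReal * ((1 + 3 * δ)⁻¹) ^ p + 2⁻¹) 0 := by
      refine (continuousAt_const.mul (ContinuousAt.rpow_const (ContinuousAt.inv₀ (by fun_prop) (by simp)) (Or.inr hp.le))).add continuousAt_const
    have h2 := this.tendsto
    simp only [mul_zero, add_zero, inv_one, Real.one_rpow, mul_one] at h2
    exact h2.mono_left nhdsWithin_le_nhds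
  have h1 : ∀ᶠ δ : ℝ in 𝓝[>] 0, N.toReal < N.toReal * ((1 + 3 * δ)⁻¹) ^ p + 2⁻¹ :=
    hc.eventually_const_lt (by norm_num)
  obtain ⟨δ, h2, h3⟩ := (h1.and self_mem_nhdsWithin).exists
  have hδ : 0 < δ := h3
  refine ⟨ENNReal.ofReal δ, by simpa using hδ, ENNReal.ofReal_ne_top, ?_⟩
  have e : (1 + 3 * ENNReal.ofReal δ)⁻¹ ^ p = ENNReal.ofReal (((1 + 3 * δ)⁻¹) ^ p) := by
    rw [← ENNReal.ofReal_rpow_of_pos (by positivity), ENNReal.ofReal_inv_of_pos (by positivity),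
      ENNReal.ofReal_add (by norm_num) (by positivity), ENNReal.ofReal_mul (by norm_num)]
    simp
  have e2 : (2⁻¹ : ℝ≥0∞) = ENNReal.ofReal 2⁻¹ := by
    rw [ENNReal.ofReal_inv_of_pos (by norm_num)]; simp
  rw [e, e2]
  conv_lhs => rw [← ENNReal.ofReal_toReal hN]
  conv_rhs => rw [← ENNReal.ofReal_toReal hN]
  rw [← ENNReal.ofReal_mul ENNReal.toReal_nonneg, ← ENNReal.ofReal_add (by positivity) (by norm_num)]
  exact ENNReal.ofReal_le_ofReal h2.le

lemma choose_γ {δ a b : ℝ≥0∞} (h0 : δ ≠ 0) (hδ : δ ≠ ⊤) (ha : a ≠ ⊤) (hb : b ≠ ⊤) :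
    ∃ γ : ℝ≥0∞, γ ≠ 0 ∧ γ ≠ ⊤ ∧ a * γ ≤ δ ∧ b * γ ≤ δ := by
  have hs0 : a + b + 1 ≠ 0 := by simp
  have hst : a + b + 1 ≠ ⊤ := by finiteness
  refine ⟨δ * (a + b + 1)⁻¹, mul_ne_zero h0 (ENNReal.inv_ne_zero.2 hst), ENNReal.mul_ne_top hδ (ENNReal.inv_ne_top.2 hs0), ?_, ?_⟩
  all_goals
    refine le_trans (mul_le_mul' (b := a + b + 1) ?_ le_rfl) (le_of_eq ?_)
    · first
        | exact le_trans le_self_add le_self_add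
        | exact le_trans le_add_self le_self_add
    · rw [mul_comm δ, ← mul_assoc, ENNReal.mul_inv_cancel hs0 hst, one_mul]

section kernel
variable {θ : ℝ → ℝ} {C₀ : ℝ} {K : Rn n → Rn n → ℝ}

lemma Ts_off (hK : IsThetaKernel n θ C₀ K) {f : Rn n → ℝ} {R : ℝ} (hR : 0 < R)
    (hs : ∀ y, f y ≠ 0 → ‖y‖ ≤ R) {x : Rn n} (hx : 2 * R ≤ ‖x‖) :
    Ts K f x ≤ ENNReal.ofReal C₀ * (4 ^ n * vv n) * MM volume (fun y => ‖f y‖ₑ) x := by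
  refine iSup_le fun ε => iSup_le fun hε => ?_
  have hx0 : 0 < ‖x‖ := by linarith
  refine (Tr_le hK (a := ‖x‖ / 2) (by positivity) fun y hy => ?_).trans ?_
  · rw [dist_eq_norm]
    have := norm_sub_norm_le x y
    have := hs y hy
    linarith
  have h1 : ∫⁻ y, ‖f y‖ₑ ≤ volume (ball (0 : Rn n) (2 * ‖x‖)) * MM volume (fun y => ‖f y‖ₑ) x := by
    refine le_trans ?_ (DMvol.le_MM _ (by rw [mem_ball_zero_iff]; linarith))
    rw [← lintegral_indicator measurableSet_ball]
    refine lintegral_mono fun y => ?_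
    by_cases hy : f y = 0
    · simp [hy]
    · rw [indicator_of_mem]
      rw [mem_ball_zero_iff]; have := hs y hy; linarith
  refine (mul_le_mul' le_rfl h1).trans (le_of_eq ?_)
  have h0 : ENNReal.ofReal (‖x‖ / 2) ^ n ≠ 0 := pow_ne_zero _ (by rw [Ne, ENNReal.ofReal_eq_zero]; linarith)
  have ht : ENNReal.ofReal (‖x‖ / 2) ^ n ≠ ⊤ := by finiteness
  rw [volb _ (by positivity), show 2 * ‖x‖ = 4 * (‖x‖ / 2) by ring, ENNReal.ofReal_mul (by norm_num), mul_pow]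
  simp only [ENNReal.ofReal_ofNat]
  calc _ = ENNReal.ofReal C₀ * (4 ^ n * vv n) * MM volume (fun y => ‖f y‖ₑ) x *
        ((ENNReal.ofReal (‖x‖ / 2) ^ n)⁻¹ * ENNReal.ofReal (‖x‖ / 2) ^ n) := by ring
    _ = _ := by rw [ENNReal.inv_mul_cancel h0 ht, mul_one]

lemma C3_ne (hθ : IsModulus θ) (hD : DiniCondition θ) : C3 n θ C₀ ≠ ⊤ := by
  have h1 : SS θ ≠ ⊤ := dini_sum hθ hD
  have h2 := vv_ne_top (n := n)
  unfold C3
  finiteness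

set_option maxHeartbeats 1000000 in
theorem strongBB (hn : 0 < n) (hθ : IsModulus θ) (hD : DiniCondition θ) (hK : IsThetaKernel n θ C₀ K)
    {T : Lp ℝ 2 (volume : Measure (Rn n)) →L[ℝ] Lp ℝ 2 (volume : Measure (Rn n))} (hT : IsCZO n K T)
    {p : ℝ} {w s : Rn n → ℝ≥0∞} {A : ℝ≥0∞} (hw : APW p w s A) :
    ∃ C : ℝ≥0∞, C ≠ ⊤ ∧ ∀ f : Rn n → ℝ, BB f →
      ∫⁻ x, Ts K f x ^ p ∂(volume.withDensity w) ≤ C * ∫⁻ x, ‖f x‖ₑ ^ p ∂(volume.withDensity w) := by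
  have hp := hw.hp
  have hp0 : 0 < p := by linarith
  obtain ⟨C1, hC1, h11⟩ := weak11 hn hθ hD hK hT
  obtain ⟨CM, hCM, hM⟩ := hw.MW
  obtain ⟨N, hN⟩ : ∃ N, N = A * (5 ^ n) ^ p * (A * 2 ^ p) := ⟨_, rfl⟩
  have hNt : N ≠ ⊤ := by
    rw [hN]
    have := hw.A0
    exact ENNReal.mul_ne_top (ENNReal.mul_ne_top this (ENNReal.rpow_ne_top_of_nonneg hp0.le (by finiteness)))
      (ENNReal.mul_ne_top this (ENNReal.rpow_ne_top_of_nonneg hp0.le (by finiteness)))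
  obtain ⟨δ, hδ0, hδt, hNa⟩ := choose_a hNt hp0
  obtain ⟨γ, hγ0, hγt, hg1, hg2⟩ := choose_γ (a := C3 n θ C₀) (b := C1 * 43 ^ n) hδ0 hδt (C3_ne hθ hD) (by finiteness)
  refine ⟨2 * (N * γ⁻¹ ^ p) * CM, ?_, fun f hf => ?_⟩
  · have : γ⁻¹ ^ p ≠ ⊤ := ENNReal.rpow_ne_top_of_nonneg hp0.le (ENNReal.inv_ne_top.2 hγ0)
    finiteness
  set W := volume.withDensity w with hW
  set g : Rn n → ℝ≥0∞ := fun y => ‖f y‖ₑ with hg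
  have hgm : Measurable g := hf.meas.enorm
  have hTm : Measurable (Ts K f) := measurable_Ts hn hθ hK hf.integrable
  obtain ⟨B, hB⟩ := hf.bdd
  obtain ⟨R0, hR0⟩ := hf.supp
  obtain ⟨R, hR, hRs⟩ : ∃ R, 0 < R ∧ ∀ y, f y ≠ 0 → ‖y‖ ≤ R :=
    ⟨max R0 1, by positivity, fun y hy => (hR0 y hy).trans (le_max_left _ _)⟩
  have hgf : ∫⁻ x, g x ^ p ∂W ≠ ⊤ := by
    have : ∫⁻ x, g x ^ p ∂W ≤ ∫⁻ x, (ball (0 : Rn n) (2 * R)).indicator (fun _ => ENNReal.ofReal B ^ p) x ∂W := by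
      refine lintegral_mono fun x => ?_
      by_cases hx : f x = 0
      · simp [hg, hx, hp0]
      · rw [indicator_of_mem (by rw [mem_ball_zero_iff]; have := hRs x hx; linarith)]
        simp only [hg]
        gcongr
        rw [Real.enorm_eq_ofReal_abs]
        exact ENNReal.ofReal_le_ofReal (hB x)
    refine ne_top_of_le_ne_top ?_ this
    rw [lintegral_indicator_const measurableSet_ball]
    exact ENNReal.mul_ne_top (ENNReal.rpow_ne_top_of_nonneg hp0.le (by finiteness)) (hw.Wf _ _)
  have hMf : ∫⁻ x, MM volume g x ^ p ∂W ≠ ⊤ := ne_top_of_le_ne_top (ENNReal.mul_ne_top hCM hgf) (hM g hgm)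
  have hk : ∀ k : ℕ, ∫⁻ x, (min (Ts K f x) k) ^ p ∂W ≤ 2 * (N * γ⁻¹ ^ p) * ∫⁻ x, MM volume g x ^ p ∂W := by
    intro k
    refine glam W (hTm.min measurable_const) (measurable_MM _ _) hp0 hNt (a := 1 + 3 * δ) (by simp) (by finiteness) hγ0 hγt ?_ hNa ?_
    · intro l hl0 hlt
      by_cases hlk : l < k
      · have e1 : {x | l < min (Ts K f x) k} = {x | l < Ts K f x} := by
          ext x; simp [hlk]
        have e2 : {x | (1 + 3 * δ) * l < min (Ts K f x) k} ⊆ {x | (1 + 3 * δ) * l < Ts K f x} :=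
          by
          intro x hx
          simp only [mem_ofPred_eq] at hx ⊢
          exact lt_of_lt_of_le hx (min_le_left _ _)
        rw [e1]
        exact le_trans (by gcongr) (good_lambda hn hθ hK hw hC1 h11 hf hl0 hlt hδ0 hδt hg1 hg2 hN)
      · have e1 : {x | l < min (Ts K f x) k} = ∅ := by
          ext x; simp only [mem_ofPred_eq, mem_empty_iff_false, iff_false, not_lt]
          exact (min_le_right _ _).trans (not_lt.1 hlk)
        have e2 : {x | (1 + 3 * δ) * l < min (Ts K f x) k} = ∅ := by
          rw [← subset_empty_iff, ← e1]
          exact fun x hx => lt_of_le_of_lt (le_mul_of_one_le_left zero_le (le_self_add : 1 ≤ 1 + 3 * δ)) hx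
        rw [e1, e2]; simp
    · have : ∫⁻ x, (min (Ts K f x) k) ^ p ∂W ≤ ∫⁻ x, ((ball (0 : Rn n) (2 * R)).indicator (fun _ => (k : ℝ≥0∞) ^ p) x
          + (ENNReal.ofReal C₀ * (4 ^ n * vv n)) ^ p * MM volume g x ^ p) ∂W := by
        refine lintegral_mono fun x => ?_
        by_cases hx : x ∈ ball (0 : Rn n) (2 * R)
        · rw [indicator_of_mem hx]
          exact le_trans (ENNReal.rpow_le_rpow (min_le_right _ _) hp0.le) le_self_add
        · rw [indicator_of_notMem hx, zero_add, ← ENNReal.mul_rpow_of_nonneg _ _ hp0.le]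
          refine ENNReal.rpow_le_rpow ((min_le_left _ _).trans (Ts_off hK hR hRs ?_)) hp0.le
          rw [mem_ball_zero_iff] at hx
          exact not_lt.1 hx
      refine ne_top_of_le_ne_top ?_ this
      rw [lintegral_add_left (measurable_const.indicator measurableSet_ball), lintegral_indicator_const measurableSet_ball,
        lintegral_const_mul _ ((measurable_MM _ _).pow_const _)]
      have h2 := vv_ne_top (n := n)
      refine ENNReal.add_ne_top.2 ⟨ENNReal.mul_ne_top (ENNReal.rpow_ne_top_of_nonneg hp0.le (by finiteness)) (hw.Wf _ _),
        ENNReal.mul_ne_top (ENNReal.rpow_ne_top_of_nonneg hp0.le (by finiteness)) hMf⟩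
  have hsup : ∀ x, Ts K f x ^ p ≤ liminf (fun k : ℕ => (min (Ts K f x) k) ^ p) atTop := by
    intro x
    have ht : Tendsto (fun k : ℕ => min (Ts K f x) (k : ℝ≥0∞)) atTop (𝓝 (Ts K f x)) := by
      have := (tendsto_const_nhds (x := Ts K f x)).min ENNReal.tendsto_nat_nhds_top
      simpa using this
    have h2 := ((ENNReal.continuous_rpow_const (y := p)).tendsto (Ts K f x)).comp ht
    exact le_of_eq h2.liminf_eq.symm
  calc ∫⁻ x, Ts K f x ^ p ∂W ≤ ∫⁻ x, liminf (fun k : ℕ => (min (Ts K f x) k) ^ p) atTop ∂W := lintegral_mono hsup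
    _ ≤ liminf (fun k : ℕ => ∫⁻ x, (min (Ts K f x) k) ^ p ∂W) atTop :=
        lintegral_liminf_le fun k => (hTm.min measurable_const).pow_const _
    _ ≤ 2 * (N * γ⁻¹ ^ p) * ∫⁻ x, MM volume g x ^ p ∂W := by
        refine liminf_le_of_le (by isBoundedDefault) fun b hb => ?_
        obtain ⟨k, h⟩ := hb.exists
        exact h.trans (hk k)
    _ ≤ 2 * (N * γ⁻¹ ^ p) * (CM * ∫⁻ x, g x ^ p ∂W) := mul_le_mul' le_rfl (hM g hgm)
    _ = _ := by ring

end kernel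
end CZ

/-! ### Part 12 -/
namespace CZ
variable {n : ℕ}

def cut (f : Rn n → ℝ) (k : ℕ) : Rn n → ℝ := {y | |f y| ≤ k ∧ ‖y‖ ≤ k}.indicator f

lemma cut_ms {f : Rn n → ℝ} (hf : Measurable f) (k : ℕ) : MeasurableSet {y | |f y| ≤ k ∧ ‖y‖ ≤ k} :=
  (measurableSet_le hf.abs measurable_const).inter (measurableSet_le measurable_norm measurable_const)

lemma cut_BB {f : Rn n → ℝ} (hf : Measurable f) (k : ℕ) : BB (cut f k) where
  meas := hf.indicator (cut_ms hf k)
  bdd := ⟨k, fun x => by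
    unfold cut
    by_cases h : x ∈ {y | |f y| ≤ k ∧ ‖y‖ ≤ k}
    · rw [indicator_of_mem h]; exact h.1
    · rw [indicator_of_notMem h]; simp⟩
  supp := ⟨k, fun x hx => by
    by_contra h
    exact hx (indicator_of_notMem (fun h' => h h'.2) _)⟩

lemma cut_le (f : Rn n → ℝ) (k : ℕ) (x : Rn n) : ‖cut f k x‖ₑ ≤ ‖f x‖ₑ := by
  unfold cut
  rw [enorm_indicator_eq_indicator_enorm]
  exact indicator_le_self _ _ _

lemma cut_ev (f : Rn n → ℝ) (x : Rn n) : ∀ᶠ k : ℕ in atTop, cut f k x = f x := by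
  obtain ⟨k0, hk0⟩ := exists_nat_ge (max |f x| ‖x‖)
  filter_upwards [eventually_ge_atTop k0] with k hk
  have : (k0 : ℝ) ≤ k := by exact_mod_cast hk
  exact indicator_of_mem (s := {y | |f y| ≤ k ∧ ‖y‖ ≤ k})
    ⟨(le_max_left _ _).trans (hk0.trans this), (le_max_right _ _).trans (hk0.trans this)⟩ f

lemma Tr_liminf (K : Rn n → Rn n → ℝ) {f : Rn n → ℝ} (hf : Measurable f) {ε : ℝ} (hε : 0 < ε) (x : Rn n) :
    ‖Tr K ε f x‖ₑ ≤ liminf (fun k : ℕ => Ts K (cut f k) x) atTop := by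
  by_cases hi : IntegrableOn (fun y => K x y * f y) {y | ε < dist x y}
  · have hc : ∀ k y, K x y * cut f k y = {y | |f y| ≤ k ∧ ‖y‖ ≤ k}.indicator (fun y => K x y * f y) y := by
      intro k y
      unfold cut
      by_cases h : y ∈ {y | |f y| ≤ k ∧ ‖y‖ ≤ k}
      · rw [indicator_of_mem h, indicator_of_mem h]
      · rw [indicator_of_notMem h, indicator_of_notMem h, mul_zero]
    have ht : Tendsto (fun k : ℕ => Tr K ε (cut f k) x) atTop (𝓝 (Tr K ε f x)) := by
      unfold Tr
      refine tendsto_integral_of_dominated_convergence (fun y => ‖K x y * f y‖) (fun k => ?_) hi.norm (fun k => ?_) ?_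
      · simp_rw [hc]
        exact hi.aestronglyMeasurable.indicator (cut_ms hf k)
      · refine ae_of_all _ fun y => ?_
        rw [hc]
        exact norm_indicator_le_norm_self _ _
      · refine ae_of_all _ fun y => ?_
        refine tendsto_const_nhds.congr' ?_
        filter_upwards [cut_ev f y] with k hk
        rw [hk]
    have h2 : Tendsto (fun k : ℕ => ‖Tr K ε (cut f k) x‖ₑ) atTop (𝓝 ‖Tr K ε f x‖ₑ) := ht.enorm
    rw [← h2.liminf_eq]
    refine liminf_le_liminf (Eventually.of_forall fun k => ?_)
    exact le_iSup_of_le ε (le_iSup_of_le hε le_rfl)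
  · unfold Tr
    rw [integral_undef hi]; simp

section kernel
variable {θ : ℝ → ℝ} {C₀ : ℝ} {K : Rn n → Rn n → ℝ}

lemma final_meas (hn : 0 < n) (hθ : IsModulus θ) (hK : IsThetaKernel n θ C₀ K)
    {p : ℝ} (hp : 0 < p) {W : Measure (Rn n)} {C : ℝ≥0∞}
    (H : ∀ f : Rn n → ℝ, BB f → ∫⁻ x, Ts K f x ^ p ∂W ≤ C * ∫⁻ x, ‖f x‖ₑ ^ p ∂W)
    {f : Rn n → ℝ} (hf : Measurable f) :
    ∫⁻ x, (⨆ j : ℤ, ‖Tr K ((2:ℝ) ^ j) f x‖ₑ) ^ p ∂W ≤ C * ∫⁻ x, ‖f x‖ₑ ^ p ∂W := by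
  have h1 : ∀ x, (⨆ j : ℤ, ‖Tr K ((2:ℝ) ^ j) f x‖ₑ) ^ p ≤ liminf (fun k : ℕ => Ts K (cut f k) x ^ p) atTop := by
    intro x
    have h2 : (⨆ j : ℤ, ‖Tr K ((2:ℝ) ^ j) f x‖ₑ) ≤ liminf (fun k : ℕ => Ts K (cut f k) x) atTop :=
      iSup_le fun j => Tr_liminf K hf (by positivity) x
    have h3 := (ENNReal.orderIsoRpow p hp).liminf_apply (f := atTop) (u := fun k : ℕ => Ts K (cut f k) x)
    simp only [ENNReal.orderIsoRpow_apply] at h3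
    rw [← h3]
    exact ENNReal.rpow_le_rpow h2 hp.le
  refine (lintegral_mono h1).trans ?_
  refine (lintegral_liminf_le fun k => (measurable_Ts hn hθ hK (cut_BB hf k).integrable).pow_const _).trans ?_
  refine liminf_le_of_le (by isBoundedDefault) fun b hb => ?_
  obtain ⟨k, h⟩ := hb.exists
  refine h.trans ((H _ (cut_BB hf k)).trans (mul_le_mul' le_rfl (lintegral_mono fun x => ?_)))
  exact ENNReal.rpow_le_rpow (cut_le f k x) hp.le

end kernel

theorem main (p : ℝ) (hp : 1 < p)
    (ω : Rn n → ℝ) (hω : IsAp n p ω)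
    (θ : ℝ → ℝ) (hθ : IsModulus θ) (hDini : DiniCondition θ)
    (C₀ : ℝ) (K : Rn n → Rn n → ℝ) (hK : IsThetaKernel n θ C₀ K)
    (T : Lp ℝ 2 (volume : Measure (Rn n)) →L[ℝ] Lp ℝ 2 (volume : Measure (Rn n)))
    (hT : IsCZO n K T) :
    ∃ C : ℝ, 0 < C ∧
      ∀ f : Rn n → ℝ, MemLp f (ENNReal.ofReal p) (wMeasure n ω) →
        wLpNorm p (wMeasure n ω)
            (fun x => ⨆ j : ℤ, ENNReal.ofReal
              |∫ y in {y : Rn n | (2:ℝ) ^ j < dist x y}, K x y * f y|) ≤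
          ENNReal.ofReal C * eLpNorm f (ENNReal.ofReal p) (wMeasure n ω) := by
  have hp0 : 0 < p := by linarith
  rcases Nat.eq_zero_or_pos n with h0 | hn
  · refine ⟨1, one_pos, fun f _ => ?_⟩
    subst h0
    have : ∀ (x : Rn 0) (j : ℤ), {y : Rn 0 | (2:ℝ) ^ j < dist x y} = ∅ := by
      intro x j
      ext y
      simp only [mem_ofPred_eq, mem_empty_iff_false, iff_false, not_lt]
      rw [Subsingleton.elim x y, dist_self]
      positivity
    unfold wLpNorm
    simp [this, hp0]
  obtain ⟨w, s, A, hw, hW⟩ := exists_APW hp hω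
  rw [hW]
  obtain ⟨C, hC, H⟩ := strongBB hn hθ hDini hK hT hw
  set W := volume.withDensity w with hWd
  have hac : (volume : Measure (Rn n)) ≪ W :=
    withDensity_absolutelyContinuous' hw.wm.aemeasurable (ae_of_all _ hw.w0)
  have hCp : C ^ (1 / p) ≠ ⊤ := ENNReal.rpow_ne_top_of_nonneg (by positivity) hC
  refine ⟨(C ^ (1 / p)).toReal + 1, by positivity, fun f hf => ?_⟩
  set f0 := hf.1.mk f with hf0
  have hf0m : Measurable f0 := hf.1.stronglyMeasurable_mk.measurable
  have hae : f =ᵐ[W] f0 := hf.1.ae_eq_mk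
  have haev : f =ᵐ[volume] f0 := hac.ae_eq hae
  have h1 := final_meas hn hθ hK hp0 H hf0m
  have e1 : ∀ (x : Rn n) (j : ℤ), ENNReal.ofReal |∫ y in {y : Rn n | (2:ℝ) ^ j < dist x y}, K x y * f y|
      = ‖Tr K ((2:ℝ) ^ j) f0 x‖ₑ := by
    intro x j
    rw [Real.enorm_eq_ofReal_abs, Tr]
    congr 2
    refine integral_congr_ae (ae_restrict_of_ae ?_)
    filter_upwards [haev] with y hy
    rw [hy]
  have e2 : ∫⁻ x, ‖f0 x‖ₑ ^ p ∂W = ∫⁻ x, ‖f x‖ₑ ^ p ∂W := by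
    refine lintegral_congr_ae ?_
    filter_upwards [hae] with y hy
    rw [hy]
  rw [e2] at h1
  unfold wLpNorm
  simp_rw [e1]
  rw [eLpNorm_eq_lintegral_rpow_enorm_toReal (by simpa using hp0) ENNReal.ofReal_ne_top, ENNReal.toReal_ofReal hp0.le]
  calc _ ≤ (C * ∫⁻ x, ‖f x‖ₑ ^ p ∂W) ^ (1 / p) := ENNReal.rpow_le_rpow h1 (by positivity)
    _ = C ^ (1 / p) * (∫⁻ x, ‖f x‖ₑ ^ p ∂W) ^ (1 / p) := ENNReal.mul_rpow_of_nonneg _ _ (by positivity)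
    _ ≤ _ := by
        refine mul_le_mul' ?_ le_rfl
        conv_lhs => rw [← ENNReal.ofReal_toReal hCp]
        exact ENNReal.ofReal_le_ofReal (by linarith)

end CZ

/-- For `1 < p < ∞`, `ω ∈ A_p`, `T` a θ-type Calderón–Zygmund operator
with Dini modulus and `T_j f(x) = ∫_{|x−y|>2^j} K x y f y dy`, there is `C` such that
`‖sup_j |T_j f|‖_{L^p(ω)} ≤ C ‖f‖_{L^p(ω)}` for all `f ∈ L^p(ω)`. -/
theorem statement13 {n : ℕ} (p : ℝ) (hp : 1 < p)
    (ω : Rn n → ℝ) (hω : IsAp n p ω)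
    (θ : ℝ → ℝ) (hθ : IsModulus θ) (hDini : DiniCondition θ)
    (C₀ : ℝ) (K : Rn n → Rn n → ℝ) (hK : IsThetaKernel n θ C₀ K)
    (T : Lp ℝ 2 (volume : Measure (Rn n)) →L[ℝ] Lp ℝ 2 (volume : Measure (Rn n)))
    (hT : IsCZO n K T) :
    ∃ C : ℝ, 0 < C ∧
      ∀ f : Rn n → ℝ, MemLp f (ENNReal.ofReal p) (wMeasure n ω) →
        wLpNorm p (wMeasure n ω)
            (fun x => ⨆ j : ℤ, ENNReal.ofReal
              |∫ y in {y : Rn n | (2:ℝ) ^ j < dist x y}, K x y * f y|) ≤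
          ENNReal.ofReal C * eLpNorm f (ENNReal.ofReal p) (wMeasure n ω) := by
  exact CZ.main p hp ω hω θ hθ hDini C₀ K hK T hT
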